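/- Let V be a vector space, 1 ∈ V, L(−1) a linear operator on V, U a subset of V, and Y₀: U → Hom(V, V((x))), u ↦ u(x) = Σ_{n∈ℤ} u_n x^{−n−1}, a map. Assume: (i) L(−1)1 = 0; (ii) [L(−1), u(x)] = (d/dx) u(x) for u ∈ U; (iii) u(x)1 ∈ V[[x]] with lim_{x→0} u(x)1 = u for u ∈ U; (iv) the subset Y₀(U) = {u(x) : u ∈ U} of ℰ(V) is quasi compatible; (v) V = span{ u¹_{n₁} ⋯ uʳ_{n_r} 1 : r ∈ ℕ, uⁱ ∈ U, n_i ∈ ℤ }; and (vi) there exists a linear map ψ from V into ⟨Y₀(U)⟩ with ψ(1) = 1_V (the identity operator) and ψ(u_n v) = u(x)_n ψ(v) for u ∈ U, v ∈ V, n ∈ ℤ. Then Y₀ extends uniquely to a linear map Y: V → Hom(V, V((x))) such that (V, Y, 1) carries the structure of a nonlocal vertex algebra. Moreover, if Y₀(U) is 𝒮-local, then V is a weak quantum vertex algebra. -/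

import Mathlib

noncomputable section

open Classical

namespace NVA

/-! ### The space ℰ(W) = Hom(W, W((x))), coefficient-indexed by modes:
`a w n` is the mode `a_n` applied to `w`, where `a(x)w = ∑ (a_n w) x^{-n-1}`.
Lower truncation of `a(x)w` in powers of `x` means `a_n w = 0` for `n` large. -/

variable (W : Type*) [AddCommGroup W] [Module ℂ W]

/-- `ℰ(W) = Hom(W, W((x)))` as a submodule of `Hom(W, W[[x^{±1}]])`. -/
def EWsub : Submodule ℂ (W →ₗ[ℂ] (ℤ → W)) where
  carrier := {a | ∀ w : W, ∃ N : ℤ, ∀ n : ℤ, N ≤ n → a w n = 0}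
  add_mem' := by
    intro a b ha hb w
    obtain ⟨N, hN⟩ := ha w
    obtain ⟨M, hM⟩ := hb w
    refine ⟨max N M, fun n hn => ?_⟩
    simp only [LinearMap.add_apply, Pi.add_apply,
      hN n (le_trans (le_max_left _ _) hn), hM n (le_trans (le_max_right _ _) hn), add_zero]
  zero_mem' := by intro w; exact ⟨0, fun n _ => rfl⟩
  smul_mem' := by
    intro c a ha w
    obtain ⟨N, hN⟩ := ha w
    exact ⟨N, fun n hn => by
      simp only [LinearMap.smul_apply, Pi.smul_apply, hN n hn, smul_zero]⟩

/-- The type `ℰ(W)`. -/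
abbrev EW := ↥(EWsub W)

variable {W}

/-- The mode function of an element of `ℰ(W)`. -/
def mf (a : EW W) : W → ℤ → W := fun w n => (a : W →ₗ[ℂ] (ℤ → W)) w n

/-- The identity operator `1_W`, as an element of `ℰ(W)`. -/
def oneE : EW W :=
  ⟨{ toFun := fun w n => if n = -1 then w else 0
     map_add' := by
       intro w w'; funext n; by_cases h : n = -1 <;> simp [h]
     map_smul' := by
       intro c w; funext n; by_cases h : n = -1 <;> simp [h] },
   fun w => ⟨0, fun n hn => if_neg (by omega)⟩⟩

/-- The generalized binomial coefficient `C(m, j)` for `m ∈ ℤ`, as a complex number. -/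
def binom (m : ℤ) (j : ℕ) : ℂ :=
  (∏ i ∈ Finset.range j, ((m : ℂ) - (i : ℂ))) / (j.factorial : ℂ)

/-- The coefficient of `x₁^m x₂^t` in `a(x₁) b(x₂) w`. -/
def Fab (a b : EW W) (w : W) (m t : ℤ) : W := mf a (mf b w (-t - 1)) (-m - 1)

/-- Multiplication of a two-variable family by a polynomial `p(x₁,x₂)`. -/
def mulPoly (p : MvPolynomial (Fin 2) ℂ) (F : ℤ → ℤ → W) : ℤ → ℤ → W :=
  fun m t => ∑ d ∈ p.support, MvPolynomial.coeff d p • F (m - d 0) (t - d 1)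

/-- A two-variable family lies in `W((x₁,x₂))` (jointly lower truncated). -/
def IsLaurent2 (F : ℤ → ℤ → W) : Prop :=
  ∃ N : ℤ, ∀ m t : ℤ, (m < N ∨ t < N) → F m t = 0

/-- Quasi compatibility of an ordered pair `(a(x), b(x))` in `ℰ(W)`:
`p(x₁,x₂) a(x₁) b(x₂) ∈ Hom(W, W((x₁,x₂)))` for some nonzero polynomial `p`. -/
def QCPair (a b : EW W) : Prop :=
  ∃ p : MvPolynomial (Fin 2) ℂ, p ≠ 0 ∧ ∀ w, IsLaurent2 (mulPoly p (Fab a b w))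

/-! ### Sequences -/

/-- The coefficient of `x₁^{k 1} ⋯ x_r^{k r}` in `ψ₁(x₁) ⋯ ψ_r(x_r) w`. -/
def seqCoeff : {r : ℕ} → (Fin r → EW W) → W → (Fin r → ℤ) → W
  | 0, _, w, _ => w
  | _ + 1, ψ, w, k => mf (ψ 0) (seqCoeff (Fin.tail ψ) w (Fin.tail k)) (-(k 0) - 1)

/-- The polynomial `∏_{1 ≤ i < j ≤ r} p(x_i, x_j)`. -/
def pairPoly (p : MvPolynomial (Fin 2) ℂ) (r : ℕ) : MvPolynomial (Fin r) ℂ :=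
  ∏ ij ∈ Finset.univ.filter (fun ij : Fin r × Fin r => ij.1 < ij.2),
    MvPolynomial.rename ![ij.1, ij.2] p

/-- Multiplication of an `r`-variable family by a polynomial in `r` variables. -/
def mulPolyN {r : ℕ} (P : MvPolynomial (Fin r) ℂ) (F : (Fin r → ℤ) → W) :
    (Fin r → ℤ) → W :=
  fun k => ∑ d ∈ P.support, MvPolynomial.coeff d P • F (fun i => k i - d i)

/-- An `r`-variable family lies in `W((x₁,…,x_r))`. -/
def IsLaurentN {r : ℕ} (F : (Fin r → ℤ) → W) : Prop :=
  ∃ N : ℤ, ∀ k : Fin r → ℤ, (∃ i, k i < N) → F k = 0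

/-- Quasi compatibility of an ordered sequence in `ℰ(W)`. -/
def QCSeq {r : ℕ} (ψ : Fin r → EW W) : Prop :=
  ∃ p : MvPolynomial (Fin 2) ℂ, p ≠ 0 ∧
    ∀ w, IsLaurentN (mulPolyN (pairPoly p r) (seqCoeff ψ w))

/-- Quasi compatibility of a subset of `ℰ(W)`. -/
def QCSet (S : Set (EW W)) : Prop :=
  ∀ (r : ℕ) (ψ : Fin r → EW W), (∀ i, ψ i ∈ S) → QCSeq ψ

/-! ### The vertex operation `Y_ℰ^{(α)}` -/

/-- `ℂ((x))`. -/
abbrev LC : Type := LaurentSeries ℂ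

/-- An iterated Laurent series field, e.g. `ℂ((x))((x₀))` (outer variable the second one). -/
abbrev K2 : Type := HahnSeries ℤ LC

/-- The outer variable of `K2`. -/
def xOuter : K2 := HahnSeries.single 1 1

/-- The inner variable of `K2`. -/
def xInner : K2 := HahnSeries.single 0 (HahnSeries.single 1 1)

/-- `α` times the inner variable of `K2`. -/
def xInnerC (c : ℂ) : K2 := HahnSeries.single 0 (HahnSeries.single 1 c)

/-- The polynomial `p(x₀ + α x, x)` as an element of `ℂ((x))((x₀))`
(outer variable `x₀`). -/
def qK (p : MvPolynomial (Fin 2) ℂ) (α : ℂ) : K2 :=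
  MvPolynomial.aeval ![xOuter + xInnerC α, xInner] p

/-- The expansion `ι_{x,x₀} (p(x₀ + α x, x)^{-1}) ∈ ℂ((x))((x₀))`. -/
def qInv (p : MvPolynomial (Fin 2) ℂ) (α : ℂ) : K2 := (qK p α)⁻¹

/-- The coefficient of `x₀^j x^t` in `(p(x₁,x) a(x₁) b(x) w)|_{x₁ = αx + x₀}`,
expanding via `(αx+x₀)^m = ∑_{j≥0} C(m,j) α^{m-j} x^{m-j} x₀^j`. -/
def substYE (α : ℂ) (p : MvPolynomial (Fin 2) ℂ) (a b : EW W) (w : W)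
    (j : ℕ) (t : ℤ) : W :=
  ∑ᶠ m : ℤ, (binom m j * α ^ (m - (j : ℤ))) • mulPoly p (Fab a b w) m (t - m + j)

/-- The coefficient of `x₀^J x^T` in
`ι_{x,x₀}(p(x₀+αx,x)^{-1}) ⬝ (p(x₁,x)a(x₁)b(x)w)|_{x₁ = αx+x₀}`. -/
def fullYE (α : ℂ) (p : MvPolynomial (Fin 2) ℂ) (a b : EW W) (w : W)
    (J T : ℤ) : W :=
  ∑ᶠ s : ℤ × ℤ, (((qInv p α).coeff s.1).coeff s.2) •
    (if 0 ≤ J - s.1 then substYE α p a b w (J - s.1).toNat (T - s.2) else 0)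

/-- The raw mode family of `Y_ℰ^{(α)}(a(x), x₀) b(x)`; `rawYE α a b n w m` is the mode
`m` of the element `a(x)_{(α,n)} b(x)` applied to `w`.  (Defined using a choice of
polynomial from quasi compatibility; by the general theory the value does not depend
on the choice.) -/
def rawYE (α : ℂ) (a b : EW W) (n : ℤ) (w : W) (m : ℤ) : W :=
  if h : QCPair a b then fullYE α h.choose a b w (-n - 1) (-m - 1) else 0

/-- `a(x)_{(α,n)} b(x)`, as an element of `ℰ(W)` whenever the raw family is realized
by one (which is the case for any quasi compatible pair). -/
def YEa (α : ℂˣ) (a b : EW W) (n : ℤ) : EW W :=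
  if h : ∃ c : EW W, ∀ w m, mf c w m = rawYE (α : ℂ) a b n w m then h.choose else 0

/-- `a(x)_n b(x) = a(x)_{(1,n)} b(x)`. -/
def YE (a b : EW W) (n : ℤ) : EW W := YEa 1 a b n

end NVA

namespace NVA

variable {W : Type*} [AddCommGroup W] [Module ℂ W]

/-- Submodules of `ℰ(W)` are `ℂ`-vector spaces (registered explicitly to assist
instance resolution). -/
noncomputable instance (V : Submodule ℂ (EW W)) : AddCommGroup ↥V :=
  @Submodule.addCommGroup ℂ (EW W) _ inferInstance inferInstance V

noncomputable instance (V : Submodule ℂ (EW W)) : Module ℂ ↥V :=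
  @Submodule.module ℂ (EW W) _ inferInstance inferInstance V

/-! ### Derivative and scaling operators on ℰ(W) -/

/-- `D = d/dx` on `ℰ(W)`: `(Da)_m = -m • a_{m-1}`. -/
def Dop (a : EW W) : EW W :=
  ⟨{ toFun := fun w m => (-m : ℂ) • mf a w (m - 1)
     map_add' := by intro w w'; funext m; simp [mf, map_add]
     map_smul' := by
       intro c w; funext m
       simp only [mf, map_smul, Pi.smul_apply, RingHom.id_apply]
       exact smul_comm _ _ _ },
   by
     intro w
     obtain ⟨N, hN⟩ := a.2 w
     exact ⟨N + 1, fun m hm => by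
       have : (a : W →ₗ[ℂ] (ℤ → W)) w (m - 1) = 0 := hN _ (by omega)
       simp [mf, this]⟩⟩

/-- `R_α : a(x) ↦ a(αx)`, on modes `(R_α a)_m = α^{-m-1} a_m`. -/
def RaE (α : ℂˣ) (a : EW W) : EW W :=
  ⟨{ toFun := fun w m => ((α : ℂ) ^ (-m - 1 : ℤ)) • mf a w m
     map_add' := by intro w w'; funext m; simp [mf, map_add]
     map_smul' := by
       intro c w; funext m
       simp only [mf, map_smul, Pi.smul_apply, RingHom.id_apply]
       exact smul_comm _ _ _ },
   by
     intro w
     obtain ⟨N, hN⟩ := a.2 w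
     exact ⟨N, fun m hm => by simp [mf, hN m hm]⟩⟩

/-! ### Nonlocal vertex algebras, modules and quasi modules -/

/-- The coefficient of `x₀^a x₂^b` in `Y₁(u, x₀+x₂) (Y₂(v,x₂) w)`, where
`(x₀+x₂)^m` is expanded in nonnegative powers of `x₂`. -/
def prodCE {V : Type*} (Yo Yi : V → W → ℤ → W) (u v : V) (w : W) (a b : ℤ) : W :=
  ∑ᶠ m : ℤ, if a ≤ m then
    binom m (m - a).toNat • Yo u (Yi v w (-(b - (m - a)) - 1)) (-m - 1) else 0

/-- The coefficient of `x₀^a x₂^b` in `Y₂(Y₁(u,x₀)v, x₂) w`. -/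
def assocCE {V : Type*} (Y1 : V → V → ℤ → V) (Y2 : V → W → ℤ → W)
    (u v : V) (w : W) (a b : ℤ) : W :=
  Y2 (Y1 u v (-a - 1)) w (-b - 1)

/-- Multiplication of a two-variable family (in `x₀, x₂`) by `f(x₀+x₂, x₂)` for a
polynomial `f`, expanding `(x₀+x₂)^d` in nonnegative powers of `x₂`. -/
def mulSubPoly (f : MvPolynomial (Fin 2) ℂ) (A : ℤ → ℤ → W) (a b : ℤ) : W :=
  ∑ d ∈ f.support, ∑ i ∈ Finset.range (d 0 + 1),
    (MvPolynomial.coeff d f * ((d 0).choose i : ℂ)) •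
      A (a - ((d 0 : ℤ) - i)) (b - i - (d 1 : ℤ))

/-- A nonlocal vertex algebra structure on a ℂ-vector space `V`:
a linear map `Y : V → ℰ(V) = Hom(V, V((x)))` and a vacuum vector `1` such that
`Y(1,x)v = v`, `Y(v,x)1 ∈ V[[x]]` with constant term `v`, and weak associativity
holds. -/
structure NLVA (V : Type*) [AddCommGroup V] [Module ℂ V] where
  Y : V →ₗ[ℂ] EW V
  one : V
  vac : ∀ (v : V) (n : ℤ), mf (Y one) v n = if n = -1 then v else 0
  creation0 : ∀ (v : V) (n : ℤ), 0 ≤ n → mf (Y v) one n = 0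
  creation1 : ∀ v : V, mf (Y v) one (-1) = v
  wassoc : ∀ u v w : V, ∃ l : ℕ, ∀ a b : ℤ,
    mulSubPoly (MvPolynomial.X 0 ^ l)
      (prodCE (fun x => mf (Y x)) (fun x => mf (Y x)) u v w) a b =
    mulSubPoly (MvPolynomial.X 0 ^ l)
      (assocCE (fun x y n => mf (Y x) y n) (fun x => mf (Y x)) u v w) a b

/-- The mode maps of a nonlocal vertex algebra: `Yf A u v n = u_n v`. -/
def Yf {V : Type*} [AddCommGroup V] [Module ℂ V] (A : NLVA V) : V → V → ℤ → V :=
  fun u v n => mf (A.Y u) v n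

/-- Mode maps of a linear map `V → ℰ(W)`. -/
def YWf {V : Type*} [AddCommGroup V] [Module ℂ V] (YW : V →ₗ[ℂ] EW W) :
    V → W → ℤ → W := fun v w n => mf (YW v) w n

/-- `(W, Y_W)` is a quasi module for the nonlocal vertex algebra `A` on `V`. -/
def IsQuasiModule {V : Type*} [AddCommGroup V] [Module ℂ V] (A : NLVA V)
    (YW : V →ₗ[ℂ] EW W) : Prop :=
  (∀ (w : W) (n : ℤ), mf (YW A.one) w n = if n = -1 then w else 0) ∧
  ∀ (u v : V) (w : W), ∃ f : MvPolynomial (Fin 2) ℂ, f ≠ 0 ∧ ∀ a b : ℤ,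
    mulSubPoly f (prodCE (YWf YW) (YWf YW) u v w) a b =
    mulSubPoly f (assocCE (Yf A) (YWf YW) u v w) a b

/-- `(W, Y_W)` is a module for the nonlocal vertex algebra `A` on `V`. -/
def IsModule {V : Type*} [AddCommGroup V] [Module ℂ V] (A : NLVA V)
    (YW : V →ₗ[ℂ] EW W) : Prop :=
  (∀ (w : W) (n : ℤ), mf (YW A.one) w n = if n = -1 then w else 0) ∧
  ∀ (u v : V) (w : W), ∃ l : ℕ, ∀ a b : ℤ,
    mulSubPoly (MvPolynomial.X 0 ^ l) (prodCE (YWf YW) (YWf YW) u v w) a b =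
    mulSubPoly (MvPolynomial.X 0 ^ l) (assocCE (Yf A) (YWf YW) u v w) a b

end NVA

namespace NVA

variable {W : Type*} [AddCommGroup W] [Module ℂ W]
variable {V : Type*} [AddCommGroup V] [Module ℂ V]

/-! ### Pseudo-locality -/

/-- A power series `∑ f n x^n` as a Laurent series. -/
def psN (f : ℕ → ℂ) : LC := HahnSeries.ofPowerSeries ℤ ℂ (PowerSeries.mk f)

/-- `ι_{x₂,x₁}` of a formal power series `F(x₁,x₂) ∈ ℂ[[x₁,x₂]]`, given by its
coefficient function, as an element of `ℂ((x₂))((x₁))` (outer variable `x₁`). -/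
def psEmbed (F : ℕ → ℕ → ℂ) : K2 :=
  HahnSeries.ofPowerSeries ℤ LC (PowerSeries.mk (fun m => psN (F m)))

/-- The coefficient function of a polynomial in two variables. -/
def polyCoeffFun (g : MvPolynomial (Fin 2) ℂ) : ℕ → ℕ → ℂ :=
  fun m t => MvPolynomial.coeff (Finsupp.single 0 m + Finsupp.single 1 t) g

/-- `ι_{x₂,x₁}` of a polynomial in two variables. -/
def polyEmbed (g : MvPolynomial (Fin 2) ℂ) : K2 := psEmbed (polyCoeffFun g)

/-- The coefficient function of an element of `ℂ((x₂))((x₁))`: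
`k2Fun x m t` is the coefficient of `x₁^m x₂^t`. -/
def k2Fun (x : K2) : ℤ → ℤ → ℂ := fun m t => (x.coeff m).coeff t

/-- Multiplication of a two-variable family by a scalar-valued two-variable series. -/
def smulFam (c : ℤ → ℤ → ℂ) (G : ℤ → ℤ → W) : ℤ → ℤ → W :=
  fun m t => ∑ᶠ s : ℤ × ℤ, c s.1 s.2 • G (m - s.1) (t - s.2)

/-- Multiplication of a two-variable family by a Laurent polynomial
`p ∈ ℂ[x₁^{±1}, x₂^{±1}]` (recorded by its finitely supported coefficients). -/
def mulLPoly (p : (ℤ × ℤ) →₀ ℂ) (G : ℤ → ℤ → W) : ℤ → ℤ → W :=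
  fun m t => ∑ d ∈ p.support, p d • G (m - d.1) (t - d.2)

/-- A subset `S ⊆ ℰ(W)` is pseudo-local. -/
def PseudoLocal (S : Set (EW W)) : Prop :=
  ∀ a ∈ S, ∀ b ∈ S, ∃ p : (ℤ × ℤ) →₀ ℂ, p ≠ 0 ∧
    ∃ (r : ℕ) (F : Fin r → (ℕ → ℕ → ℂ)) (g : Fin r → MvPolynomial (Fin 2) ℂ)
      (u v : Fin r → EW W),
      (∀ i, g i ≠ 0) ∧ (∀ i, u i ∈ S) ∧ (∀ i, v i ∈ S) ∧
      ∀ (w : W) (m t : ℤ),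
        mulLPoly p (Fab a b w) m t =
          ∑ i, smulFam (k2Fun (psEmbed (F i) * (polyEmbed (g i))⁻¹))
            (fun m' t' => Fab (u i) (v i) w t' m') m t

/-- The coefficient of `x₁^m x₂^t` in `ι_{x₂,x₁} f(x₂ - x₁)`, for `f(x) ∈ ℂ((x))`. -/
def expandSub (f : LC) : ℤ → ℤ → ℂ :=
  fun m t => if 0 ≤ m then
    ((-1 : ℂ) ^ m.toNat * binom (t + m) m.toNat) * f.coeff (t + m) else 0

/-- A subset `S ⊆ ℰ(W)` is `𝒮`-local. -/
def SLocal (S : Set (EW W)) : Prop :=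
  ∀ a ∈ S, ∀ b ∈ S, ∃ (k : ℕ) (r : ℕ) (f : Fin r → LC) (u v : Fin r → EW W),
    (∀ i, u i ∈ S) ∧ (∀ i, v i ∈ S) ∧
    ∀ (w : W) (m t : ℤ),
      mulPoly ((MvPolynomial.X 0 - MvPolynomial.X 1) ^ k) (Fab a b w) m t =
        ∑ i, mulPoly ((MvPolynomial.X 0 - MvPolynomial.X 1) ^ k)
          (smulFam (expandSub (f i)) (fun m' t' => Fab (u i) (v i) w t' m')) m t

/-- `U` is the nonlocal vertex algebra `⟨S⟩` generated by `S`: the smallest closed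
quasi compatible subspace of `ℰ(W)` containing `S ∪ {1_W}`. -/
def IsGenVA (S : Set (EW W)) (U : Submodule ℂ (EW W)) : Prop :=
  QCSet (U : Set (EW W)) ∧ (∀ a ∈ U, ∀ b ∈ U, ∀ n : ℤ, YE a b n ∈ U) ∧
  oneE ∈ U ∧ S ⊆ U ∧
  ∀ U' : Submodule ℂ (EW W),
    (QCSet (U' : Set (EW W)) ∧ (∀ a ∈ U', ∀ b ∈ U', ∀ n : ℤ, YE a b n ∈ U') ∧
      oneE ∈ U' ∧ S ⊆ (U' : Set (EW W))) → U ≤ U'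

/-! ### 𝒮-locality for maps and weak quantum vertex algebras -/

/-- The `𝒮`-locality identity
`(x₁-x₂)^k Y(u,x₁)Y(v,x₂) = ∑ᵢ (x₁-x₂)^k ι_{x₂,x₁}(fᵢ(x₂-x₁)) Y(vᵢ,x₂)Y(uᵢ,x₁)`
at the level of coefficient families, for mode maps `Ym`. -/
def sLocPair {V : Type*} (Ym : V → W → ℤ → W) (k : ℕ) (u v : V) {r : ℕ}
    (f : Fin r → LC) (vi ui : Fin r → V) : Prop :=
  ∀ (w : W) (m t : ℤ),
    mulPoly ((MvPolynomial.X 0 - MvPolynomial.X 1) ^ k)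
      (fun m' t' => Ym u (Ym v w (-t' - 1)) (-m' - 1)) m t =
    ∑ i, mulPoly ((MvPolynomial.X 0 - MvPolynomial.X 1) ^ k)
      (smulFam (expandSub (f i))
        (fun m' t' => Ym (vi i) (Ym (ui i) w (-m' - 1)) (-t' - 1))) m t

/-- A weak quantum vertex algebra: a nonlocal vertex algebra whose vertex operators
form an `𝒮`-local subspace of `ℰ(V)`. -/
def IsWeakQVA (A : NLVA V) : Prop :=
  ∀ u v : V, ∃ (k : ℕ) (r : ℕ) (f : Fin r → LC) (vi ui : Fin r → V),
    sLocPair (Yf A) k u v f vi ui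

end NVA

namespace NVA

set_option linter.unusedSectionVars false

/-! ### Polynomials acting on coefficient families -/

section PolyAction

variable {σ τ I I' : Type*} [AddCommGroup I] [AddCommGroup I']
variable {V : Type*} [AddCommGroup V] [Module ℂ V]

/-- The translation of a family by `i`. -/
def shiftEnd (V : Type*) [AddCommGroup V] [Module ℂ V] (i : I) : Module.End ℂ (I → V) where
  toFun F k := F (k - i)
  map_add' _ _ := rfl
  map_smul' _ _ := rfl

/-- The degree of a monomial when the variable `X j` has degree `e j`. -/
def wt (e : σ → I) : (σ →₀ ℕ) →+ I :=
  Finsupp.liftAddHom fun j => (multiplesHom I) (e j)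

/-- The action of polynomials on families in which `X j` translates by `e j`. -/
def act (V : Type*) [AddCommGroup V] [Module ℂ V] (e : σ → I) :
    MvPolynomial σ ℂ →ₐ[ℂ] Module.End ℂ (I → V) :=
  AddMonoidAlgebra.lift ℂ (Module.End ℂ (I → V)) (σ →₀ ℕ)
    { toFun := fun d => shiftEnd V (wt e d.toAdd)
      map_one' := by ext; simp [shiftEnd]
      map_mul' := by
        intro a b
        ext F k
        simp [shiftEnd, sub_sub] }

theorem act_apply (e : σ → I) (P : MvPolynomial σ ℂ) (F : I → V) (k : I) :
    act V e P F k = ∑ d ∈ P.support, P.coeff d • F (k - wt e d) := by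
  have h : act V e P = P.support.sum fun d => P.coeff d • shiftEnd V (wt e d) :=
    AddMonoidAlgebra.lift_apply _ _
  rw [h]
  simp [shiftEnd]

theorem act_X (e : σ → I) (j : σ) (F : I → V) (k : I) :
    act V e (MvPolynomial.X j) F k = F (k - e j) := by
  have h : act V e (MvPolynomial.X j) = (1 : ℂ) • shiftEnd V (wt e (Finsupp.single j 1)) :=
    AddMonoidAlgebra.lift_single _ _ _
  rw [h]
  simp [shiftEnd, wt]

theorem act_C (e : σ → I) (c : ℂ) (F : I → V) :
    act V e (MvPolynomial.C c) F = c • F := by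
  have h : act V e (MvPolynomial.C c) = algebraMap ℂ _ c := (act V e).commutes c
  rw [h]; rfl

theorem act_mul (e : σ → I) (P Q : MvPolynomial σ ℂ) (F : I → V) :
    act V e (P * Q) F = act V e P (act V e Q F) := by
  rw [map_mul]; rfl

theorem act_add (e : σ → I) (P Q : MvPolynomial σ ℂ) (F : I → V) :
    act V e (P + Q) F = act V e P F + act V e Q F := by
  rw [map_add]; rfl

theorem act_sub (e : σ → I) (P Q : MvPolynomial σ ℂ) (F : I → V) :
    act V e (P - Q) F = act V e P F - act V e Q F := by
  rw [map_sub]; rfl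

theorem act_one (e : σ → I) (F : I → V) : act V e 1 F = F := by
  rw [map_one]; rfl

theorem act_comm (e : σ → I) (P Q : MvPolynomial σ ℂ) (F : I → V) :
    act V e P (act V e Q F) = act V e Q (act V e P F) := by
  rw [← act_mul, mul_comm, act_mul]

theorem act_X_pow (e : σ → I) (j : σ) (n : ℕ) (F : I → V) (k : I) :
    act V e (MvPolynomial.X j ^ n) F k = F (k - n • e j) := by
  induction n generalizing F k with
  | zero => rw [pow_zero, act_one]; simp
  | succ n ih => rw [pow_succ, act_mul, ih, act_X]; congr 1; rw [succ_nsmul]; abel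

/-- An additive operator on a class of families which intertwines the variables with
polynomials intertwines all polynomials. -/
theorem act_intertwine {V' : Type*} [AddCommGroup V'] [Module ℂ V'] {e : σ → I} {e' : τ → I'}
    (C : (I → V) → Prop) (T : (I → V) → (I' → V')) (Q : σ → MvPolynomial τ ℂ)
    (hCadd : ∀ F G, C F → C G → C (F + G)) (hCsmul : ∀ (c : ℂ) F, C F → C (c • F))
    (hCX : ∀ j F, C F → C (act V e (MvPolynomial.X j) F))
    (hadd : ∀ F G, C F → C G → T (F + G) = T F + T G)
    (hsmul : ∀ (c : ℂ) F, C F → T (c • F) = c • T F)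
    (hX : ∀ j F, C F → T (act V e (MvPolynomial.X j) F) = act V' e' (Q j) (T F))
    (P : MvPolynomial σ ℂ) (F : I → V) (hF : C F) :
    C (act V e P F) ∧ T (act V e P F) = act V' e' (MvPolynomial.aeval Q P) (T F) := by
  induction P using MvPolynomial.induction_on generalizing F with
  | C c =>
    rw [act_C]
    refine ⟨hCsmul c F hF, ?_⟩
    rw [hsmul c F hF, MvPolynomial.aeval_C]
    exact (act_C e' c (T F)).symm
  | add p q hp hq =>
    rw [act_add, map_add, act_add]
    exact ⟨hCadd _ _ (hp F hF).1 (hq F hF).1,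
      by rw [hadd _ _ (hp F hF).1 (hq F hF).1, (hp F hF).2, (hq F hF).2]⟩
  | mul_X p j hp =>
    rw [act_mul, map_mul, act_mul, MvPolynomial.aeval_X, ← hX j F hF]
    exact hp _ (hCX j F hF)

/-- Pulling families back along an index map intertwines renamings. -/
theorem act_comp {e : σ → I} {e' : τ → I'} (ι : I' → I) (f : τ → σ)
    (h : ∀ k j, ι (k - e' j) = ι k - e (f j)) (P : MvPolynomial τ ℂ) (F : I → V) :
    (fun k => act V e (MvPolynomial.rename f P) F (ι k)) = act V e' P (fun k => F (ι k)) := by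
  induction P using MvPolynomial.induction_on generalizing F with
  | C c => rw [MvPolynomial.rename_C, act_C, act_C]; rfl
  | add p q hp hq =>
    rw [map_add, act_add, act_add, ← hp, ← hq]; rfl
  | mul_X p j hp =>
    rw [map_mul, act_mul, act_mul, hp, MvPolynomial.rename_X]
    congr 1
    funext k
    rw [act_X, act_X, h]

/-- Polynomials act compatibly with linear maps of the coefficients. -/
theorem act_map {V' : Type*} [AddCommGroup V'] [Module ℂ V'] (e : σ → I) (L : V →ₗ[ℂ] V')
    (P : MvPolynomial σ ℂ) (F : I → V) :
    act V' e P (fun k => L (F k)) = fun k => L (act V e P F k) := by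
  funext k
  simp [act_apply]

end PolyAction

/-- The standard translations of two-variable families. -/
abbrev e2 : Fin 2 → ℤ × ℤ := ![(1, 0), (0, 1)]

/-- The standard translations of three-variable families. -/
abbrev e3 : Fin 3 → ℤ × ℤ × ℤ := ![(1, 0, 0), (0, 1, 0), (0, 0, 1)]

/-- The standard translations of `r`-variable families. -/
abbrev eN (r : ℕ) : Fin r → (Fin r → ℤ) := fun i => Pi.single i 1

section Standard

variable {V : Type*} [AddCommGroup V] [Module ℂ V]

theorem act2_X0 (F : ℤ × ℤ → V) (m t : ℤ) :
    act V e2 (MvPolynomial.X 0) F (m, t) = F (m - 1, t) := by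
  rw [act_X]; congr 1; ext <;> simp

theorem act2_X1 (F : ℤ × ℤ → V) (m t : ℤ) :
    act V e2 (MvPolynomial.X 1) F (m, t) = F (m, t - 1) := by
  rw [act_X]; congr 1; ext <;> simp

theorem act3_X0 (F : ℤ × ℤ × ℤ → V) (m t s : ℤ) :
    act V e3 (MvPolynomial.X 0) F (m, t, s) = F (m - 1, t, s) := by
  rw [act_X]; congr 1; ext <;> simp

theorem act3_X1 (F : ℤ × ℤ × ℤ → V) (m t s : ℤ) :
    act V e3 (MvPolynomial.X 1) F (m, t, s) = F (m, t - 1, s) := by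
  rw [act_X]; congr 1; ext <;> simp

theorem act3_X2 (F : ℤ × ℤ × ℤ → V) (m t s : ℤ) :
    act V e3 (MvPolynomial.X 2) F (m, t, s) = F (m, t, s - 1) := by
  rw [act_X]; congr 1; ext <;> simp

theorem wt_e2 (d : Fin 2 →₀ ℕ) : wt e2 d = ((d 0 : ℤ), (d 1 : ℤ)) := by
  ext <;> simp [wt, Finsupp.sum_fintype]

theorem wt_eN {r : ℕ} (d : Fin r →₀ ℕ) : wt (eN r) d = fun i => (d i : ℤ) := by
  funext i
  simp [wt, Finsupp.sum_fintype, Finset.sum_apply, Pi.single_apply]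

theorem mulPoly_eq (p : MvPolynomial (Fin 2) ℂ) (F : ℤ → ℤ → V) (m t : ℤ) :
    mulPoly p F m t = act V e2 p (fun k => F k.1 k.2) (m, t) := by
  rw [act_apply]; simp [mulPoly, wt_e2]

theorem mulPolyN_eq {r : ℕ} (P : MvPolynomial (Fin r) ℂ) (F : (Fin r → ℤ) → V) :
    mulPolyN P F = act V (eN r) P F := by
  funext k
  rw [act_apply]
  simp only [mulPolyN, wt_eN]
  rfl

end Standard

/-! ### Generalized binomial coefficients -/

theorem binom_eq (m : ℤ) (j : ℕ) : binom m j = ((Ring.choose m j : ℤ) : ℂ) := by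
  have h := Ring.descPochhammer_eq_factorial_smul_choose m j
  rw [binom, div_eq_iff (by exact_mod_cast j.factorial_ne_zero)]
  have h2 : ((j.factorial • Ring.choose m j : ℤ) : ℂ) =
      ((Ring.choose m j : ℤ) : ℂ) * j.factorial := by
    rw [nsmul_eq_mul, Int.cast_mul, mul_comm, Int.cast_natCast]
  rw [← h2, ← h]
  rw [← Polynomial.aeval_eq_smeval]
  clear h h2
  induction j with
  | zero => simp
  | succ j ih =>
    rw [Finset.prod_range_succ, ih, descPochhammer_succ_right]
    simp

/-- The binomial coefficient with an integer lower entry. -/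
def ch (m J : ℤ) : ℂ := if J < 0 then 0 else binom m J.toNat

theorem ch_neg {m J : ℤ} (h : J < 0) : ch m J = 0 := if_pos h

theorem ch_natCast (m : ℤ) (j : ℕ) : ch m j = ((Ring.choose m j : ℤ) : ℂ) := by
  rw [ch, if_neg (by omega), binom_eq]; simp

theorem ch_zero (m : ℤ) : ch m 0 = 1 := by
  have := ch_natCast m 0
  simpa using this

theorem ch_succ (m J : ℤ) : ch (m + 1) J = ch m J + ch m (J - 1) := by
  rcases lt_trichotomy J 0 with h | rfl | h
  · simp [ch_neg h, ch_neg (show J - 1 < 0 by omega)]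
  · simp [ch_zero, ch_neg (show (-1 : ℤ) < 0 by omega)]
  · obtain ⟨j, rfl⟩ : ∃ j : ℕ, J = (j + 1 : ℕ) := ⟨(J - 1).toNat, by omega⟩
    rw [show ((j + 1 : ℕ) : ℤ) - 1 = (j : ℕ) by push_cast; ring]
    rw [ch_natCast, ch_natCast, ch_natCast, Ring.choose_succ_succ]
    push_cast; ring

theorem ch_nat_nat (m j : ℕ) : ch m j = (m.choose j : ℂ) := by
  rw [ch_natCast, Ring.choose_natCast]; simp

theorem ch_of_lt {m J : ℤ} (h0 : 0 ≤ m) (h : m < J) : ch m J = 0 := by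
  lift m to ℕ using h0
  lift J to ℕ using by omega
  rw [ch_nat_nat, Nat.choose_eq_zero_of_lt (by omega)]; simp

theorem ch_symm {m : ℤ} (h0 : 0 ≤ m) (J : ℤ) : ch m (m - J) = ch m J := by
  rcases lt_or_ge J 0 with h | h
  · rw [ch_neg h, ch_of_lt h0 (by omega)]
  · rcases lt_or_ge m J with h' | h'
    · rw [ch_of_lt h0 h', ch_neg (by omega)]
    · lift m to ℕ using h0
      lift J to ℕ using h
      rw [show (m : ℤ) - J = ((m - J : ℕ) : ℤ) by omega, ch_nat_nat, ch_nat_nat,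
        Nat.choose_symm (by omega)]

theorem ch_absorb (m J : ℤ) : (m : ℂ) * ch (m - 1) J = (m - J) * ch m J := by
  rcases lt_or_ge J 0 with h | h
  · simp [ch_neg h]
  lift J to ℕ using h
  rw [ch, ch, if_neg (by omega), if_neg (by omega), binom, binom]
  simp only [Int.toNat_natCast]
  rw [mul_div_assoc', mul_div_assoc']
  congr 1
  induction J with
  | zero => simp
  | succ j ih =>
    rw [Finset.prod_range_succ, Finset.prod_range_succ, ← mul_assoc, ih]
    push_cast; ring

/-! ### Substitution operators on two-variable families -/

section Subst

variable {V : Type*} [AddCommGroup V] [Module ℂ V]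

open MvPolynomial (X C aeval)

/-- Joint lower truncation. -/
def Laur2 (G : ℤ × ℤ → V) : Prop := ∃ N : ℤ, ∀ k : ℤ × ℤ, (k.1 < N ∨ k.2 < N) → G k = 0

/-- Uniform lower truncation in the second variable. -/
def TrU (G : ℤ × ℤ → V) : Prop := ∃ N : ℤ, ∀ k : ℤ × ℤ, k.2 < N → G k = 0

theorem Laur2.add {F G : ℤ × ℤ → V} (hF : Laur2 F) (hG : Laur2 G) : Laur2 (F + G) := by
  obtain ⟨N, hN⟩ := hF
  obtain ⟨M, hM⟩ := hG
  refine ⟨min N M, fun k hk => ?_⟩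
  have h1 := hN k (by omega)
  have h2 := hM k (by omega)
  simp [h1, h2]

theorem Laur2.smul (c : ℂ) {F : ℤ × ℤ → V} (hF : Laur2 F) : Laur2 (c • F) := by
  obtain ⟨N, hN⟩ := hF
  exact ⟨N, fun k hk => by simp [hN k hk]⟩

theorem Laur2.act_X (j : Fin 2) {F : ℤ × ℤ → V} (hF : Laur2 F) :
    Laur2 (act V e2 (X j) F) := by
  obtain ⟨N, hN⟩ := hF
  refine ⟨N, fun k hk => ?_⟩
  obtain ⟨m, t⟩ := k
  simp only at hk
  fin_cases j
  · exact (act2_X0 F m t).trans (hN _ (by simp only; omega))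
  · exact (act2_X1 F m t).trans (hN _ (by simp only; omega))

theorem TrU.add {F G : ℤ × ℤ → V} (hF : TrU F) (hG : TrU G) : TrU (F + G) := by
  obtain ⟨N, hN⟩ := hF
  obtain ⟨M, hM⟩ := hG
  refine ⟨min N M, fun k hk => ?_⟩
  have h1 := hN k (by omega)
  have h2 := hM k (by omega)
  simp [h1, h2]

theorem TrU.smul (c : ℂ) {F : ℤ × ℤ → V} (hF : TrU F) : TrU (c • F) := by
  obtain ⟨N, hN⟩ := hF
  exact ⟨N, fun k hk => by simp [hN k hk]⟩

theorem TrU.act_X (j : Fin 2) {F : ℤ × ℤ → V} (hF : TrU F) :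
    TrU (act V e2 (X j) F) := by
  obtain ⟨N, hN⟩ := hF
  refine ⟨N, fun k hk => ?_⟩
  obtain ⟨m, t⟩ := k
  simp only at hk
  fin_cases j
  · exact (act2_X0 F m t).trans (hN _ (by simp only; omega))
  · exact (act2_X1 F m t).trans (hN _ (by simp only; omega))

/-- The substitution `x₁ = x₂ + x₀`, expanded in nonnegative powers of `x₀`. -/
def Sop (G : ℤ × ℤ → V) : ℤ × ℤ → V :=
  fun k => ∑ᶠ m : ℤ, ch m k.1 • G (m, k.2 - m + k.1)

/-- The substitution `x₁ = x₀ + x₂`, expanded in nonnegative powers of `x₂`. -/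
def Eop (G : ℤ × ℤ → V) : ℤ × ℤ → V :=
  fun k => ∑ᶠ m : ℤ, ch m (m - k.1) • G (m, k.2 - (m - k.1))

/-- The images of the variables under both substitutions. -/
abbrev subQ : Fin 2 → MvPolynomial (Fin 2) ℂ := ![X 0 + X 1, X 1]

theorem Sop_finite {G : ℤ × ℤ → V} (hG : Laur2 G) (k : ℤ × ℤ) (c : ℤ → ℂ) :
    (Function.support fun m : ℤ => c m • G (m, k.2 - m + k.1)).Finite := by
  obtain ⟨N, hN⟩ := hG
  refine (Set.finite_Icc N (k.2 + k.1 - N)).subset fun m hm => ?_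
  by_contra h
  apply hm
  simp only [Set.mem_Icc, not_and_or, not_le] at h
  simp only
  rw [hN _ (by simp only; omega), smul_zero]

theorem Eop_finite {G : ℤ × ℤ → V} (hG : TrU G) (k : ℤ × ℤ) :
    (Function.support fun m : ℤ => ch m (m - k.1) • G (m, k.2 - (m - k.1))).Finite := by
  obtain ⟨N, hN⟩ := hG
  refine (Set.finite_Icc k.1 (k.2 + k.1 - N)).subset fun m hm => ?_
  by_contra h
  apply hm
  simp only [Set.mem_Icc, not_and_or, not_le] at h
  simp only
  rcases h with h | h
  · rw [ch_neg (by omega), zero_smul]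
  · rw [hN _ (by simp only; omega), smul_zero]

theorem Sop_add {F G : ℤ × ℤ → V} (hF : Laur2 F) (hG : Laur2 G) :
    Sop (F + G) = Sop F + Sop G := by
  funext k
  simp only [Sop, Pi.add_apply, smul_add]
  exact finsum_add_distrib (Sop_finite hF k _) (Sop_finite hG k _)

theorem Sop_smul (c : ℂ) {F : ℤ × ℤ → V} (hF : Laur2 F) :
    Sop (c • F) = c • Sop F := by
  funext k
  simp only [Sop, Pi.smul_apply]
  rw [smul_finsum' _ (Sop_finite hF k _)]
  exact finsum_congr fun m => smul_comm _ _ _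

theorem Eop_add {F G : ℤ × ℤ → V} (hF : TrU F) (hG : TrU G) :
    Eop (F + G) = Eop F + Eop G := by
  funext k
  simp only [Eop, Pi.add_apply, smul_add]
  exact finsum_add_distrib (Eop_finite hF k) (Eop_finite hG k)

theorem Eop_smul (c : ℂ) {F : ℤ × ℤ → V} (hF : TrU F) :
    Eop (c • F) = c • Eop F := by
  funext k
  simp only [Eop, Pi.smul_apply]
  rw [smul_finsum' _ (Eop_finite hF k)]
  exact finsum_congr fun m => smul_comm _ _ _

theorem Sop_X {F : ℤ × ℤ → V} (hF : Laur2 F) (j : Fin 2) :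
    Sop (act V e2 (X j) F) = act V e2 (subQ j) (Sop F) := by
  funext k
  obtain ⟨J, q⟩ := k
  fin_cases j
  · change Sop (act V e2 (X 0) F) (J, q) = act V e2 (X 0 + X 1) (Sop F) (J, q)
    rw [act_add, Pi.add_apply, act2_X0, act2_X1]
    simp only [Sop, act2_X0]
    rw [← finsum_comp_equiv (Equiv.addRight (1 : ℤ))]
    refine Eq.trans ?_ (finsum_add_distrib (Sop_finite hF (J - 1, q) fun m => ch m (J - 1))
      (Sop_finite hF (J, q - 1) fun m => ch m J))
    refine finsum_congr fun m => ?_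
    simp only [Equiv.coe_addRight, ch_succ, add_smul]
    rw [add_comm]
    congr 3 <;> ring_nf
  · change Sop (act V e2 (X 1) F) (J, q) = act V e2 (X 1) (Sop F) (J, q)
    rw [act2_X1]
    simp only [Sop, act2_X1]
    refine finsum_congr fun m => ?_
    congr 2; ring_nf

theorem Eop_X {F : ℤ × ℤ → V} (hF : TrU F) (j : Fin 2) :
    Eop (act V e2 (X j) F) = act V e2 (subQ j) (Eop F) := by
  funext k
  obtain ⟨J, q⟩ := k
  fin_cases j
  · change Eop (act V e2 (X 0) F) (J, q) = act V e2 (X 0 + X 1) (Eop F) (J, q)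
    rw [act_add, Pi.add_apply, act2_X0, act2_X1]
    simp only [Eop, act2_X0]
    rw [← finsum_comp_equiv (Equiv.addRight (1 : ℤ))]
    refine Eq.trans ?_ (finsum_add_distrib (Eop_finite hF (J - 1, q)) (Eop_finite hF (J, q - 1)))
    refine finsum_congr fun m => ?_
    simp only [Equiv.coe_addRight, ch_succ, add_smul]
    congr 3 <;> ring_nf
  · change Eop (act V e2 (X 1) F) (J, q) = act V e2 (X 1) (Eop F) (J, q)
    rw [act2_X1]
    simp only [Eop, act2_X1]
    refine finsum_congr fun m => ?_
    congr 2; ring_nf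

theorem Laur2.act (P : MvPolynomial (Fin 2) ℂ) {F : ℤ × ℤ → V} (hF : Laur2 F) :
    Laur2 (act V e2 P F) :=
  (act_intertwine Laur2 Sop subQ (fun _ _ => Laur2.add) (fun c _ => Laur2.smul c)
    (fun j _ => Laur2.act_X j) (fun _ _ => Sop_add) (fun c _ => Sop_smul c)
    (fun j _ h => Sop_X h j) P F hF).1

theorem Sop_act (P : MvPolynomial (Fin 2) ℂ) {F : ℤ × ℤ → V} (hF : Laur2 F) :
    Sop (act V e2 P F) = act V e2 (aeval subQ P) (Sop F) :=
  (act_intertwine Laur2 Sop subQ (fun _ _ => Laur2.add) (fun c _ => Laur2.smul c)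
    (fun j _ => Laur2.act_X j) (fun _ _ => Sop_add) (fun c _ => Sop_smul c)
    (fun j _ h => Sop_X h j) P F hF).2

theorem TrU.act (P : MvPolynomial (Fin 2) ℂ) {F : ℤ × ℤ → V} (hF : TrU F) :
    TrU (act V e2 P F) :=
  (act_intertwine TrU Eop subQ (fun _ _ => TrU.add) (fun c _ => TrU.smul c)
    (fun j _ => TrU.act_X j) (fun _ _ => Eop_add) (fun c _ => Eop_smul c)
    (fun j _ h => Eop_X h j) P F hF).1

theorem Eop_act (P : MvPolynomial (Fin 2) ℂ) {F : ℤ × ℤ → V} (hF : TrU F) :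
    Eop (act V e2 P F) = act V e2 (aeval subQ P) (Eop F) :=
  (act_intertwine TrU Eop subQ (fun _ _ => TrU.add) (fun c _ => TrU.smul c)
    (fun j _ => TrU.act_X j) (fun _ _ => Eop_add) (fun c _ => Eop_smul c)
    (fun j _ h => Eop_X h j) P F hF).2

theorem Sop_of_neg (G : ℤ × ℤ → V) {J : ℤ} (h : J < 0) (q : ℤ) : Sop G (J, q) = 0 := by
  simp [Sop, ch_neg h]

theorem Sop_trunc {G : ℤ × ℤ → V} {N : ℤ} (hN : ∀ k : ℤ × ℤ, (k.1 < N ∨ k.2 < N) → G k = 0)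
    {J q : ℤ} (h : q + J < 2 * N) : Sop G (J, q) = 0 := by
  rw [Sop, finsum_eq_zero_of_forall_eq_zero]
  intro m
  rw [hN _ (by simp only; omega), smul_zero]

theorem Eop_eq_Sop {G : ℤ × ℤ → V} (h : ∀ k : ℤ × ℤ, k.1 < 0 → G k = 0) : Eop G = Sop G := by
  funext k
  refine finsum_congr fun m => ?_
  rcases lt_or_ge m 0 with hm | hm
  · rw [h _ hm, smul_zero, h _ hm, smul_zero]
  · rw [ch_symm hm, show k.2 - (m - k.1) = k.2 - m + k.1 by ring]

/-! ### The substitution after clearing a pole along the diagonal -/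

/-- The polynomial `x₁ - x₂`. -/
abbrev dl : MvPolynomial (Fin 2) ℂ := X 0 - X 1

theorem aeval_subQ_dl : aeval subQ dl = X 0 := by simp [dl]

/-- `(x₁ - x₂)^K G` is jointly lower truncated. -/
def QLK (K : ℕ) (G : ℤ × ℤ → V) : Prop := Laur2 (act V e2 (dl ^ K) G)

/-- `(x₁ - x₂)^K G` is jointly lower truncated for some `K`. -/
def QL (G : ℤ × ℤ → V) : Prop := ∃ K, QLK K G

theorem QLK.mono {K K' : ℕ} {G : ℤ × ℤ → V} (h : QLK K G) (hK : K ≤ K') : QLK K' G := by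
  obtain ⟨d, rfl⟩ := Nat.exists_eq_add_of_le hK
  rw [QLK, add_comm, pow_add, act_mul]
  exact Laur2.act _ h

/-- The substitution `x₁ = x₂ + x₀` on families with a pole along the diagonal. -/
def Sb (G : ℤ × ℤ → V) : ℤ × ℤ → V :=
  fun k => if h : QL G then Sop (act V e2 (dl ^ h.choose) G) (k.1 + h.choose, k.2) else 0

theorem Sop_dl_pow {G : ℤ × ℤ → V} (hG : Laur2 G) (d : ℕ) (k : ℤ × ℤ) :
    Sop (act V e2 (dl ^ d) G) (k.1 + d, k.2) = Sop G k := by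
  rw [Sop_act _ hG, map_pow, aeval_subQ_dl, act_X_pow]
  simp

theorem Sb_eq {K : ℕ} {G : ℤ × ℤ → V} (h : QLK K G) (k : ℤ × ℤ) :
    Sb G k = Sop (act V e2 (dl ^ K) G) (k.1 + K, k.2) := by
  have hq : QL G := ⟨K, h⟩
  have key : ∀ {K K' : ℕ}, QLK K G → K ≤ K' → Sop (act V e2 (dl ^ K) G) (k.1 + K, k.2) =
      Sop (act V e2 (dl ^ K') G) (k.1 + K', k.2) := by
    intro K K' h hK
    obtain ⟨d, rfl⟩ := Nat.exists_eq_add_of_le hK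
    rw [add_comm K d, pow_add, act_mul]
    have := Sop_dl_pow h d (k.1 + K, k.2)
    rw [← this]
    congr 2
    push_cast; ring
  rw [Sb, dif_pos hq]
  rcases le_total hq.choose K with hle | hle
  · exact key hq.choose_spec hle
  · exact (key h hle).symm

theorem Sb_of_laur2 {G : ℤ × ℤ → V} (h : Laur2 G) : Sb G = Sop G := by
  funext k
  have : QLK 0 G := by rw [QLK, pow_zero, act_one]; exact h
  rw [Sb_eq this, pow_zero, act_one]; simp

theorem X_pow_Sb {K : ℕ} {G : ℤ × ℤ → V} (h : QLK K G) :
    act V e2 (X 0 ^ K) (Sb G) = Sop (act V e2 (dl ^ K) G) := by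
  funext k
  rw [act_X_pow, Sb_eq h]
  simp

theorem QLK.add {K : ℕ} {F G : ℤ × ℤ → V} (hF : QLK K F) (hG : QLK K G) : QLK K (F + G) := by
  rw [QLK, map_add]; exact Laur2.add hF hG

theorem QLK.smul {K : ℕ} (c : ℂ) {F : ℤ × ℤ → V} (hF : QLK K F) : QLK K (c • F) := by
  rw [QLK, map_smul]; exact Laur2.smul c hF

theorem QLK.act {K : ℕ} (P : MvPolynomial (Fin 2) ℂ) {F : ℤ × ℤ → V} (hF : QLK K F) :
    QLK K (act V e2 P F) := by
  rw [QLK, act_comm]; exact Laur2.act P hF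

theorem QL.common {F G : ℤ × ℤ → V} (hF : QL F) (hG : QL G) : ∃ K, QLK K F ∧ QLK K G := by
  obtain ⟨K, hK⟩ := hF
  obtain ⟨M, hM⟩ := hG
  exact ⟨max K M, hK.mono (le_max_left _ _), hM.mono (le_max_right _ _)⟩

theorem Sb_add {F G : ℤ × ℤ → V} (hF : QL F) (hG : QL G) : Sb (F + G) = Sb F + Sb G := by
  obtain ⟨K, h1, h2⟩ := hF.common hG
  funext k
  rw [Pi.add_apply, Sb_eq h1, Sb_eq h2, Sb_eq (h1.add h2), map_add, Sop_add h1 h2]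
  rfl

theorem Sb_smul (c : ℂ) {F : ℤ × ℤ → V} (hF : QL F) : Sb (c • F) = c • Sb F := by
  obtain ⟨K, h1⟩ := hF
  funext k
  rw [Pi.smul_apply, Sb_eq h1, Sb_eq (h1.smul c), map_smul, Sop_smul c h1]
  rfl

theorem Sb_act (P : MvPolynomial (Fin 2) ℂ) {F : ℤ × ℤ → V} (hF : QL F) :
    Sb (act V e2 P F) = act V e2 (aeval subQ P) (Sb F) := by
  obtain ⟨K, h⟩ := hF
  have h1 := X_pow_Sb (h.act P)
  rw [act_comm, Sop_act _ h, ← X_pow_Sb h, act_comm] at h1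
  funext k
  have := congrFun h1 (k.1 + K, k.2)
  rw [act_X_pow, act_X_pow] at this
  simpa using this

end Subst

section WeakAssoc

variable {V : Type*} [AddCommGroup V] [Module ℂ V]

open MvPolynomial (X C aeval)

/-- The family of coefficients of `a(x₁) b(x₂) w`. -/
def Fu (a b : EW V) (w : V) : ℤ × ℤ → V := fun k => Fab a b w k.1 k.2

theorem mf_trunc (a : EW V) (w : V) : ∃ N : ℤ, ∀ n, N ≤ n → mf a w n = 0 := a.2 w

theorem mf_zero (a : EW V) (n : ℤ) : mf a 0 n = 0 := by simp [mf]

theorem mf_add (a : EW V) (v w : V) (n : ℤ) : mf a (v + w) n = mf a v n + mf a w n := by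
  simp [mf]

theorem mf_smul (a : EW V) (c : ℂ) (w : V) (n : ℤ) : mf a (c • w) n = c • mf a w n := by
  simp [mf]

theorem add_mf (a b : EW V) (w : V) (n : ℤ) : mf (a + b) w n = mf a w n + mf b w n := rfl

theorem smul_mf (c : ℂ) (a : EW V) (w : V) (n : ℤ) : mf (c • a) w n = c • mf a w n := rfl

theorem zero_mf (w : V) (n : ℤ) : mf (0 : EW V) w n = 0 := rfl

theorem EW_ext {a b : EW V} (h : ∀ w n, mf a w n = mf b w n) : a = b := by
  apply Subtype.ext
  ext w n
  exact h w n

/-- The mode `a_n` as a linear operator. -/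
def mfL (a : EW V) (n : ℤ) : V →ₗ[ℂ] V where
  toFun w := mf a w n
  map_add' v w := mf_add a v w n
  map_smul' c w := mf_smul a c w n

theorem Fu_trU (a b : EW V) (w : V) : TrU (Fu a b w) := by
  obtain ⟨N, hN⟩ := mf_trunc b w
  refine ⟨-N, fun k hk => ?_⟩
  rw [Fu, Fab, hN _ (by omega), mf_zero]

theorem X_pow_cancel {I : Type*} [AddCommGroup I] {σ : Type*} (e : σ → I) (j : σ) (K : ℕ)
    {F G : I → V} (h : act V e (X j ^ K) F = act V e (X j ^ K) G) : F = G := by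
  funext k
  have := congrFun h (k + K • e j)
  rw [act_X_pow, act_X_pow] at this
  simpa using this

/-- Expansions of a truncated family with a pole along the diagonal agree up to a power
of `x₁`. -/
theorem Eop_Sb_assoc {G : ℤ × ℤ → V} (ht : TrU G) (hq : QL G) :
    ∃ l : ℕ, act V e2 ((X 0 + X 1) ^ l) (Eop G) = act V e2 ((X 0 + X 1) ^ l) (Sb G) := by
  obtain ⟨K, hK⟩ := hq
  obtain ⟨N, hN⟩ := id hK
  refine ⟨(-N).toNat, X_pow_cancel e2 0 K ?_⟩
  set l := (-N).toNat
  have h1 : ∀ k : ℤ × ℤ, k.1 < 0 → act V e2 (X 0 ^ l) (act V e2 (dl ^ K) G) k = 0 := by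
    intro k hk
    rw [act_X_pow]
    apply hN
    left
    simp
    omega
  have h2 := Eop_eq_Sop h1
  rw [← act_mul, Eop_act _ ht, act_mul, Sop_act _ hK, ← X_pow_Sb hK, map_mul, map_pow, map_pow,
    aeval_subQ_dl] at h2
  simp only [MvPolynomial.aeval_X, Matrix.cons_val_zero, subQ] at h2
  rw [← act_mul, ← act_mul, mul_comm (X 0 ^ K), h2, act_mul]

/-- `x₀ + x₂` is cancellable on families truncated in the first variable. -/
theorem add_pow_cancel {A : ℤ × ℤ → V} {J₀ : ℤ} (hA : ∀ J q, J < J₀ → A (J, q) = 0) (l : ℕ)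
    (h : act V e2 ((X 0 + X 1) ^ l) A = 0) : A = 0 := by
  induction l with
  | zero => rwa [pow_zero, act_one] at h
  | succ l ih =>
    apply ih
    rw [pow_succ', act_mul, act_add] at h
    set B := act V e2 ((X 0 + X 1) ^ l) A with hB
    have hB0 : ∀ J q, J < J₀ → B (J, q) = 0 := by
      clear_value B
      subst hB
      clear ih h
      induction l with
      | zero => simpa [pow_zero, act_one] using hA
      | succ l ih =>
        intro J q hJ
        rw [pow_succ', act_mul, act_add, Pi.add_apply, act2_X0, act2_X1, ih _ _ (by omega),
          ih _ _ hJ, add_zero]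
    have step : ∀ n : ℕ, ∀ q, B (J₀ + n, q) = 0 := by
      intro n
      induction n with
      | zero =>
        intro q
        have := congrFun h (J₀, q + 1)
        rw [Pi.add_apply, act2_X0, act2_X1, hB0 _ _ (by omega)] at this
        simpa using this
      | succ n ih =>
        intro q
        have := congrFun h (J₀ + (n + 1 : ℕ), q + 1)
        rw [Pi.add_apply, act2_X0, act2_X1] at this
        have e : J₀ + ((n + 1 : ℕ) : ℤ) - 1 = J₀ + n := by push_cast; ring
        rw [e, ih] at this
        simpa using this
    funext ⟨J, q⟩
    rcases lt_or_ge J J₀ with hJ | hJ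
    · exact hB0 J q hJ
    · have := step (J - J₀).toNat q
      rwa [show J₀ + ((J - J₀).toNat : ℤ) = J by omega] at this

theorem mulSubPoly_X_pow (l : ℕ) (A : ℤ → ℤ → V) (a b : ℤ) :
    mulSubPoly (X 0 ^ l) A a b = act V e2 ((X 0 + X 1) ^ l) (fun k => A k.1 k.2) (a, b) := by
  rw [add_comm, add_pow, map_sum, LinearMap.sum_apply, Finset.sum_apply]
  have hs : (X 0 ^ l : MvPolynomial (Fin 2) ℂ) = MvPolynomial.monomial (Finsupp.single 0 l) 1 :=
    MvPolynomial.X_pow_eq_monomial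
  rw [mulSubPoly, hs, MvPolynomial.support_monomial, if_neg one_ne_zero, Finset.sum_singleton]
  simp only [Finsupp.single_eq_same]
  refine Finset.sum_congr rfl fun i hi => ?_
  have hc : ((l.choose i : ℕ) : MvPolynomial (Fin 2) ℂ) = C (l.choose i : ℂ) := by simp
  rw [hc, mul_comm _ (C _), act_mul, act_C, Pi.smul_apply, act_mul, act_X_pow, act_X_pow]
  rw [MvPolynomial.coeff_monomial, if_pos rfl, one_mul]
  have hi' : i ≤ l := by simp at hi; omega
  congr 2
  · simp [Nat.cast_sub hi']
  · simp

theorem prodCE_eq {V' : Type*} (Yo Yi : V' → V → ℤ → V) (u v : V') (w : V) (a b : ℤ) :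
    prodCE Yo Yi u v w a b =
      Eop (fun k => Yo u (Yi v w (-k.2 - 1)) (-k.1 - 1)) (a, b) := by
  refine finsum_congr fun m => ?_
  by_cases h : a ≤ m
  · rw [if_pos h, ch, if_neg (by omega)]
  · rw [if_neg h, ch_neg (by omega), zero_smul]

end WeakAssoc

/-! ### Compatibility -/

section Translation

open MvPolynomial (X C aeval)

/-- The derivation `∑ᵢ ∂/∂xᵢ`. -/
def dsum (σ : Type*) : Derivation ℂ (MvPolynomial σ ℂ) (MvPolynomial σ ℂ) :=
  MvPolynomial.mkDerivation ℂ fun _ => 1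

theorem dsum_X {σ : Type*} (i : σ) : dsum σ (X i) = 1 := MvPolynomial.mkDerivation_X _ _ _

theorem dsum_iterate_add {σ : Type*} (n : ℕ) (P Q : MvPolynomial σ ℂ) :
    (dsum σ)^[n] (P + Q) = (dsum σ)^[n] P + (dsum σ)^[n] Q :=
  iterate_map_add (dsum σ) n P Q

theorem dsum_iterate_zero {σ : Type*} (n : ℕ) : (dsum σ)^[n] 0 = 0 :=
  iterate_map_zero (dsum σ) n

theorem dsum_iterate_mul {σ : Type*} (n : ℕ) : ∀ (N M : ℕ) (P Q : MvPolynomial σ ℂ), N + M = n →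
    (dsum σ)^[N + 1] P = 0 → (dsum σ)^[M + 1] Q = 0 →
    ∃ c : ℕ, c ≠ 0 ∧ (dsum σ)^[n] (P * Q) = c • ((dsum σ)^[N] P * (dsum σ)^[M] Q) := by
  induction n with
  | zero =>
    intro N M P Q h hP hQ
    obtain rfl : N = 0 := by omega
    obtain rfl : M = 0 := by omega
    exact ⟨1, one_ne_zero, by simp⟩
  | succ n ih =>
    intro N M P Q h hP hQ
    have e : (dsum σ)^[n + 1] (P * Q) =
        (dsum σ)^[n] (P * dsum σ Q) + (dsum σ)^[n] (dsum σ P * Q) := by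
      rw [Function.iterate_succ_apply, Derivation.leibniz, smul_eq_mul, smul_eq_mul,
        mul_comm Q, dsum_iterate_add]
    rcases N with _ | N
    · obtain ⟨M, rfl⟩ : ∃ M', M = M' + 1 := ⟨M - 1, by omega⟩
      obtain ⟨c, hc, h2⟩ := ih 0 M P (dsum σ Q) (by omega) hP hQ
      refine ⟨c, hc, ?_⟩
      have hP' : dsum σ P = 0 := hP
      rw [e, h2, hP', zero_mul, dsum_iterate_zero, add_zero]
      rfl
    · rcases M with _ | M
      · obtain ⟨c, hc, h2⟩ := ih N 0 (dsum σ P) Q (by omega) hP hQ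
        refine ⟨c, hc, ?_⟩
        have hQ' : dsum σ Q = 0 := hQ
        rw [e, h2, hQ', mul_zero, dsum_iterate_zero, zero_add]
        rfl
      · obtain ⟨c, hc, h2⟩ := ih (N + 1) M P (dsum σ Q) (by omega) hP hQ
        obtain ⟨c', hc', h3⟩ := ih N (M + 1) (dsum σ P) Q (by omega) hP hQ
        refine ⟨c + c', by omega, ?_⟩
        rw [e, h2, h3, add_smul]
        rfl

theorem dsum_nilpotent {σ : Type*} (P : MvPolynomial σ ℂ) : ∃ N, (dsum σ)^[N + 1] P = 0 := by
  induction P using MvPolynomial.induction_on with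
  | C c => exact ⟨0, by simp [← MvPolynomial.algebraMap_eq]⟩
  | add p q hp hq =>
    obtain ⟨N, hN⟩ := hp
    obtain ⟨M, hM⟩ := hq
    refine ⟨N + M, ?_⟩
    rw [dsum_iterate_add, show N + M + 1 = M + (N + 1) by ring, Function.iterate_add_apply, hN,
      show M + (N + 1) = N + (M + 1) by ring, Function.iterate_add_apply, hM, dsum_iterate_zero,
      dsum_iterate_zero, add_zero]
  | mul_X p i hp =>
    obtain ⟨N, hN⟩ := hp
    have hX : (dsum σ)^[1 + 1] (X i) = 0 := by
      simp [dsum_X]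
    obtain ⟨c, -, h⟩ := dsum_iterate_mul (N + 1) N 1 p (X i) rfl hN hX
    refine ⟨N + 1, ?_⟩
    rw [Function.iterate_succ_apply', h, map_nsmul, Derivation.leibniz,
      ← Function.iterate_succ_apply' (dsum σ), ← Function.iterate_succ_apply' (dsum σ), hN, hX]
    simp

theorem dsum_top {σ : Type*} {P : MvPolynomial σ ℂ} (hP : P ≠ 0) :
    ∃ N, (dsum σ)^[N + 1] P = 0 ∧ (dsum σ)^[N] P ≠ 0 := by
  have h := dsum_nilpotent P
  refine ⟨Nat.find h, Nat.find_spec h, fun h0 => ?_⟩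
  rcases hn : Nat.find h with _ | n
  · rw [hn] at h0; exact hP h0
  · rw [hn] at h0
    exact Nat.find_min h (m := n) (by omega) h0

theorem dsum_rename {σ τ : Type*} (f : σ → τ) (P : MvPolynomial σ ℂ) :
    dsum τ (MvPolynomial.rename f P) = MvPolynomial.rename f (dsum σ P) := by
  induction P using MvPolynomial.induction_on with
  | C c => simp [← MvPolynomial.algebraMap_eq]
  | add p q hp hq => simp [hp, hq]
  | mul_X p i hp => simp [hp, dsum_X]

theorem dsum_iterate_rename {σ τ : Type*} (f : σ → τ) (n : ℕ) (P : MvPolynomial σ ℂ) :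
    (dsum τ)^[n] (MvPolynomial.rename f P) = MvPolynomial.rename f ((dsum σ)^[n] P) := by
  induction n generalizing P with
  | zero => rfl
  | succ n ih => rw [Function.iterate_succ_apply, dsum_rename, ih]; rfl

theorem dsum_prod_rename {ι σ τ : Type*} (s : Finset ι) (f : ι → σ → τ) (N : ℕ)
    (p : MvPolynomial σ ℂ) (hp : (dsum σ)^[N + 1] p = 0) :
    ∃ n c : ℕ, c ≠ 0 ∧ (dsum τ)^[n + 1] (∏ i ∈ s, MvPolynomial.rename (f i) p) = 0 ∧
      (dsum τ)^[n] (∏ i ∈ s, MvPolynomial.rename (f i) p) =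
        c • ∏ i ∈ s, MvPolynomial.rename (f i) ((dsum σ)^[N] p) := by
  induction s using Finset.induction_on with
  | empty => exact ⟨0, 1, one_ne_zero, by simp, by simp⟩
  | insert a s ha ih =>
    obtain ⟨n, c, hc, h0, h1⟩ := ih
    have hpa : (dsum τ)^[N + 1] (MvPolynomial.rename (f a) p) = 0 := by
      rw [dsum_iterate_rename, hp, map_zero]
    obtain ⟨c', hc', h2⟩ := dsum_iterate_mul (N + n) N n _ _ rfl hpa h0
    refine ⟨N + n, c' * c, mul_ne_zero hc' hc, ?_, ?_⟩
    · rw [Finset.prod_insert ha, Function.iterate_succ_apply', h2, map_nsmul, Derivation.leibniz,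
        ← Function.iterate_succ_apply' (dsum τ), ← Function.iterate_succ_apply' (dsum τ), hpa, h0]
      simp
    · rw [Finset.prod_insert ha, Finset.prod_insert ha, h2, h1, dsum_iterate_rename, mul_smul,
        mul_smul_comm]

/-- A translation invariant polynomial is a polynomial in the difference of the variables. -/
theorem eq_aeval_sub_of_dsum_eq_zero {p : MvPolynomial (Fin 2) ℂ} (hp : dsum (Fin 2) p = 0) :
    ∃ h : Polynomial ℂ, p = Polynomial.aeval (X 0 - X 1 : MvPolynomial (Fin 2) ℂ) h := by
  let Φ : MvPolynomial (Fin 2) ℂ →ₐ[ℂ] Polynomial (Polynomial ℂ) :=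
    aeval ![Polynomial.C Polynomial.X + Polynomial.X, Polynomial.X]
  let Ψ : Polynomial (Polynomial ℂ) →+* MvPolynomial (Fin 2) ℂ :=
    Polynomial.eval₂RingHom
      (Polynomial.aeval (X 0 - X 1 : MvPolynomial (Fin 2) ℂ)).toRingHom (X 1)
  have hΨ : ∀ q, Ψ (Φ q) = q := by
    intro q
    induction q using MvPolynomial.induction_on with
    | C c =>
      have : Φ (C c) = Polynomial.C (Polynomial.C c) := MvPolynomial.aeval_C _ _
      rw [this]; simp [Ψ, MvPolynomial.algebraMap_eq]
    | add p q hp hq => rw [map_add, map_add, hp, hq]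
    | mul_X p i hp =>
      rw [map_mul, map_mul, hp]
      congr 1
      fin_cases i <;> simp [Φ, Ψ]
  have hD : ∀ q, Polynomial.derivative (Φ q) = Φ (dsum _ q) := by
    intro q
    induction q using MvPolynomial.induction_on with
    | C c =>
      have : Φ (C c) = Polynomial.C (Polynomial.C c) := MvPolynomial.aeval_C _ _
      rw [this]; simp [← MvPolynomial.algebraMap_eq]
    | add p q hp hq => simp [hp, hq]
    | mul_X p i hp =>
      rw [map_mul, Polynomial.derivative_mul, hp, Derivation.leibniz, dsum_X, map_add]
      have : Polynomial.derivative (Φ (X i)) = 1 := by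
        fin_cases i <;> simp [Φ]
      rw [this]
      simp [mul_comm, add_comm]
  have h0 : Polynomial.derivative (Φ p) = 0 := by rw [hD, hp, map_zero]
  have h1 := Polynomial.derivative_eq_zero.mp h0
  obtain ⟨h, hh⟩ := Polynomial.natDegree_eq_zero.mp h1
  refine ⟨h, ?_⟩
  rw [← hΨ p, ← hh]
  simp [Ψ]

theorem exists_dl_pow_mul_of_dsum_eq_zero {p : MvPolynomial (Fin 2) ℂ} (h0 : p ≠ 0)
    (hp : dsum (Fin 2) p = 0) :
    ∃ (k : ℕ) (g : MvPolynomial (Fin 2) ℂ), p = dl ^ k * g ∧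
      MvPolynomial.constantCoeff g ≠ 0 := by
  obtain ⟨h, rfl⟩ := eq_aeval_sub_of_dsum_eq_zero hp
  have hh : h ≠ 0 := by rintro rfl; simp at h0
  obtain ⟨q, hq, hnd⟩ := Polynomial.exists_eq_pow_rootMultiplicity_mul_and_not_dvd h hh 0
  rw [Polynomial.C_0, sub_zero] at hq hnd
  refine ⟨h.rootMultiplicity 0, Polynomial.aeval (X 0 - X 1) q, ?_, ?_⟩
  · conv_lhs => rw [hq]
    simp [dl]
  · intro hc
    apply hnd
    rw [Polynomial.X_dvd_iff, ← hc]
    have : MvPolynomial.constantCoeff (Polynomial.aeval (X 0 - X 1 : MvPolynomial (Fin 2) ℂ) q) =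
        Polynomial.eval₂ (RingHom.id ℂ) 0 q := by
      rw [Polynomial.aeval_def, Polynomial.hom_eval₂]
      congr 1
      · ext; simp
      · simp
    rw [this]; simp [Polynomial.coeff_zero_eq_eval_zero]

end Translation

section Compat

variable {V : Type*} [AddCommGroup V] [Module ℂ V]

open MvPolynomial (X C aeval)

/-- The bracket relation `[L, a(x)] = (d/dx) a(x)`. -/
def Dbr (L : V →ₗ[ℂ] V) (a : EW V) : Prop :=
  ∀ (v : V) (n : ℤ), L (mf a v n) - mf a (L v) n = (-n : ℂ) • mf a v (n - 1)

/-- The operator `∑ᵢ ∂/∂xᵢ` on families. -/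
def pdN {r : ℕ} (F : (Fin r → ℤ) → V) : (Fin r → ℤ) → V :=
  fun k => ∑ i, ((k i : ℂ) + 1) • F (k + Pi.single i 1)

theorem pdN_add {r : ℕ} (F G : (Fin r → ℤ) → V) : pdN (F + G) = pdN F + pdN G := by
  funext k
  simp [pdN, Finset.sum_add_distrib]

theorem pdN_smul {r : ℕ} (c : ℂ) (F : (Fin r → ℤ) → V) : pdN (c • F) = c • pdN F := by
  funext k
  simp only [pdN, Pi.smul_apply, Finset.smul_sum]
  exact Finset.sum_congr rfl fun i _ => smul_comm _ _ _

theorem pdN_act {r : ℕ} (P : MvPolynomial (Fin r) ℂ) (F : (Fin r → ℤ) → V) :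
    pdN (act V (eN r) P F) =
      act V (eN r) P (pdN F) + act V (eN r) (dsum (Fin r) P) F := by
  induction P using MvPolynomial.induction_on generalizing F with
  | C c =>
    rw [act_C, act_C, pdN_smul, ← MvPolynomial.algebraMap_eq, Derivation.map_algebraMap, map_zero]
    simp
  | add p q hp hq =>
    rw [act_add, pdN_add, hp, hq, act_add, map_add, act_add]; abel
  | mul_X p i hp =>
    rw [act_mul, hp, Derivation.leibniz, dsum_X, act_mul, act_add]
    have key : pdN (act V (eN r) (X i) F) = act V (eN r) (X i) (pdN F) + F := by
      funext k
      rw [Pi.add_apply, act_X]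
      simp only [pdN, act_X]
      have : F k = ∑ j, (if j = i then F k else 0) := by simp
      rw [this, ← Finset.sum_add_distrib]
      refine Finset.sum_congr rfl fun j _ => ?_
      rw [show k + Pi.single j 1 - eN r i = k - eN r i + Pi.single j 1 by abel]
      rcases eq_or_ne j i with rfl | h
      · rw [if_pos rfl, show k - eN r j + Pi.single j 1 = k by simp]
        rw [← sub_eq_zero]
        have : (((k - eN r j) j : ℤ) : ℂ) = k j - 1 := by simp
        rw [this]
        module
      · simp [h]
    rw [key, map_add, smul_eq_mul, smul_eq_mul, mul_one, mul_comm (X i), act_mul]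
    abel

theorem IsLaurentN.add {r : ℕ} {F G : (Fin r → ℤ) → V} (hF : IsLaurentN F) (hG : IsLaurentN G) :
    IsLaurentN (F + G) := by
  obtain ⟨N, hN⟩ := hF
  obtain ⟨M, hM⟩ := hG
  refine ⟨min N M, fun k ⟨i, hi⟩ => ?_⟩
  have h1 := hN k ⟨i, by omega⟩
  have h2 := hM k ⟨i, by omega⟩
  simp [h1, h2]

theorem IsLaurentN.smul {r : ℕ} (c : ℂ) {F : (Fin r → ℤ) → V} (hF : IsLaurentN F) :
    IsLaurentN (c • F) := by
  obtain ⟨N, hN⟩ := hF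
  exact ⟨N, fun k hk => by simp [hN k hk]⟩

theorem IsLaurentN.pdN {r : ℕ} {F : (Fin r → ℤ) → V} (hF : IsLaurentN F) :
    IsLaurentN (pdN F) := by
  obtain ⟨N, hN⟩ := hF
  refine ⟨N - 1, fun k ⟨i, hi⟩ => Finset.sum_eq_zero fun j _ => ?_⟩
  rw [hN _ ⟨i, ?_⟩, smul_zero]
  rw [Pi.add_apply, Pi.single_apply]
  split_ifs <;> omega

theorem seqCoeff_bracket {L : V →ₗ[ℂ] V} {r : ℕ} (ψ : Fin r → EW V) (hψ : ∀ i, Dbr L (ψ i))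
    (w : V) (k : Fin r → ℤ) :
    L (seqCoeff ψ w k) - seqCoeff ψ (L w) k = pdN (seqCoeff ψ w) k := by
  induction r with
  | zero => simp [seqCoeff, pdN]
  | succ r ih =>
    have h1 := hψ 0 (seqCoeff (Fin.tail ψ) w (Fin.tail k)) (-(k 0) - 1)
    have h2 := ih (Fin.tail ψ) (fun i => hψ _) (Fin.tail k)
    rw [sub_eq_iff_eq_add] at h1 h2
    have e0 : ∀ w', seqCoeff ψ w' k =
      mf (ψ 0) (seqCoeff (Fin.tail ψ) w' (Fin.tail k)) (-(k 0) - 1) := fun _ => rfl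
    rw [e0, e0, h1, h2, mf_add, pdN, pdN, Fin.sum_univ_succ]
    have e1 : mf (ψ 0) (∑ i, (((Fin.tail k i : ℤ) : ℂ) + 1) •
        seqCoeff (Fin.tail ψ) w (Fin.tail k + Pi.single i 1)) (-(k 0) - 1) =
        ∑ i : Fin r, ((k i.succ : ℂ) + 1) • seqCoeff ψ w (k + Pi.single i.succ 1) := by
      change mfL (ψ 0) _ _ = _
      rw [map_sum]
      refine Finset.sum_congr rfl fun i _ => ?_
      rw [map_smul]
      simp only [seqCoeff]
      congr 1
      change mf (ψ 0) _ _ = _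
      congr 2
      · congr 1
        funext j
        simp [Pi.single_apply]
      · simp
    have e2 : seqCoeff ψ w (k + Pi.single 0 1) =
        mf (ψ 0) (seqCoeff (Fin.tail ψ) w (Fin.tail k)) (-(k 0) - 1 - 1) := by
      have h0 : Fin.tail (k + Pi.single 0 1 : Fin (r + 1) → ℤ) = Fin.tail k := by
        funext j; simp [Fin.tail]
      have h3 : (k + Pi.single 0 1 : Fin (r + 1) → ℤ) 0 = k 0 + 1 := by simp
      simp only [seqCoeff]
      rw [h0, h3]
      congr 1
      ring
    rw [e1, e2]
    push_cast
    module

/-- A sequence of fields multiplied by the derivative of a polynomial which makes them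
compatible stays compatible. -/
theorem IsLaurentN.act_dsum {L : V →ₗ[ℂ] V} {r : ℕ} {ψ : Fin r → EW V} (hψ : ∀ i, Dbr L (ψ i))
    {P : MvPolynomial (Fin r) ℂ} (hP : ∀ w, IsLaurentN (act V (eN r) P (seqCoeff ψ w))) (w : V) :
    IsLaurentN (act V (eN r) (dsum _ P) (seqCoeff ψ w)) := by
  have h1 : (fun k => L (seqCoeff ψ w k)) = seqCoeff ψ (L w) + NVA.pdN (seqCoeff ψ w) := by
    funext k
    rw [Pi.add_apply, ← seqCoeff_bracket ψ hψ w k]; abel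
  have h2 := pdN_act P (seqCoeff ψ w)
  have h3 : act V (eN r) P (NVA.pdN (seqCoeff ψ w)) =
      (fun k => L (act V (eN r) P (seqCoeff ψ w) k)) +
        (-1 : ℂ) • act V (eN r) P (seqCoeff ψ (L w)) := by
    rw [← act_map, h1, map_add]; simp
  have h4 : act V (eN r) (dsum _ P) (seqCoeff ψ w) =
      NVA.pdN (act V (eN r) P (seqCoeff ψ w)) +
      ((-1 : ℂ) • (fun k => L (act V (eN r) P (seqCoeff ψ w) k)) +
        act V (eN r) P (seqCoeff ψ (L w))) := by
    rw [h2, h3]; module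
  rw [h4]
  refine (hP w).pdN.add (IsLaurentN.add (IsLaurentN.smul _ ?_) (hP _))
  obtain ⟨N, hN⟩ := hP w
  exact ⟨N, fun k hk => by simp only [hN k hk, map_zero]⟩

theorem IsLaurentN.act_dsum_iterate {L : V →ₗ[ℂ] V} {r : ℕ} {ψ : Fin r → EW V}
    (hψ : ∀ i, Dbr L (ψ i)) {P : MvPolynomial (Fin r) ℂ}
    (hP : ∀ w, IsLaurentN (act V (eN r) P (seqCoeff ψ w))) (n : ℕ) (w : V) :
    IsLaurentN (act V (eN r) ((dsum _)^[n] P) (seqCoeff ψ w)) := by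
  induction n generalizing w with
  | zero => exact hP w
  | succ n ih => rw [Function.iterate_succ_apply']; exact IsLaurentN.act_dsum hψ ih w

/-! Families with well-founded support -/

theorem isWF_support_act {r : ℕ} (P : MvPolynomial (Fin r) ℂ) {F : (Fin r → ℤ) → V}
    (hF : (Function.support F).IsWF) : (Function.support (act V (eN r) P F)).IsWF := by
  refine (act_intertwine (e := eN r) (e' := eN r)
    (fun F : (Fin r → ℤ) → V => (Function.support F).IsWF) id X ?_ ?_ ?_
    (fun _ _ _ _ => rfl) (fun _ _ _ => rfl) (fun _ _ _ => rfl) P F hF).1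
  · intro F G hF hG
    exact (hF.union hG).mono (Function.support_add F G)
  · intro c F hF
    exact hF.mono (Function.support_const_smul_subset c F)
  · intro j F hF
    have : Set.MapsTo (fun k => k - eN r j) (Function.support (act V (eN r) (X j) F))
        (Function.support F) := by
      intro k hk
      rwa [Function.mem_support, act_X] at hk
    refine (Set.WellFoundedOn.mapsTo _ this hF).mono ?_ subset_rfl
    intro a b h
    exact sub_lt_sub_right h _

theorem isWF_support_seqCoeff {r : ℕ} (ψ : Fin r → EW V) (w : V) :
    (Function.support (seqCoeff ψ w)).IsWF := by
  induction r with
  | zero => exact Set.Finite.isWF (Set.toFinite _)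
  | succ r ih =>
    rw [Set.IsWF, Set.wellFoundedOn_iff, WellFounded.wellFounded_iff_has_min]
    intro T ⟨k0, hk0⟩
    by_cases hT : ∃ k ∈ T, k ∉ Function.support (seqCoeff ψ w)
    · obtain ⟨k, hk, hks⟩ := hT
      exact ⟨k, hk, fun x _ hx => hks hx.2.2⟩
    push Not at hT
    have h1 := ih (Fin.tail ψ)
    rw [Set.IsWF, Set.wellFoundedOn_iff, WellFounded.wellFounded_iff_has_min] at h1
    obtain ⟨kt, ⟨k1, hk1, hk1t⟩, hmin⟩ := h1 (Fin.tail '' T) ⟨_, k0, hk0, rfl⟩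
    have htail : ∀ k ∈ T, Fin.tail k ∈ Function.support (seqCoeff (Fin.tail ψ) w) := by
      intro k hk h0
      apply hT k hk
      simp only [seqCoeff, h0, mf_zero]
    obtain ⟨N, hN⟩ := mf_trunc (ψ 0) (seqCoeff (Fin.tail ψ) w kt)
    have hb : ∃ b : ℤ, ∀ z : ℤ, (∃ k ∈ T, Fin.tail k = kt ∧ k 0 = z) → b ≤ z := by
      refine ⟨-N, ?_⟩
      rintro z ⟨k, hk, rfl, rfl⟩
      by_contra h
      exact hT k hk (hN _ (by omega))
    obtain ⟨z, ⟨k, hk, hkt, rfl⟩, hzmin⟩ :=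
      Int.exists_least_of_bdd hb ⟨k1 0, k1, hk1, hk1t, rfl⟩
    refine ⟨k, hk, fun x hx hlt => ?_⟩
    have hle := hlt.1.le
    have hxt : Fin.tail x = kt := by
      by_contra hne
      refine hmin _ ⟨x, hx, rfl⟩ ⟨lt_of_le_of_ne ?_ hne, htail x hx, ?_⟩
      · rw [← hkt]; exact fun i => hle i.succ
      · rw [← hkt]; exact htail k hk
    have h0 := hzmin (x 0) ⟨x, hx, hxt, rfl⟩
    refine hlt.1.not_ge fun i => ?_
    refine Fin.cases h0 (fun j => ?_) i
    have := congrFun (hxt.trans hkt.symm) j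
    exact this.ge

/-- A polynomial with nonzero constant term can be stripped off. -/
theorem IsLaurentN.of_act {r : ℕ} {P : MvPolynomial (Fin r) ℂ} {G : (Fin r → ℤ) → V}
    (hP : MvPolynomial.constantCoeff P ≠ 0) (hG : (Function.support G).IsWF)
    (h : IsLaurentN (act V (eN r) P G)) : IsLaurentN G := by
  obtain ⟨M, hM⟩ := h
  refine ⟨M, fun k ⟨i, hi⟩ => ?_⟩
  by_contra hk
  rw [Set.IsWF, Set.wellFoundedOn_iff, WellFounded.wellFounded_iff_has_min] at hG
  obtain ⟨m, ⟨hm, hmi⟩, hmin⟩ := hG {k | k ∈ Function.support G ∧ k i < M} ⟨k, hk, hi⟩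
  apply hm
  have h1 := hM m ⟨i, hmi⟩
  rw [act_apply, Finset.sum_eq_single 0] at h1
  · simp only [map_zero, sub_zero] at h1
    exact (smul_eq_zero.mp h1).resolve_left hP
  · intro d _ hd
    by_contra hne
    have hs : m - wt (eN r) d ∈ Function.support G := fun h => hne (by rw [h, smul_zero])
    have hle : m - wt (eN r) d ≤ m := by
      intro j
      rw [wt_eN]; simp
    refine hmin _ ⟨hs, (hle i).trans_lt hmi⟩ ⟨lt_of_le_of_ne hle ?_, hs, hm⟩
    intro he
    apply hd
    have h0 : wt (eN r) d = 0 := by simpa using he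
    ext j
    have := congrFun h0 j
    rw [wt_eN] at this
    simpa using this
  · intro h0
    rw [MvPolynomial.notMem_support_iff] at h0
    exact absurd h0 hP

/-- Quasi compatible sequences of fields satisfying the bracket relation are compatible. -/
theorem QCSeq.compatible {L : V →ₗ[ℂ] V} {r : ℕ} {ψ : Fin r → EW V} (hψ : ∀ i, Dbr L (ψ i))
    (h : QCSeq ψ) : ∃ k : ℕ, ∀ w, IsLaurentN (act V (eN r)
      (∏ ij ∈ Finset.univ.filter (fun ij : Fin r × Fin r => ij.1 < ij.2), (X ij.1 - X ij.2) ^ k)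
      (seqCoeff ψ w)) := by
  obtain ⟨p, hp0, hp⟩ := h
  obtain ⟨N, hN0, hN1⟩ := dsum_top hp0
  obtain ⟨k, g, hg, hg0⟩ := exists_dl_pow_mul_of_dsum_eq_zero hN1
    (by rw [← Function.iterate_succ_apply' (dsum _)]; exact hN0)
  obtain ⟨n, c, hc, -, h1⟩ := dsum_prod_rename
    (Finset.univ.filter (fun ij : Fin r × Fin r => ij.1 < ij.2)) (fun ij => ![ij.1, ij.2]) N p hN0
  refine ⟨k, fun w => ?_⟩
  have h2 : IsLaurentN (act V (eN r) ((dsum _)^[n] (pairPoly p r)) (seqCoeff ψ w)) :=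
    IsLaurentN.act_dsum_iterate hψ (fun w => by rw [← mulPolyN_eq]; exact hp w) n w
  rw [pairPoly, h1, hg] at h2
  simp only [map_mul, Finset.prod_mul_distrib] at h2
  rw [← Nat.cast_smul_eq_nsmul ℂ, map_smul, LinearMap.smul_apply] at h2
  replace h2 := IsLaurentN.smul ((c : ℂ)⁻¹) h2
  rw [smul_smul, inv_mul_cancel₀ (by exact_mod_cast hc), one_smul, mul_comm, act_mul] at h2
  have h3 := IsLaurentN.of_act ?_ (isWF_support_act _ (isWF_support_seqCoeff ψ w)) h2
  · simpa [dl] using h3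
  · rw [map_prod, Finset.prod_ne_zero_iff]
    intro ij _
    rwa [MvPolynomial.constantCoeff_rename]

/-- `(x₁ - x₂)(x₁ - x₃)(x₂ - x₃)`. -/
abbrev vd : MvPolynomial (Fin 3) ℂ := (X 0 - X 1) * (X 0 - X 2) * (X 1 - X 2)

/-- Joint lower truncation in three variables. -/
def Laur3 (F : ℤ × ℤ × ℤ → V) : Prop :=
  ∃ N : ℤ, ∀ k : ℤ × ℤ × ℤ, (k.1 < N ∨ k.2.1 < N ∨ k.2.2 < N) → F k = 0

/-- The family of coefficients of `a(x₁) b(x₂) c(x₃) w`. -/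
def Ft (a b c : EW V) (w : V) : ℤ × ℤ × ℤ → V :=
  fun k => mf a (mf b (mf c w (-k.2.2 - 1)) (-k.2.1 - 1)) (-k.1 - 1)

theorem QCSeq.pair {L : V →ₗ[ℂ] V} {a b : EW V} (ha : Dbr L a) (hb : Dbr L b)
    (h : QCSeq ![a, b]) : ∃ k : ℕ, ∀ w, QLK k (Fu a b w) := by
  obtain ⟨k, hk⟩ := h.compatible (L := L) (by intro i; fin_cases i <;> assumption)
  refine ⟨k, fun w => ?_⟩
  obtain ⟨N, hN⟩ := hk w
  have hs : Finset.univ.filter (fun ij : Fin 2 × Fin 2 => ij.1 < ij.2) = {(0, 1)} := by decide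
  rw [hs, Finset.prod_singleton] at hN
  have h1 := act_comp (V := V) (e := eN 2) (e' := e2) (fun k : ℤ × ℤ => ![k.1, k.2]) id
    (by rintro ⟨m, t⟩ j; fin_cases j <;> (funext i; fin_cases i <;> simp))
    (dl ^ k) (seqCoeff ![a, b] w)
  have h2 : (fun k : ℤ × ℤ => seqCoeff ![a, b] w ![k.1, k.2]) = Fu a b w := by
    funext k
    simp [seqCoeff, Fu, Fab, Fin.tail]
  rw [h2, MvPolynomial.rename_id_apply] at h1
  refine ⟨N, fun k hk => ?_⟩
  rw [← h1]
  refine hN _ ?_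
  rcases hk with hk | hk
  · exact ⟨0, hk⟩
  · exact ⟨1, hk⟩

theorem QCSeq.triple {L : V →ₗ[ℂ] V} {a b c : EW V} (ha : Dbr L a) (hb : Dbr L b) (hc : Dbr L c)
    (h : QCSeq ![a, b, c]) : ∃ k : ℕ, ∀ w, Laur3 (act V e3 (vd ^ k) (Ft a b c w)) := by
  obtain ⟨k, hk⟩ := h.compatible (L := L) (by intro i; fin_cases i <;> assumption)
  refine ⟨k, fun w => ?_⟩
  obtain ⟨N, hN⟩ := hk w
  have hs : Finset.univ.filter (fun ij : Fin 3 × Fin 3 => ij.1 < ij.2) =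
      {(0, 1), (0, 2), (1, 2)} := by decide
  rw [hs, Finset.prod_insert (by decide), Finset.prod_insert (by decide),
    Finset.prod_singleton, ← mul_pow, ← mul_pow, ← mul_assoc] at hN
  have h1 := act_comp (V := V) (e := eN 3) (e' := e3)
    (fun k : ℤ × ℤ × ℤ => ![k.1, k.2.1, k.2.2]) id
    (by rintro ⟨m, t, s⟩ j; fin_cases j <;> (funext i; fin_cases i <;> simp))
    (vd ^ k) (seqCoeff ![a, b, c] w)
  have h2 : (fun k : ℤ × ℤ × ℤ => seqCoeff ![a, b, c] w ![k.1, k.2.1, k.2.2]) = Ft a b c w := by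
    funext k
    simp [seqCoeff, Ft, Fin.tail]
  rw [h2, MvPolynomial.rename_id_apply] at h1
  refine ⟨N, fun k hk => ?_⟩
  rw [← h1]
  refine hN _ ?_
  rcases hk with hk | hk | hk
  · exact ⟨0, hk⟩
  · exact ⟨1, hk⟩
  · exact ⟨2, hk⟩

end Compat

section Formula

variable {V : Type*} [AddCommGroup V] [Module ℂ V]

open MvPolynomial (X C aeval)

/-- Families bounded below in the first variable and, for each value of it, bounded below in
the second one. -/
def LexBdd (G : ℤ × ℤ → V) : Prop :=
  (∃ J₀ : ℤ, ∀ J q : ℤ, J < J₀ → G (J, q) = 0) ∧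
    ∀ J : ℤ, ∃ T : ℤ, ∀ q : ℤ, q < T → G (J, q) = 0

theorem LexBdd.add {F G : ℤ × ℤ → V} (hF : LexBdd F) (hG : LexBdd G) : LexBdd (F + G) := by
  obtain ⟨⟨a, ha⟩, hF⟩ := hF
  obtain ⟨⟨b, hb⟩, hG⟩ := hG
  refine ⟨⟨min a b, fun J q h => ?_⟩, fun J => ?_⟩
  · simp [ha J q (by omega), hb J q (by omega)]
  · obtain ⟨c, hc⟩ := hF J
    obtain ⟨d, hd⟩ := hG J
    exact ⟨min c d, fun q h => by simp [hc q (by omega), hd q (by omega)]⟩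

theorem LexBdd.smul (c : ℂ) {F : ℤ × ℤ → V} (hF : LexBdd F) : LexBdd (c • F) := by
  obtain ⟨⟨a, ha⟩, hF⟩ := hF
  refine ⟨⟨a, fun J q h => by simp [ha J q h]⟩, fun J => ?_⟩
  obtain ⟨d, hd⟩ := hF J
  exact ⟨d, fun q h => by simp [hd q h]⟩

theorem LexBdd.act_X (j : Fin 2) {F : ℤ × ℤ → V} (hF : LexBdd F) :
    LexBdd (act V e2 (X j) F) := by
  obtain ⟨⟨a, ha⟩, hF⟩ := hF
  fin_cases j
  · refine ⟨⟨a + 1, fun J q h => (act2_X0 F J q).trans (ha _ _ (by omega))⟩, fun J => ?_⟩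
    obtain ⟨d, hd⟩ := hF (J - 1)
    exact ⟨d, fun q h => (act2_X0 F J q).trans (hd _ h)⟩
  · refine ⟨⟨a, fun J q h => (act2_X1 F J q).trans (ha _ _ h)⟩, fun J => ?_⟩
    obtain ⟨d, hd⟩ := hF J
    exact ⟨d + 1, fun q h => (act2_X1 F J q).trans (hd _ (by omega))⟩

theorem LexBdd.act (P : MvPolynomial (Fin 2) ℂ) {F : ℤ × ℤ → V} (hF : LexBdd F) :
    LexBdd (act V e2 P F) := by
  induction P using MvPolynomial.induction_on generalizing F with
  | C c => rw [act_C]; exact hF.smul c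
  | add p q hp hq => rw [act_add]; exact (hp hF).add (hq hF)
  | mul_X p j hp => rw [act_mul]; exact hp (hF.act_X j)

theorem K2_mul_add (y z w : K2) : y * (z + w) = y * z + y * w :=
  (inferInstance : Distrib K2).left_distrib y z w

theorem K2_mul_assoc (y z w : K2) : y * z * w = y * (z * w) :=
  (inferInstance : Semigroup K2).mul_assoc y z w

theorem K2_mul_zero (y : K2) : y * 0 = 0 :=
  (inferInstance : MulZeroClass K2).mul_zero y

theorem K2_inv_mul (y : K2) (h : y ≠ 0) : y⁻¹ * y = 1 :=
  inv_mul_cancel₀ (G₀ := K2) h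

theorem K2_coeff_mul_xOuter (y : K2) (n : ℤ) : (y * xOuter).coeff (n + 1) = y.coeff n := by
  have := HahnSeries.coeff_mul_single_add (r := (1 : LC)) (x := y) (a := n) (b := 1)
  exact this.trans (mul_one (M := LC) _)

theorem K2_coeff_mul_xInner (y : K2) (n m : ℤ) :
    ((y * xInner).coeff n).coeff (m + 1) = (y.coeff n).coeff m := by
  have h := HahnSeries.coeff_mul_single_add (r := (HahnSeries.single 1 1 : LC)) (x := y)
    (a := n) (b := 0)
  rw [add_zero] at h
  have h2 := HahnSeries.coeff_mul_single_add (r := (1 : ℂ)) (x := y.coeff n) (a := m) (b := 1)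
  rw [mul_one] at h2
  refine Eq.trans ?_ h2
  exact congrArg (fun z : LC => z.coeff (m + 1)) h

/-- The expansion of polynomials in `ℂ((x))((x₀))`. -/
def ev2 : MvPolynomial (Fin 2) ℂ →ₐ[ℂ] K2 := MvPolynomial.aeval ![xOuter, xInner]

theorem ev2_C (c : ℂ) : ev2 (MvPolynomial.C c) = HahnSeries.single 0 (HahnSeries.single 0 c) := by
  rw [ev2, MvPolynomial.aeval_C]
  rw [HahnSeries.algebraMap_apply']
  rw [MvPowerSeries.algebraMap_apply]
  rw [HahnSeries.algebraMap_apply']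
  rw [MvPowerSeries.algebraMap_apply]
  erw [HahnSeries.ofPowerSeries_C, HahnSeries.ofPowerSeries_C]
  rfl

theorem K2_mul_ev2_C (y : K2) (c : ℂ) (n m : ℤ) :
    ((y * ev2 (MvPolynomial.C c)).coeff n).coeff m = c * (y.coeff n).coeff m := by
  rw [ev2_C]
  have h := HahnSeries.coeff_mul_single_zero (r := (HahnSeries.single 0 c : LC)) (x := y) (a := n) 
  have h2 := HahnSeries.coeff_mul_single_zero (r := (c : ℂ)) (x := y.coeff n) (a := m) 
  refine Eq.trans ?_ (h2.trans (mul_comm _ _))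
  exact congrArg (fun z : LC => z.coeff m) h

theorem ev2_X_mul (y : K2) (p : MvPolynomial (Fin 2) ℂ) (j : Fin 2) :
  y * ev2 p * ![xOuter, xInner] j = y * ev2 (p * MvPolynomial.X j) := by
  rw [K2_mul_assoc, ev2, map_mul, MvPolynomial.aeval_X]
theorem ev2_add (y : K2) (p q : MvPolynomial (Fin 2) ℂ) :
  y * ev2 (p + q) = y * ev2 p + y * ev2 q := by
  rw [map_add]; exact K2_mul_add _ _ _

/-- Multiplication of a family by an iterated Laurent series. -/
def conv (y : K2) (G : ℤ × ℤ → V) : ℤ × ℤ → V :=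
  fun k => ∑ᶠ s : ℤ × ℤ, (y.coeff s.1).coeff s.2 • G (k - s)

theorem hahn_coeff_eq_zero_of_lt {R : Type*} [Zero R] (y : HahnSeries ℤ R) :
    ∃ N : ℤ, ∀ s : ℤ, s < N → y.coeff s = 0 := by
  by_cases h : y = 0
  · exact ⟨0, fun s _ => by simp [h]⟩
  · exact ⟨y.order, fun s hs => HahnSeries.coeff_eq_zero_of_lt_order hs⟩

theorem conv_finite (y : K2) {G : ℤ × ℤ → V} (hG : LexBdd G) (k : ℤ × ℤ) :
    (Function.support fun s : ℤ × ℤ => (y.coeff s.1).coeff s.2 • G (k - s)).Finite := by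
  obtain ⟨⟨J₀, h0⟩, hT⟩ := hG
  obtain ⟨N, hN⟩ := hahn_coeff_eq_zero_of_lt y
  choose T hT using hT
  choose M hM using fun s1 : ℤ => hahn_coeff_eq_zero_of_lt (y.coeff s1)
  refine ((Set.finite_Icc N (k.1 - J₀)).biUnion (t := fun s1 =>
    ({s1} : Set ℤ) ×ˢ Set.Icc (M s1) (k.2 - T (k.1 - s1)))
    (fun s1 _ => (Set.finite_singleton s1).prod (Set.finite_Icc _ _))).subset ?_
  rintro ⟨s1, s2⟩ hs
  simp only [Function.mem_support] at hs
  by_contra hn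
  apply hs
  simp only [Set.mem_iUnion, Set.mem_Icc, Set.mem_prod, Set.mem_singleton_iff, not_exists] at hn
  by_cases hc1 : s1 < N
  · simp [hN _ hc1]
  by_cases hc2 : k.1 - J₀ < s1
  · have : G (k - (s1, s2)) = 0 := h0 _ _ (by simp; omega)
    rw [this, smul_zero]
  have := hn s1 ⟨by omega, by omega⟩
  by_cases hc3 : s2 < M s1
  · simp [hM _ _ hc3]
  · have : G (k - (s1, s2)) = 0 := hT (k.1 - s1) _ (by simp; omega)
    rw [this, smul_zero]

theorem conv_add_left (y z : K2) {G : ℤ × ℤ → V} (hG : LexBdd G) :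
    conv (y + z) G = conv y G + conv z G := by
  funext k
  rw [Pi.add_apply, conv, conv, conv,
    ← finsum_add_distrib (conv_finite y hG k) (conv_finite z hG k)]
  refine finsum_congr fun s => ?_
  simp [add_smul]

theorem conv_add_right (y : K2) {F G : ℤ × ℤ → V} (hF : LexBdd F) (hG : LexBdd G) :
    conv y (F + G) = conv y F + conv y G := by
  funext k
  rw [Pi.add_apply, conv, conv, conv,
    ← finsum_add_distrib (conv_finite y hF k) (conv_finite y hG k)]
  refine finsum_congr fun s => ?_
  simp [smul_add]

theorem conv_xOuter (y : K2) (G : ℤ × ℤ → V) :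
    conv y (act V e2 (X 0) G) = conv (y * xOuter) G := by
  funext k
  refine finsum_eq_of_bijective (fun s : ℤ × ℤ => s + (1, 0))
    (Equiv.addRight ((1, 0) : ℤ × ℤ)).bijective fun s => ?_
  have h1 : (y * xOuter).coeff (s + (1, 0)).1 = y.coeff s.1 := by
    exact K2_coeff_mul_xOuter _ _
  rw [h1, act_X]
  congr 2
  · simp
  · simp [sub_sub]

theorem conv_xInner (y : K2) (G : ℤ × ℤ → V) :
    conv y (act V e2 (X 1) G) = conv (y * xInner) G := by
  funext k
  refine finsum_eq_of_bijective (fun s : ℤ × ℤ => s + (0, 1))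
    (Equiv.addRight ((0, 1) : ℤ × ℤ)).bijective fun s => ?_
  have h1 : ((y * xInner).coeff (s + (0, 1)).1).coeff (s + (0, 1)).2 =
      (y.coeff s.1).coeff s.2 := by
    have : (s + (0, 1)).1 = s.1 := by simp
    rw [this]
    exact K2_coeff_mul_xInner _ _ _
  rw [h1, act_X]
  congr 2
  simp [sub_sub]

theorem conv_smul_right (y : K2) (c : ℂ) (G : ℤ × ℤ → V) :
    conv y (c • G) = c • conv y G := by
  funext k
  rw [Pi.smul_apply, conv, conv, smul_finsum]
  exact finsum_congr fun s => smul_comm _ _ _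

theorem conv_ev2_C (y : K2) (c : ℂ) (G : ℤ × ℤ → V) :
    conv (y * ev2 (C c)) G = c • conv y G := by
  funext k
  rw [Pi.smul_apply, conv, conv, smul_finsum]
  refine finsum_congr fun s => ?_
  rw [K2_mul_ev2_C, mul_smul]

theorem conv_act (P : MvPolynomial (Fin 2) ℂ) (y : K2) {G : ℤ × ℤ → V} (hG : LexBdd G) :
    conv y (act V e2 P G) = conv (y * ev2 P) G := by
  induction P using MvPolynomial.induction_on generalizing G y with
  | C c => rw [act_C, conv_smul_right, conv_ev2_C]
  | add p q hp hq =>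
    rw [act_add, conv_add_right _ (hG.act p) (hG.act q), hp _ hG, hq _ hG, ev2_add,
      conv_add_left _ _ hG]
  | mul_X p j hp =>
    rw [act_mul, hp _ (hG.act_X j), ← ev2_X_mul]
    fin_cases j
    · exact conv_xOuter _ _
    · exact conv_xInner _ _

theorem conv_one (G : ℤ × ℤ → V) : conv 1 G = G := by
  funext k
  rw [conv, finsum_eq_single _ (0 : ℤ × ℤ)]
  · simp
  · rintro ⟨a, b⟩ h
    by_cases ha : a = 0
    · subst ha
      have hb : b ≠ 0 := by rintro rfl; exact h rfl
      simp [HahnSeries.coeff_one, hb]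
    · simp [HahnSeries.coeff_one, ha]

theorem ev2_ne_zero {P : MvPolynomial (Fin 2) ℂ} (hP : P ≠ 0) :
    ev2 P ≠ 0 := by
  intro h
  apply hP
  set D : ℤ × ℤ → ℂ := fun k => if k = 0 then 1 else 0
  have hD : LexBdd D := by
    refine ⟨⟨0, fun J q hJ => if_neg ?_⟩, fun J => ⟨0, fun q hq => if_neg ?_⟩⟩
    · intro h; have := congrArg Prod.fst h; simp at this; omega
    · intro h; have := congrArg Prod.snd h; simp at this; omega
  have h1 := conv_act P 1 hD
  rw [h, K2_mul_zero, conv_one] at h1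
  ext d
  have h2 := congrFun h1 (wt e2 d)
  rw [act_apply] at h2
  have h3 : ∀ d' : Fin 2 →₀ ℕ, D (wt e2 d - wt e2 d') = if d' = d then 1 else 0 := by
    intro d'
    by_cases hd : d' = d
    · simp [D, hd]
    · simp only [D, if_neg hd]
      refine if_neg fun h0 => hd ?_
      rw [sub_eq_zero, wt_e2, wt_e2, Prod.mk.injEq] at h0
      ext i
      fin_cases i
      · exact_mod_cast h0.1.symm
      · exact_mod_cast h0.2.symm
  simp only [h3] at h2
  have h4 : conv (0 : K2) D (wt e2 d) = 0 := by simp [conv]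
  rw [h4] at h2
  by_cases hd : d ∈ P.support
  · rw [Finset.sum_eq_single d (by intro b _ hb; simp [hb]) (by simp_all)] at h2
    simpa using h2
  · simpa using hd

theorem aeval_subQ_ne_zero {p : MvPolynomial (Fin 2) ℂ} (hp : p ≠ 0) : aeval subQ p ≠ 0 := by
  intro h
  apply hp
  have h1 : (aeval ![X 0 - X 1, X 1] : MvPolynomial (Fin 2) ℂ →ₐ[ℂ] _).comp (aeval subQ) =
      AlgHom.id ℂ (MvPolynomial (Fin 2) ℂ) := by
    ext i
    fin_cases i <;> simp [subQ]
  have := AlgHom.congr_fun h1 p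
  rw [AlgHom.comp_apply, h, map_zero] at this
  exact this.symm

theorem qK_one (p : MvPolynomial (Fin 2) ℂ) :
    qK p 1 = ev2 (aeval subQ p) := by
  have h1 : ev2.comp (aeval subQ) =
      aeval ![xOuter + xInnerC 1, xInner] := by
    ext i
    fin_cases i <;> simp [subQ, ev2, xInner, xInnerC]
  exact (AlgHom.congr_fun h1 p).symm

theorem Sb_lexBdd {G : ℤ × ℤ → V} (h : QL G) : LexBdd (Sb G) := by
  obtain ⟨K, h⟩ := h
  obtain ⟨N, hN⟩ := id h
  refine ⟨⟨-K, fun J q hJ => ?_⟩, fun J => ⟨N + N - (J + K), fun q hq => ?_⟩⟩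
  · rw [Sb_eq h]; exact Sop_of_neg _ (by simp; omega) _
  · rw [Sb_eq h]; exact Sop_trunc hN (by simp; omega)

theorem fullYE_one {a b : EW V} {w : V} (hq : QL (Fu a b w)) {p : MvPolynomial (Fin 2) ℂ}
    (hp : p ≠ 0) (hL : IsLaurent2 (mulPoly p (Fab a b w))) (J T : ℤ) :
    fullYE 1 p a b w J T = Sb (Fu a b w) (J, T) := by
  have hL' : Laur2 (act V e2 p (Fu a b w)) := by
    obtain ⟨N, hN⟩ := hL
    refine ⟨N, fun k hk => ?_⟩
    have := hN k.1 k.2 hk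
    rwa [mulPoly_eq] at this
  have h1 : Sop (act V e2 p (Fu a b w)) = act V e2 (aeval subQ p) (Sb (Fu a b w)) := by
    rw [← Sb_of_laur2 hL', Sb_act _ hq]
  have h2 : ∀ J T : ℤ, (if 0 ≤ J then substYE 1 p a b w J.toNat T else 0) =
      Sop (act V e2 p (Fu a b w)) (J, T) := by
    intro J T
    split_ifs with hJ
    · refine finsum_congr fun m => ?_
      rw [mulPoly_eq, ch, if_neg (by omega)]
      have : ((J.toNat : ℕ) : ℤ) = J := by omega
      simp only [this, one_zpow, mul_one]
      rfl
    · exact (Sop_of_neg _ (by omega) _).symm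
  have h3 : fullYE 1 p a b w J T = conv (qInv p 1) (act V e2 (aeval subQ p) (Sb (Fu a b w)))
      (J, T) := by
    refine finsum_congr fun s => ?_
    rw [h2, h1]
    rfl
  rw [h3, conv_act _ _ (Sb_lexBdd hq), ← qK_one, qInv, K2_inv_mul, conv_one]
  rw [qK_one]
  exact ev2_ne_zero (aeval_subQ_ne_zero hp)

theorem dl_ne_zero : dl ≠ 0 := by
  intro h
  have := congrArg (aeval (![1, 0] : Fin 2 → ℂ)) h
  simp [dl] at this

theorem Fu_add (a b : EW V) (v w : V) : Fu a b (v + w) = Fu a b v + Fu a b w := by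
  funext k; simp [Fu, Fab, mf_add]

theorem Fu_smul (a b : EW V) (c : ℂ) (w : V) : Fu a b (c • w) = c • Fu a b w := by
  funext k; simp [Fu, Fab, mf_smul]

theorem YE_eq {a b : EW V} {K : ℕ} (h : ∀ w, QLK K (Fu a b w)) (n : ℤ) (w : V) (m : ℤ) :
    mf (YE a b n) w m = Sb (Fu a b w) (-n - 1, -m - 1) := by
  have hqc : QCPair a b := by
    refine ⟨dl ^ K, pow_ne_zero _ dl_ne_zero, fun w => ?_⟩
    obtain ⟨N, hN⟩ := h w
    exact ⟨N, fun m t hk => by rw [mulPoly_eq]; exact hN (m, t) hk⟩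
  have hraw : ∀ w m, rawYE 1 a b n w m = Sb (Fu a b w) (-n - 1, -m - 1) := by
    intro w m
    rw [rawYE, dif_pos hqc]
    exact fullYE_one ⟨K, h w⟩ hqc.choose_spec.1 (hqc.choose_spec.2 w) _ _
  have hex : ∃ c : EW V, ∀ w m, mf c w m = rawYE ((1 : ℂˣ) : ℂ) a b n w m := by
    simp only [Units.val_one, hraw]
    refine ⟨⟨{ toFun := fun w m => Sb (Fu a b w) (-n - 1, -m - 1)
               map_add' := fun v w => ?_
               map_smul' := fun c w => ?_ }, fun w => ?_⟩, fun w m => rfl⟩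
    · funext m
      rw [Fu_add, Sb_add ⟨K, h v⟩ ⟨K, h w⟩]; rfl
    · funext m
      rw [Fu_smul, Sb_smul c ⟨K, h w⟩]; rfl
    · obtain ⟨T, hT⟩ := (Sb_lexBdd ⟨K, h w⟩).2 (-n - 1)
      exact ⟨-T, fun m hm => hT _ (by omega)⟩
  rw [YE, YEa, dif_pos hex, hex.choose_spec w m]
  exact hraw w m

end Formula

section Creation

variable {V : Type*} [AddCommGroup V] [Module ℂ V]

open MvPolynomial (X C aeval)

/-- The operator `∂/∂x₁ + ∂/∂x₂` on families. -/
def pd2 (G : ℤ × ℤ → V) : ℤ × ℤ → V :=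
  fun k => ((k.1 : ℂ) + 1) • G (k.1 + 1, k.2) + ((k.2 : ℂ) + 1) • G (k.1, k.2 + 1)

theorem pd2_dl (G : ℤ × ℤ → V) : pd2 (act V e2 dl G) = act V e2 dl (pd2 G) := by
  funext ⟨m, t⟩
  simp only [act_sub, pd2, Pi.sub_apply, act2_X0, act2_X1, add_sub_cancel_right, sub_add_cancel,
    Int.cast_sub, Int.cast_one]
  module

theorem pd2_dl_pow (n : ℕ) (G : ℤ × ℤ → V) : pd2 (act V e2 (dl ^ n) G) =
    act V e2 (dl ^ n) (pd2 G) := by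
  induction n generalizing G with
  | zero => simp only [pow_zero, act_one]
  | succ n ih => rw [pow_succ, act_mul, ih, pd2_dl, act_mul]

theorem Laur2.shift {G : ℤ × ℤ → V} (h : Laur2 G) (i : ℤ × ℤ) : Laur2 fun k => G (k + i) := by
  obtain ⟨N, hN⟩ := h
  refine ⟨N - |i.1| - |i.2|, fun k hk => hN _ ?_⟩
  have := neg_abs_le i.1
  have := neg_abs_le i.2
  have := le_abs_self i.1
  have := le_abs_self i.2
  simp only [Prod.fst_add, Prod.snd_add]
  omega

theorem Sop_pd2 {G : ℤ × ℤ → V} (h : Laur2 G) (J q : ℤ) :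
    Sop (pd2 G) (J, q) = ((q : ℂ) + 1) • Sop G (J, q + 1) := by
  have h1 : Sop (pd2 G) (J, q) = (∑ᶠ m : ℤ, (ch (m - 1) J * m) • G (m, q - m + 1 + J)) +
      ∑ᶠ m : ℤ, (ch m J * (q - m + J + 1)) • G (m, q - m + 1 + J) := by
    have hs : (∑ᶠ m : ℤ, (ch (m - 1) J * m) • G (m, q - m + 1 + J)) =
        ∑ᶠ m : ℤ, (ch m J * (m + 1)) • G (m + 1, q - m + J) := by
      refine (finsum_eq_of_bijective (fun m : ℤ => m + 1)
        (Equiv.addRight (1 : ℤ)).bijective fun m => ?_).symm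
      have e1 : m + 1 - 1 = m := by ring
      have e2 : q - (m + 1) + 1 + J = q - m + J := by ring
      rw [e1, e2]
      push_cast
      rfl
    rw [hs, ← finsum_add_distrib]
    · refine finsum_congr fun m => ?_
      simp only [pd2, smul_add, smul_smul]
      push_cast
      rw [show q - m + J + 1 = q - m + 1 + J by ring]
    · exact (Sop_finite (h.shift (1, 0)) (J, q) fun m => ch m J * (m + 1)).subset
        (by intro m hm; simpa using hm)
    · exact (Sop_finite h (J, q + 1) fun m => ch m J * (q - m + J + 1)).subset
        (by intro m hm; simpa [sub_add_eq_add_sub] using hm)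
  rw [h1, ← finsum_add_distrib, Sop, smul_finsum]
  · refine finsum_congr fun m => ?_
    rw [mul_comm (ch (m - 1) J), ch_absorb, ← add_smul, smul_smul,
      show q + 1 - m + J = q - m + 1 + J by ring]
    congr 1
    ring
  · exact (Sop_finite h (J, q + 1) fun m => ch (m - 1) J * m).subset
      (by intro m hm; simpa [sub_add_eq_add_sub] using hm)
  · exact (Sop_finite h (J, q + 1) fun m => ch m J * (q - m + J + 1)).subset
      (by intro m hm; simpa [sub_add_eq_add_sub] using hm)

theorem Laur2.pd2 {G : ℤ × ℤ → V} (h : Laur2 G) : Laur2 (pd2 G) := by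
  obtain ⟨N, hN⟩ := h
  refine ⟨N - 1, fun k hk => ?_⟩
  rw [NVA.pd2]
  rcases hk with hk | hk
  · rw [hN _ (by simp only; omega), hN _ (by simp only; omega)]; simp
  · rw [hN _ (by simp only; omega), hN _ (by simp only; omega)]; simp

theorem QLK.pd2 {K : ℕ} {G : ℤ × ℤ → V} (h : QLK K G) : QLK K (pd2 G) := by
  rw [QLK, ← pd2_dl_pow]; exact Laur2.pd2 h

theorem Sb_pd2 {G : ℤ × ℤ → V} (h : QL G) (J q : ℤ) :
    Sb (pd2 G) (J, q) = ((q : ℂ) + 1) • Sb G (J, q + 1) := by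
  obtain ⟨K, h⟩ := h
  rw [Sb_eq h.pd2, Sb_eq h, ← pd2_dl_pow, Sop_pd2 h]

theorem Laur2.map {V' : Type*} [AddCommGroup V'] [Module ℂ V'] (L : V →ₗ[ℂ] V') {G : ℤ × ℤ → V}
    (h : Laur2 G) : Laur2 fun k => L (G k) := by
  obtain ⟨N, hN⟩ := h
  exact ⟨N, fun k hk => by simp [hN k hk]⟩

theorem Sop_map {V' : Type*} [AddCommGroup V'] [Module ℂ V'] (L : V →ₗ[ℂ] V') {G : ℤ × ℤ → V}
    (h : Laur2 G) (k : ℤ × ℤ) : Sop (fun k => L (G k)) k = L (Sop G k) := by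
  rw [Sop, Sop, ← LinearMap.toAddMonoidHom_coe,
    AddMonoidHom.map_finsum _ (Sop_finite h k fun m => ch m k.1)]
  refine finsum_congr fun m => ?_
  simp

theorem QLK.map {V' : Type*} [AddCommGroup V'] [Module ℂ V'] (L : V →ₗ[ℂ] V') {K : ℕ}
    {G : ℤ × ℤ → V} (h : QLK K G) : QLK K fun k => L (G k) := by
  rw [QLK, act_map]; exact Laur2.map L h

theorem Sb_map {V' : Type*} [AddCommGroup V'] [Module ℂ V'] (L : V →ₗ[ℂ] V') {G : ℤ × ℤ → V}
    (h : QL G) (k : ℤ × ℤ) : Sb (fun k => L (G k)) k = L (Sb G k) := by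
  obtain ⟨K, h⟩ := h
  rw [Sb_eq h, Sb_eq (h.map L), act_map, Sop_map L h]

theorem Fu_bracket {L : V →ₗ[ℂ] V} {a b : EW V} (ha : Dbr L a) (hb : Dbr L b) (w : V) :
    (fun k => L (Fu a b w k)) = Fu a b (L w) + pd2 (Fu a b w) := by
  funext k
  have h1 := ha (mf b w (-k.2 - 1)) (-k.1 - 1)
  have h2 := hb w (-k.2 - 1)
  rw [sub_eq_iff_eq_add] at h1 h2
  simp only [Fu, Fab, Pi.add_apply, pd2]
  rw [h1, h2, mf_add, mf_smul, show -(k.1 + 1) - 1 = -k.1 - 1 - 1 by ring,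
    show -(k.2 + 1) - 1 = -k.2 - 1 - 1 by ring]
  push_cast
  module

theorem Dbr_YE {L : V →ₗ[ℂ] V} {a b : EW V} (ha : Dbr L a) (hb : Dbr L b) {K : ℕ}
    (h : ∀ w, QLK K (Fu a b w)) (n : ℤ) : Dbr L (YE a b n) := by
  intro w m
  rw [YE_eq h, YE_eq h, YE_eq h, ← Sb_map L ⟨K, h w⟩, Fu_bracket ha hb,
    Sb_add ⟨K, h _⟩ ⟨K, (h w).pd2⟩, Pi.add_apply, add_sub_cancel_left, Sb_pd2 ⟨K, h w⟩,
    show -(m - 1) - 1 = -m - 1 + 1 by ring]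
  congr 1
  push_cast
  ring

theorem dl_pow_zero_right {F : ℤ × ℤ → V} (hF : ∀ m t : ℤ, t < 0 → F (m, t) = 0) (n : ℕ) :
    (∀ m t : ℤ, t < 0 → act V e2 (dl ^ n) F (m, t) = 0) ∧
      ∀ m : ℤ, act V e2 (dl ^ n) F (m, 0) = F (m - n, 0) := by
  induction n with
  | zero => simp only [pow_zero, act_one]; exact ⟨hF, by simp⟩
  | succ n ih =>
    obtain ⟨h1, h2⟩ := ih
    have h3 : ∀ m t : ℤ, act V e2 (dl ^ (n + 1)) F (m, t) =
        act V e2 (dl ^ n) F (m - 1, t) - act V e2 (dl ^ n) F (m, t - 1) := by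
      intro m t
      rw [pow_succ', act_mul, act_sub, Pi.sub_apply, act2_X0, act2_X1]
    refine ⟨fun m t ht => ?_, fun m => ?_⟩
    · rw [h3, h1 _ _ ht, h1 _ _ (by omega), sub_zero]
    · rw [h3, h2, h1 _ _ (by omega), sub_zero]
      congr 2
      push_cast
      ring

/-- The creation property of `a(x)ₙ b(x)`. -/
theorem YE_creation {L : V →ₗ[ℂ] V} {one : V} (hL : L one = 0) {a b : EW V} (ha : Dbr L a)
    (hb : Dbr L b) {K : ℕ} (h : ∀ w, QLK K (Fu a b w))
    (hb0 : ∀ n : ℤ, 0 ≤ n → mf b one n = 0) (n : ℤ) :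
    (∀ q : ℤ, 0 ≤ q → mf (YE a b n) one q = 0) ∧
      mf (YE a b n) one (-1) = mf a (mf b one (-1)) n := by
  obtain ⟨N, hN⟩ := mf_trunc a (mf b one (-1))
  set M := max K N.toNat
  have hM : QLK M (Fu a b one) := (h one).mono (le_max_left _ _)
  have hNM : N ≤ M := by have : N.toNat ≤ M := le_max_right _ _; omega
  have hF : ∀ m t : ℤ, t < 0 → Fu a b one (m, t) = 0 := by
    intro m t ht
    simp only [Fu, Fab]
    rw [hb0 _ (by omega), mf_zero]
  have hF0 : ∀ m : ℤ, Fu a b one (m, 0) = mf a (mf b one (-1)) (-m - 1) := fun m => rfl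
  obtain ⟨hB, hB0⟩ := dl_pow_zero_right hF M
  set B := act V e2 (dl ^ M) (Fu a b one)
  have hLB : (fun k => L (B k)) = pd2 B := by
    have h0 : Fu a b (0 : V) = 0 := by funext k; simp [Fu, Fab, mf_zero]
    rw [← act_map, Fu_bracket ha hb, hL, h0, zero_add, pd2_dl_pow]
  have hneg : ∀ (t : ℕ) (m : ℤ), m < 0 → B (m, (t : ℤ)) = 0 := by
    intro t
    induction t with
    | zero =>
      intro m hm
      rw [Nat.cast_zero, hB0, hF0]
      exact hN _ (by omega)
    | succ t ih =>
      intro m hm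
      have h1 := congrFun hLB (m, (t : ℤ))
      simp only [pd2] at h1
      rw [ih m hm, map_zero] at h1
      have h2 : ((m : ℂ) + 1) • B (m + 1, (t : ℤ)) = 0 := by
        rcases eq_or_ne m (-1) with rfl | hm'
        · simp
        · rw [ih _ (by omega), smul_zero]
      rw [h2, zero_add] at h1
      have h3 : ((t : ℤ) : ℂ) + 1 ≠ 0 := by
        exact_mod_cast (Nat.succ_ne_zero t)
      push_cast
      exact (smul_eq_zero.mp h1.symm).resolve_left h3
  have hneg' : ∀ m t : ℤ, m < 0 → B (m, t) = 0 := by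
    intro m t hm
    rcases lt_or_ge t 0 with ht | ht
    · exact hB m t ht
    · have := hneg t.toNat m hm
      rwa [show ((t.toNat : ℕ) : ℤ) = t by omega] at this
  have hS : ∀ J m q : ℤ, (q < 0 ∨ q = 0 ∧ m ≠ J) → ch m J • B (m, q - m + J) = 0 := by
    intro J m q hq
    by_cases h1 : m < 0
    · rw [hneg' _ _ h1, smul_zero]
    by_cases h2 : m < J
    · rw [ch_of_lt (by omega) h2, zero_smul]
    · rw [hB _ _ (by omega), smul_zero]
  refine ⟨fun q hq => ?_, ?_⟩
  · rw [YE_eq h, Sb_eq hM]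
    exact finsum_eq_zero_of_forall_eq_zero fun m => hS _ m _ (Or.inl (by omega))
  · rw [YE_eq h, Sb_eq hM]
    set J : ℤ := -n - 1 + M with hJ
    have h1 : Sop B (J, - -1 - 1) = ch J J • B (J, - -1 - 1 - J + J) :=
      finsum_eq_single _ J fun m hm => hS _ m _ (Or.inr ⟨by norm_num, hm⟩)
    rw [h1, show (- -1 - 1 - J + J : ℤ) = 0 by ring]
    have h2 : B (J, 0) = mf a (mf b one (-1)) n := by
      rw [hB0, hF0]
      congr 1
      omega
    rcases lt_or_ge J 0 with h3 | h3
    · rw [← h2, hneg' _ _ h3, smul_zero]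
    · rw [h2]
      have := ch_symm h3 J
      rw [sub_self, ch_zero] at this
      rw [← this, one_smul]

theorem mf_oneE (w : V) (n : ℤ) : mf (oneE : EW V) w n = if n = -1 then w else 0 := rfl

theorem Fu_oneE_right (b : EW V) (w : V) : QLK 0 (Fu b oneE w) := by
  rw [QLK, pow_zero, act_one]
  obtain ⟨N, hN⟩ := mf_trunc b w
  refine ⟨min 0 (-N), fun k hk => ?_⟩
  simp only [Fu, Fab, mf_oneE]
  split_ifs with h
  · exact hN _ (by omega)
  · exact mf_zero _ _

theorem Fu_oneE_left (b : EW V) (w : V) : QLK 0 (Fu oneE b w) := by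
  rw [QLK, pow_zero, act_one]
  obtain ⟨N, hN⟩ := mf_trunc b w
  refine ⟨min 0 (-N), fun k hk => ?_⟩
  simp only [Fu, Fab, mf_oneE]
  split_ifs with h
  · exact hN _ (by omega)
  · rfl

theorem YE_oneE_right (b : EW V) : YE b oneE (-1) = b := by
  refine EW_ext fun w n => ?_
  rw [YE_eq (Fu_oneE_right b), Sb_eq (Fu_oneE_right b w), pow_zero, act_one, Sop,
    finsum_eq_single _ (-n - 1)]
  · simp [ch_zero, Fu, Fab, mf_oneE]
  · intro m hm
    have : Fu b oneE w (m, -n - 1 - m + (- -1 - 1 + ((0 : ℕ) : ℤ))) = 0 := by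
      simp only [Fu, Fab, mf_oneE]
      rw [if_neg (by push_cast; omega), mf_zero]
    rw [this, smul_zero]

theorem YE_oneE_left (b : EW V) (n : ℤ) : YE oneE b n = if n = -1 then b else 0 := by
  refine EW_ext fun w m => ?_
  rw [YE_eq (Fu_oneE_left b), Sb_eq (Fu_oneE_left b w), pow_zero, act_one, Sop,
    finsum_eq_single _ 0]
  · simp only [Fu, Fab, mf_oneE]
    rw [if_pos (by norm_num)]
    split_ifs with h
    · subst h
      rw [show (- -1 - 1 + ((0 : ℕ) : ℤ) : ℤ) = 0 by norm_num, ch_zero, one_smul]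
      congr 1; ring
    · rw [zero_mf]
      rcases lt_or_ge (-n - 1 + ((0 : ℕ) : ℤ)) 0 with h0 | h0
      · rw [ch_neg h0, zero_smul]
      · rw [ch_of_lt le_rfl (by push_cast at *; omega), zero_smul]
  · intro l hl
    have : Fu oneE b w (l, -m - 1 - l + (-n - 1 + ((0 : ℕ) : ℤ))) = 0 := by
      simp only [Fu, Fab, mf_oneE]
      rw [if_neg (by omega)]
    rw [this, smul_zero]

end Creation

/-! ### Substitutions in three-variable families -/

section Three

variable {V : Type*} [AddCommGroup V] [Module ℂ V]

open MvPolynomial (X C aeval)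

theorem ch_mul_ch (m n i j : ℤ) (s : Finset ℤ) (hs : ∀ p, 0 ≤ p → p ≤ i + j → p ∈ s) :
    ch (n + m - i) j * ch m i = ∑ p ∈ s, ch p (p - i) * ch m p * ch n (j - (p - i)) := by
  have h0 : ∀ p : ℤ, (p < 0 ∨ p < i ∨ i + j < p) →
      ch p (p - i) * ch m p * ch n (j - (p - i)) = 0 := by
    intro p hp
    rcases lt_or_ge p 0 with h | h
    · rw [ch_neg h]; simp
    rcases lt_or_ge p i with h' | h'
    · rw [ch_neg (show p - i < 0 by omega)]; simp
    · rw [ch_neg (show j - (p - i) < 0 by omega)]; simp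
  rcases lt_or_ge i 0 with hi | hi
  · rw [ch_neg hi, mul_zero, Finset.sum_eq_zero]
    intro p _
    rcases lt_or_ge p 0 with h | h
    · exact h0 p (Or.inl h)
    · rw [ch_of_lt h (by omega)]; simp
  rcases lt_or_ge j 0 with hj | hj
  · rw [ch_neg hj, zero_mul, Finset.sum_eq_zero]
    intro p _
    exact h0 p (by omega)
  lift i to ℕ using hi
  lift j to ℕ using hj
  rw [← Finset.sum_subset (s₁ :=
    (Finset.HasAntidiagonal.antidiagonal j).image fun q : ℕ × ℕ => (i : ℤ) + q.1)]
  · rw [Finset.sum_image (by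
      intro x hx y hy hxy
      simp only [Finset.mem_coe, Finset.HasAntidiagonal.mem_antidiagonal] at hx hy
      simp only at hxy
      ext <;> omega)]
    rw [show n + m - (i : ℤ) = (m - i) + n by ring, ch_natCast, ch_natCast,
      Ring.add_choose_eq j (Commute.all _ _), Int.cast_sum, Finset.sum_mul]
    refine Finset.sum_congr rfl fun q hq => ?_
    simp only [Finset.HasAntidiagonal.mem_antidiagonal] at hq
    rw [show (i : ℤ) + q.1 = ((i + q.1 : ℕ) : ℤ) by push_cast; rfl,
      ch_symm (by omega), ch_nat_nat, ch_natCast,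
      show (j : ℤ) - (((i + q.1 : ℕ) : ℤ) - i) = (q.2 : ℕ) by omega, ch_natCast]
    have h := Ring.choose_smul_choose m (Nat.le_add_right i q.1)
    rw [Nat.add_sub_cancel_left, nsmul_eq_mul] at h
    have h' : (((i + q.1).choose i : ℕ) : ℂ) * ((Ring.choose m (i + q.1) : ℤ) : ℂ) =
        ((Ring.choose m i : ℤ) : ℂ) * ((Ring.choose (m - i) q.1 : ℤ) : ℂ) := by
      exact_mod_cast h
    rw [h']; push_cast; ring
  · intro p hp
    simp only [Finset.mem_image, Finset.HasAntidiagonal.mem_antidiagonal] at hp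
    obtain ⟨q, hq, rfl⟩ := hp
    exact hs _ (by omega) (by omega)
  · intro p _ hp
    apply h0
    by_contra hc
    apply hp
    simp only [Finset.mem_image, Finset.HasAntidiagonal.mem_antidiagonal]
    exact ⟨((p - i).toNat, (i + j - p).toNat), by simp only; omega, by simp only; omega⟩

/-- An operator on a class of two-variable families which intertwines the action of
polynomials through the substitution `x₁ ↦ x₁ + x₂`. -/
structure Subs (Cl : (ℤ × ℤ → V) → Prop) (Op : (ℤ × ℤ → V) → (ℤ × ℤ → V)) : Prop where
  add_mem : ∀ F G, Cl F → Cl G → Cl (F + G)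
  smul_mem : ∀ (c : ℂ) F, Cl F → Cl (c • F)
  X_mem : ∀ j F, Cl F → Cl (act V e2 (X j) F)
  add : ∀ F G, Cl F → Cl G → Op (F + G) = Op F + Op G
  smul : ∀ (c : ℂ) F, Cl F → Op (c • F) = c • Op F
  X : ∀ j F, Cl F → Op (act V e2 (X j) F) = act V e2 (subQ j) (Op F)

theorem QL.act (P : MvPolynomial (Fin 2) ℂ) {F : ℤ × ℤ → V} (h : QL F) : QL (act V e2 P F) :=
  h.elim fun K hK => ⟨K, hK.act P⟩

theorem subs_Sb : Subs (V := V) QL Sb where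
  add_mem _ _ hF hG := by
    obtain ⟨K, h1, h2⟩ := hF.common hG
    exact ⟨K, h1.add h2⟩
  smul_mem c _ hF := hF.elim fun K hK => ⟨K, hK.smul c⟩
  X_mem _ _ hF := hF.act _
  add _ _ hF hG := Sb_add hF hG
  smul c _ hF := Sb_smul c hF
  X j _ hF := by rw [Sb_act _ hF, MvPolynomial.aeval_X]

theorem subs_Eop : Subs (V := V) TrU Eop where
  add_mem _ _ hF hG := hF.add hG
  smul_mem c _ hF := hF.smul c
  X_mem _ _ hF := hF.act _
  add _ _ hF hG := Eop_add hF hG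
  smul c _ hF := Eop_smul c hF
  X j _ hF := Eop_X hF j

/-- The slice of a three-variable family with the third index fixed. -/
def slC (G : ℤ × ℤ × ℤ → V) (l : ℤ) : ℤ × ℤ → V := fun k => G (k.1, k.2, l)

/-- The slice of a three-variable family with the first index fixed. -/
def slA (G : ℤ × ℤ × ℤ → V) (l : ℤ) : ℤ × ℤ → V := fun k => G (l, k.1, k.2)

/-- The slice of a three-variable family with the second index fixed. -/
def slB (G : ℤ × ℤ × ℤ → V) (l : ℤ) : ℤ × ℤ → V := fun k => G (k.1, l, k.2)

/-- An operator applied to the first two variables. -/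
def opC (Op : (ℤ × ℤ → V) → (ℤ × ℤ → V)) (G : ℤ × ℤ × ℤ → V) : ℤ × ℤ × ℤ → V :=
  fun k => Op (slC G k.2.2) (k.1, k.2.1)

/-- An operator applied to the last two variables. -/
def opA (Op : (ℤ × ℤ → V) → (ℤ × ℤ → V)) (G : ℤ × ℤ × ℤ → V) : ℤ × ℤ × ℤ → V :=
  fun k => Op (slA G k.1) k.2

/-- An operator applied to the first and the last variable. -/
def opB (Op : (ℤ × ℤ → V) → (ℤ × ℤ → V)) (G : ℤ × ℤ × ℤ → V) : ℤ × ℤ × ℤ → V :=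
  fun k => Op (slB G k.2.1) (k.1, k.2.2)

abbrev subC : Fin 3 → MvPolynomial (Fin 3) ℂ := ![X 0 + X 1, X 1, X 2]
abbrev subA : Fin 3 → MvPolynomial (Fin 3) ℂ := ![X 0, X 1 + X 2, X 2]
abbrev subB : Fin 3 → MvPolynomial (Fin 3) ℂ := ![X 0 + X 2, X 1, X 2]

theorem slC_X0 (G : ℤ × ℤ × ℤ → V) (l : ℤ) :
    slC (act V e3 (X 0) G) l = act V e2 (X 0) (slC G l) := by
  funext ⟨a, b⟩; simp only [slC, act2_X0, act3_X0]
theorem slC_X1 (G : ℤ × ℤ × ℤ → V) (l : ℤ) :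
    slC (act V e3 (X 1) G) l = act V e2 (X 1) (slC G l) := by
  funext ⟨a, b⟩; simp only [slC, act2_X1, act3_X1]
theorem slC_X2 (G : ℤ × ℤ × ℤ → V) (l : ℤ) :
    slC (act V e3 (X 2) G) l = slC G (l - 1) := by
  funext ⟨a, b⟩; simp only [slC, act3_X2]
theorem slA_X0 (G : ℤ × ℤ × ℤ → V) (l : ℤ) :
    slA (act V e3 (X 0) G) l = slA G (l - 1) := by
  funext ⟨a, b⟩; simp only [slA, act3_X0]
theorem slA_X1 (G : ℤ × ℤ × ℤ → V) (l : ℤ) :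
    slA (act V e3 (X 1) G) l = act V e2 (X 0) (slA G l) := by
  funext ⟨a, b⟩; simp only [slA, act2_X0, act3_X1]
theorem slA_X2 (G : ℤ × ℤ × ℤ → V) (l : ℤ) :
    slA (act V e3 (X 2) G) l = act V e2 (X 1) (slA G l) := by
  funext ⟨a, b⟩; simp only [slA, act2_X1, act3_X2]
theorem slB_X0 (G : ℤ × ℤ × ℤ → V) (l : ℤ) :
    slB (act V e3 (X 0) G) l = act V e2 (X 0) (slB G l) := by
  funext ⟨a, b⟩; simp only [slB, act2_X0, act3_X0]
theorem slB_X1 (G : ℤ × ℤ × ℤ → V) (l : ℤ) :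
    slB (act V e3 (X 1) G) l = slB G (l - 1) := by
  funext ⟨a, b⟩; simp only [slB, act3_X1]
theorem slB_X2 (G : ℤ × ℤ × ℤ → V) (l : ℤ) :
    slB (act V e3 (X 2) G) l = act V e2 (X 1) (slB G l) := by
  funext ⟨a, b⟩; simp only [slB, act2_X1, act3_X2]

theorem opC_act {Cl : (ℤ × ℤ → V) → Prop} {Op : (ℤ × ℤ → V) → (ℤ × ℤ → V)} (h : Subs Cl Op)
    (P : MvPolynomial (Fin 3) ℂ) {F : ℤ × ℤ × ℤ → V} (hF : ∀ l, Cl (slC F l)) :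
    (∀ l, Cl (slC (act V e3 P F) l)) ∧
      opC Op (act V e3 P F) = act V e3 (aeval subC P) (opC Op F) := by
  refine act_intertwine (fun F => ∀ l, Cl (slC F l)) (opC Op) subC
    (fun F G hF hG l => h.add_mem _ _ (hF l) (hG l)) (fun c F hF l => h.smul_mem c _ (hF l))
    ?_ ?_ ?_ ?_ P F hF
  · intro j F hF l
    fin_cases j
    · change Cl (slC (act V e3 (X 0) F) l); rw [slC_X0]; exact h.X_mem _ _ (hF l)
    · change Cl (slC (act V e3 (X 1) F) l); rw [slC_X1]; exact h.X_mem _ _ (hF l)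
    · change Cl (slC (act V e3 (X 2) F) l); rw [slC_X2]; exact hF _
  · intro F G hF hG
    funext k
    exact congrFun (h.add _ _ (hF k.2.2) (hG k.2.2)) _
  · intro c F hF
    funext k
    exact congrFun (h.smul c _ (hF k.2.2)) _
  · intro j F hF
    funext ⟨x, y, z⟩
    fin_cases j
    · change Op (slC (act V e3 (X 0) F) z) (x, y) = act V e3 (X 0 + X 1) (opC Op F) (x, y, z)
      rw [slC_X0, h.X 0 _ (hF z)]
      change act V e2 (X 0 + X 1) _ _ = _
      rw [act_add, act_add, Pi.add_apply, Pi.add_apply, act2_X0, act2_X1, act3_X0, act3_X1]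
      rfl
    · change Op (slC (act V e3 (X 1) F) z) (x, y) = act V e3 (X 1) (opC Op F) (x, y, z)
      rw [slC_X1, h.X 1 _ (hF z)]
      change act V e2 (X 1) _ _ = _
      rw [act2_X1, act3_X1]
      rfl
    · change Op (slC (act V e3 (X 2) F) z) (x, y) = act V e3 (X 2) (opC Op F) (x, y, z)
      rw [slC_X2, act3_X2]
      rfl

theorem opA_act {Cl : (ℤ × ℤ → V) → Prop} {Op : (ℤ × ℤ → V) → (ℤ × ℤ → V)} (h : Subs Cl Op)
    (P : MvPolynomial (Fin 3) ℂ) {F : ℤ × ℤ × ℤ → V} (hF : ∀ l, Cl (slA F l)) :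
    (∀ l, Cl (slA (act V e3 P F) l)) ∧
      opA Op (act V e3 P F) = act V e3 (aeval subA P) (opA Op F) := by
  refine act_intertwine (fun F => ∀ l, Cl (slA F l)) (opA Op) subA
    (fun F G hF hG l => h.add_mem _ _ (hF l) (hG l)) (fun c F hF l => h.smul_mem c _ (hF l))
    ?_ ?_ ?_ ?_ P F hF
  · intro j F hF l
    fin_cases j
    · change Cl (slA (act V e3 (X 0) F) l); rw [slA_X0]; exact hF _
    · change Cl (slA (act V e3 (X 1) F) l); rw [slA_X1]; exact h.X_mem _ _ (hF l)
    · change Cl (slA (act V e3 (X 2) F) l); rw [slA_X2]; exact h.X_mem _ _ (hF l)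
  · intro F G hF hG
    funext k
    exact congrFun (h.add _ _ (hF k.1) (hG k.1)) _
  · intro c F hF
    funext k
    exact congrFun (h.smul c _ (hF k.1)) _
  · intro j F hF
    funext ⟨x, y, z⟩
    fin_cases j
    · change Op (slA (act V e3 (X 0) F) x) (y, z) = act V e3 (X 0) (opA Op F) (x, y, z)
      rw [slA_X0, act3_X0]
      rfl
    · change Op (slA (act V e3 (X 1) F) x) (y, z) = act V e3 (X 1 + X 2) (opA Op F) (x, y, z)
      rw [slA_X1, h.X 0 _ (hF x)]
      change act V e2 (X 0 + X 1) _ _ = _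
      rw [act_add, act_add, Pi.add_apply, Pi.add_apply, act2_X0, act2_X1, act3_X1, act3_X2]
      rfl
    · change Op (slA (act V e3 (X 2) F) x) (y, z) = act V e3 (X 2) (opA Op F) (x, y, z)
      rw [slA_X2, h.X 1 _ (hF x)]
      change act V e2 (X 1) _ _ = _
      rw [act2_X1, act3_X2]
      rfl

theorem opB_act {Cl : (ℤ × ℤ → V) → Prop} {Op : (ℤ × ℤ → V) → (ℤ × ℤ → V)} (h : Subs Cl Op)
    (P : MvPolynomial (Fin 3) ℂ) {F : ℤ × ℤ × ℤ → V} (hF : ∀ l, Cl (slB F l)) :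
    (∀ l, Cl (slB (act V e3 P F) l)) ∧
      opB Op (act V e3 P F) = act V e3 (aeval subB P) (opB Op F) := by
  refine act_intertwine (fun F => ∀ l, Cl (slB F l)) (opB Op) subB
    (fun F G hF hG l => h.add_mem _ _ (hF l) (hG l)) (fun c F hF l => h.smul_mem c _ (hF l))
    ?_ ?_ ?_ ?_ P F hF
  · intro j F hF l
    fin_cases j
    · change Cl (slB (act V e3 (X 0) F) l); rw [slB_X0]; exact h.X_mem _ _ (hF l)
    · change Cl (slB (act V e3 (X 1) F) l); rw [slB_X1]; exact hF _
    · change Cl (slB (act V e3 (X 2) F) l); rw [slB_X2]; exact h.X_mem _ _ (hF l)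
  · intro F G hF hG
    funext k
    exact congrFun (h.add _ _ (hF k.2.1) (hG k.2.1)) _
  · intro c F hF
    funext k
    exact congrFun (h.smul c _ (hF k.2.1)) _
  · intro j F hF
    funext ⟨x, y, z⟩
    fin_cases j
    · change Op (slB (act V e3 (X 0) F) y) (x, z) = act V e3 (X 0 + X 2) (opB Op F) (x, y, z)
      rw [slB_X0, h.X 0 _ (hF y)]
      change act V e2 (X 0 + X 1) _ _ = _
      rw [act_add, act_add, Pi.add_apply, Pi.add_apply, act2_X0, act2_X1, act3_X0, act3_X2]
      rfl
    · change Op (slB (act V e3 (X 1) F) y) (x, z) = act V e3 (X 1) (opB Op F) (x, y, z)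
      rw [slB_X1, act3_X1]
      rfl
    · change Op (slB (act V e3 (X 2) F) y) (x, z) = act V e3 (X 2) (opB Op F) (x, y, z)
      rw [slB_X2, h.X 1 _ (hF y)]
      change act V e2 (X 1) _ _ = _
      rw [act2_X1, act3_X2]
      rfl

/-- The two ways of substituting `x₁ = x₀ + y + x₃`, `x₂ = y + x₃` agree. -/
theorem opA_opC_Sop {Q : ℤ × ℤ × ℤ → V} (hQ : Laur3 Q) :
    opA Sop (opC Sop Q) = opC Eop (opB Sop (opA Sop Q)) := by
  obtain ⟨N, hN⟩ := hQ
  funext ⟨i, j, l⟩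
  have hz : ∀ m n p, (m < N ∨ n < N ∨ p < N) → Q (m, n, p) = 0 := fun m n p h => hN _ h
  simp only [opA, opC, opB, slA, slB, slC, Sop, Eop]
  obtain ⟨M, hM⟩ : ∃ M, M = l + i + j - 2 * N := ⟨_, rfl⟩
  set s := Finset.Icc N M with hs
  set f : ℤ → ℤ → V := fun m n => Q (m, n, l + i + j - m - n) with hf
  have hf0 : ∀ m n, (m ∉ s ∨ n ∉ s) → f m n = 0 := by
    intro m n h
    simp only [hs, Finset.mem_Icc, not_and_or, not_le] at h
    by_cases h' : m < N ∨ n < N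
    · exact hz _ _ _ (by omega)
    · exact hz _ _ _ (by omega)
  have hL : (∑ᶠ n : ℤ, ch n j • ∑ᶠ m : ℤ, ch m i • Q (m, n - m + i, l - n + j)) =
      ∑ m ∈ s, ∑ n ∈ s, (ch (n + m - i) j * ch m i) • f m n := by
    have e1 : ∀ n : ℤ, ch n j • (∑ᶠ m : ℤ, ch m i • Q (m, n - m + i, l - n + j)) =
        ∑ m ∈ s, (ch n j * ch m i) • f m (n - m + i) := by
      intro n
      rw [finsum_eq_sum_of_support_subset (s := s), Finset.smul_sum]
      · refine Finset.sum_congr rfl fun m _ => ?_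
        rw [smul_smul]
        simp only [hf]
        congr 3; ring_nf
      · intro m hm
        by_contra hc
        apply hm
        have := hf0 m (n - m + i) (Or.inl hc)
        simp only [hf] at this
        simp only
        rw [show l - n + j = l + i + j - m - (n - m + i) by ring, this, smul_zero]
    simp only [e1]
    rw [finsum_sum_comm]
    · refine Finset.sum_congr rfl fun m _ => ?_
      rw [← finsum_comp_equiv (Equiv.addRight (m - i)),
        finsum_eq_sum_of_support_subset (s := s)]
      · refine Finset.sum_congr rfl fun n _ => ?_
        simp only [Equiv.coe_addRight]
        congr 2 <;> ring_nf
      · intro n hn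
        by_contra hc
        apply hn
        simp only [Equiv.coe_addRight]
        rw [show n + (m - i) - m + i = n by ring, hf0 m n (Or.inr hc), smul_zero]
    · intro m _
      refine (Finset.finite_toSet (s.image fun n => n + m - i)).subset fun n hn => ?_
      by_contra hc
      apply hn
      simp only
      rw [hf0 m (n - m + i) (Or.inr _), smul_zero]
      intro h
      exact hc (by simpa using ⟨n - m + i, by simpa using h, by ring⟩)
  have hR : ∀ p : ℤ, ch p (p - i) • (∑ᶠ m : ℤ, ch m p •
      ∑ᶠ n : ℤ, ch n (j - (p - i)) • Q (m, n, l - m + p - n + (j - (p - i)))) =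
      ∑ m ∈ s, ∑ n ∈ s, (ch p (p - i) * ch m p * ch n (j - (p - i))) • f m n := by
    intro p
    have e2' : ∀ m : ℤ, (∑ᶠ n : ℤ, ch n (j - (p - i)) • Q (m, n, l - m + p - n + (j - (p - i)))) =
        ∑ n ∈ s, ch n (j - (p - i)) • f m n := by
      intro m
      have e3' : ∀ n, Q (m, n, l - m + p - n + (j - (p - i))) = f m n := by
        intro n; simp only [hf]; congr 3; ring
      simp only [e3']
      refine finsum_eq_sum_of_support_subset _ fun n hn => ?_
      by_contra hc
      exact hn (by simp only [hf0 m n (Or.inr hc), smul_zero])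
    simp only [e2']
    rw [finsum_eq_sum_of_support_subset (s := s), Finset.smul_sum]
    · refine Finset.sum_congr rfl fun m _ => ?_
      rw [Finset.smul_sum, Finset.smul_sum]
      refine Finset.sum_congr rfl fun n _ => ?_
      rw [smul_smul, smul_smul, mul_assoc]
    · intro m hm
      by_contra hc
      apply hm
      simp only
      rw [Finset.sum_eq_zero, smul_zero]
      intro n _
      rw [hf0 m n (Or.inl hc), smul_zero]
  rw [hL]
  simp only [hR]
  rw [finsum_eq_sum_of_support_subset (s := Finset.Icc 0 (i + j))]
  · symm
    rw [Finset.sum_comm]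
    refine Finset.sum_congr rfl fun m _ => ?_
    rw [Finset.sum_comm]
    refine Finset.sum_congr rfl fun n _ => ?_
    rw [← Finset.sum_smul, ← ch_mul_ch m n i j (Finset.Icc 0 (i + j))
      (fun p h1 h2 => Finset.mem_Icc.2 ⟨h1, h2⟩)]
  · intro p hp
    by_contra hc
    apply hp
    simp only
    refine Finset.sum_eq_zero fun m _ => Finset.sum_eq_zero fun n _ => ?_
    simp only [Finset.coe_Icc, Set.mem_Icc, not_and_or, not_le] at hc
    rcases hc with h | h
    · rw [ch_neg h]; simp
    · rw [ch_neg (show j - (p - i) < 0 by omega)]; simp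

end Three

/-! ### Associativity of the vertex operation on `ℰ(V)` -/

section Assoc

variable {V : Type*} [AddCommGroup V] [Module ℂ V]

open MvPolynomial (X C aeval)

/-- Compatibility of the pairs and triples in a set which is closed under the vertex operation. -/
structure Compat (S : Set (EW V)) : Prop where
  closed : ∀ a ∈ S, ∀ b ∈ S, ∀ n, YE a b n ∈ S
  pair : ∀ a ∈ S, ∀ b ∈ S, ∃ K : ℕ, ∀ w, QLK K (Fu a b w)
  triple : ∀ a ∈ S, ∀ b ∈ S, ∀ c ∈ S, ∃ k : ℕ, ∀ w, Laur3 (act V e3 (vd ^ k) (Ft a b c w))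

theorem YE_trunc {b c : EW V} {K : ℕ} (h : ∀ w, QLK K (Fu b c w)) {n : ℤ} (hn : (K : ℤ) ≤ n) :
    YE b c n = 0 := by
  refine EW_ext fun w m => ?_
  rw [YE_eq h, Sb_eq (h w), Sop_of_neg _ (by omega)]
  rfl

theorem Sb_zero : Sb (0 : ℤ × ℤ → V) = 0 := by
  have := Sb_smul (0 : ℂ) (F := (0 : ℤ × ℤ → V)) ⟨0, 0, fun _ _ => by simp⟩
  simpa using this

theorem opA_Sb {G : ℤ × ℤ × ℤ → V} (h : ∀ l, Laur2 (slA G l)) : opA Sb G = opA Sop G := by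
  funext k; simp only [opA, Sb_of_laur2 (h _)]
theorem opB_Sb {G : ℤ × ℤ × ℤ → V} (h : ∀ l, Laur2 (slB G l)) : opB Sb G = opB Sop G := by
  funext k; simp only [opB, Sb_of_laur2 (h _)]
theorem opC_Sb {G : ℤ × ℤ × ℤ → V} (h : ∀ l, Laur2 (slC G l)) : opC Sb G = opC Sop G := by
  funext k; simp only [opC, Sb_of_laur2 (h _)]

theorem slC_act (P : MvPolynomial (Fin 2) ℂ) (G : ℤ × ℤ × ℤ → V) (l : ℤ) :
    slC (act V e3 (MvPolynomial.rename ![0, 1] P) G) l = act V e2 P (slC G l) := by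
  refine act_comp (fun k : ℤ × ℤ => (k.1, k.2, l)) _ (fun k j => ?_) P G
  fin_cases j <;> simp

theorem YE_assoc {S : Set (EW V)} (hS : Compat S) {a b c : EW V} (ha : a ∈ S) (hb : b ∈ S)
    (hc : c ∈ S) : ∃ k : ℕ, ∀ (w : V) (l : ℤ),
    act V e2 ((X 0 + X 1) ^ k)
      (fun q => mf (YE (YE a b (-q.1 - 1)) c (-q.2 - 1)) w (-l - 1)) =
    act V e2 ((X 0 + X 1) ^ k)
      (Eop fun q => mf (YE a (YE b c (-q.2 - 1)) (-q.1 - 1)) w (-l - 1)) := by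
  obtain ⟨k, hk⟩ := hS.triple a ha b hb c hc
  refine ⟨k, fun w => ?_⟩
  obtain ⟨Kab, hab⟩ := hS.pair a ha b hb
  obtain ⟨Kbc, hbc⟩ := hS.pair b hb c hc
  set T := Ft a b c w with hT
  have hTC : ∀ l, QL (slC T l) := fun l => ⟨Kab, hab (mf c w (-l - 1))⟩
  have hTA : ∀ l, QL (slA T l) := fun l => ⟨Kbc, (hbc w).map (mfL a (-l - 1))⟩
  have hC : ∀ i j l, opC Sb T (i, j, l) = mf (YE a b (-i - 1)) (mf c w (-l - 1)) (-j - 1) := by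
    intro i j l
    rw [YE_eq hab, show -(-i - 1) - 1 = i by ring, show -(-j - 1) - 1 = j by ring]
    rfl
  have hA : ∀ i j l, opA Sb T (i, j, l) = mf a (mf (YE b c (-j - 1)) w (-l - 1)) (-i - 1) := by
    intro i j l
    rw [YE_eq hbc, show -(-j - 1) - 1 = j by ring, show -(-l - 1) - 1 = l by ring]
    exact Sb_map (mfL a (-i - 1)) ⟨Kbc, hbc w⟩ (j, l)
  have hCA : ∀ i, slA (opC Sb T) i = Fu (YE a b (-i - 1)) c w := fun i => by
    funext q; exact hC _ _ _
  have hAB : ∀ j, slB (opA Sb T) j = Fu a (YE b c (-j - 1)) w := fun j => by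
    funext q; exact hA _ _ _
  have hCA' : ∀ i, QL (slA (opC Sb T) i) := fun i => by
    obtain ⟨K, h⟩ := hS.pair _ (hS.closed a ha b hb (-i - 1)) c hc
    exact ⟨K, by rw [hCA]; exact h w⟩
  have hAB' : ∀ i, QL (slB (opA Sb T) i) := fun i => by
    obtain ⟨K, h⟩ := hS.pair a ha _ (hS.closed b hb c hc (-i - 1))
    exact ⟨K, by rw [hAB]; exact h w⟩
  have hR : ∀ i j l, opA Sb (opC Sb T) (i, j, l) =
      mf (YE (YE a b (-i - 1)) c (-j - 1)) w (-l - 1) := by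
    intro i j l
    obtain ⟨K, h⟩ := hS.pair _ (hS.closed a ha b hb (-i - 1)) c hc
    rw [YE_eq h, show -(-j - 1) - 1 = j by ring, show -(-l - 1) - 1 = l by ring, ← hCA]
    rfl
  have hL : ∀ i j l, opB Sb (opA Sb T) (i, j, l) =
      mf (YE a (YE b c (-j - 1)) (-i - 1)) w (-l - 1) := by
    intro i j l
    obtain ⟨K, h⟩ := hS.pair a ha _ (hS.closed b hb c hc (-j - 1))
    rw [YE_eq h, show -(-i - 1) - 1 = i by ring, show -(-l - 1) - 1 = l by ring, ← hAB]
    rfl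
  have hLt : ∀ l, TrU (slC (opB Sb (opA Sb T)) l) := by
    refine fun l => ⟨-Kbc, fun q hq => ?_⟩
    change opB Sb (opA Sb T) (q.1, q.2, l) = 0
    change Sb (slB (opA Sb T) q.2) (q.1, l) = 0
    rw [hAB, YE_trunc hbc (by omega),
      show Fu a (0 : EW V) w = 0 from funext fun q => mf_zero a _, Sb_zero]
    rfl
  set Q := act V e3 (vd ^ k) T with hQ
  obtain ⟨N, hN⟩ := hk w
  have hQC : ∀ l, Laur2 (slC Q l) := fun l => ⟨N, fun q hq => hN _ (by simp only; tauto)⟩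
  have hQA : ∀ l, Laur2 (slA Q l) := fun l => ⟨N, fun q hq => hN _ (by simp only; tauto)⟩
  have hQCA : ∀ i, Laur2 (slA (opC Sop Q) i) := by
    refine fun i => ⟨min N (2 * N - i), fun q hq => ?_⟩
    change Sop (slC Q q.2) (i, q.1) = 0
    rcases hq with h | h
    · exact Sop_trunc (N := N) (fun q hq => hN _ (by simp only; tauto)) (by omega)
    · rw [show slC Q q.2 = 0 from funext fun q' => hN _ (Or.inr (Or.inr (by simp only; omega)))]
      simp [Sop]
  have hQAB : ∀ i, Laur2 (slB (opA Sop Q) i) := by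
    refine fun i => ⟨min N (2 * N - i), fun q hq => ?_⟩
    change Sop (slA Q q.1) (i, q.2) = 0
    rcases hq with h | h
    · rw [show slA Q q.1 = 0 from funext fun q' => hN _ (Or.inl (by simp only; omega))]
      simp [Sop]
    · exact Sop_trunc (N := N) (fun q hq => hN _ (by simp only; tauto)) (by omega)
  have key : act V e3 (aeval subA (aeval subC (vd ^ k))) (opA Sb (opC Sb T)) =
      act V e3 (aeval subC (aeval subB (aeval subA (vd ^ k))))
        (opC Eop (opB Sb (opA Sb T))) := by
    rw [← (opA_act subs_Sb _ hCA').2, ← (opC_act subs_Sb _ hTC).2,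
      ← (opC_act subs_Eop _ hLt).2, ← (opB_act subs_Sb _ hAB').2, ← (opA_act subs_Sb _ hTA).2,
      ← hQ, opC_Sb hQC, opA_Sb hQCA, opA_Sb hQA, opB_Sb hQAB]
    exact opA_opC_Sop (hk w)
  have p1 : aeval subA (aeval subC (vd ^ k)) = X 0 ^ k * (X 1 ^ k * (X 0 + X 1) ^ k) := by
    simp only [vd, map_pow, map_mul, map_sub, MvPolynomial.aeval_X]
    rw [← mul_pow, ← mul_pow]
    congr 1
    simp
    ring
  have p2 : aeval subC (aeval subB (aeval subA (vd ^ k))) =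
      X 0 ^ k * (X 1 ^ k * (X 0 + X 1) ^ k) := by
    simp only [vd, map_pow, map_mul, map_sub, MvPolynomial.aeval_X]
    rw [← mul_pow, ← mul_pow]
    congr 1
    simp
    ring
  rw [p1, p2] at key
  simp only [act_mul] at key
  have key3 := X_pow_cancel e3 1 k (X_pow_cancel e3 0 k key)
  intro l
  have hr : ((X 0 + X 1 : MvPolynomial (Fin 3) ℂ) ^ k) =
      MvPolynomial.rename ![0, 1] ((X 0 + X 1 : MvPolynomial (Fin 2) ℂ) ^ k) := by simp
  have key4 := congrArg (fun G => slC G l) key3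
  simp only [hr, slC_act] at key4
  have t1 : slC (opA Sb (opC Sb T)) l =
      fun q => mf (YE (YE a b (-q.1 - 1)) c (-q.2 - 1)) w (-l - 1) := funext fun q => hR _ _ _
  have t2 : slC (opC Eop (opB Sb (opA Sb T))) l =
      Eop fun q => mf (YE a (YE b c (-q.2 - 1)) (-q.1 - 1)) w (-l - 1) := by
    have : slC (opB Sb (opA Sb T)) l =
      fun q => mf (YE a (YE b c (-q.2 - 1)) (-q.1 - 1)) w (-l - 1) := funext fun q => hL _ _ _
    rw [← this]; rfl
  rw [t1, t2] at key4
  exact key4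

end Assoc

/-! ### The state-field correspondence -/

section StateField

variable {V : Type*} [AddCommGroup V] [Module ℂ V]

open MvPolynomial (X C aeval)

theorem Eop_map {V' : Type*} [AddCommGroup V'] [Module ℂ V'] (L : V →ₗ[ℂ] V') {G : ℤ × ℤ → V}
    (h : TrU G) (k : ℤ × ℤ) : Eop (fun k => L (G k)) k = L (Eop G k) := by
  rw [Eop, Eop, ← LinearMap.toAddMonoidHom_coe, AddMonoidHom.map_finsum _ (Eop_finite h k)]
  exact finsum_congr fun m => by simp

/-- The induction principle for a space spanned by iterated modes applied to a vector. -/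
def ModeInd (one : V) {U : Type*} (Φ : U → EW V) : Prop :=
  ∀ P : V → Prop, P 0 → P one → (∀ a b, P a → P b → P (a + b)) → (∀ (c : ℂ) a, P a → P (c • a)) →
    (∀ u v n, P v → P (mf (Φ u) v n)) → ∀ v, P v

/-- A generating set of creative, translation covariant fields with a homomorphism to a
compatible set of fields. -/
structure Gens (one : V) (L : V →ₗ[ℂ] V) (U : Set V) (Y0 : U → EW V) (ψ : V →ₗ[ℂ] EW V)
    (S : Set (EW V)) : Prop where
  L_one : L one = 0
  dbr : ∀ a ∈ S, Dbr L a
  creation0 : ∀ (u : U) (n : ℤ), 0 ≤ n → mf (Y0 u) one n = 0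
  creation1 : ∀ u : U, mf (Y0 u) one (-1) = u
  ind : ModeInd one Y0
  compat : Compat S
  mem : ∀ v, ψ v ∈ S
  one : ψ one = oneE
  hom : ∀ (u : U) (v : V) (n : ℤ), ψ (mf (Y0 u) v n) = YE (Y0 u) (ψ v) n

/-- A state-field correspondence satisfying the axioms of a nonlocal vertex algebra. -/
structure SF (one : V) (L : V →ₗ[ℂ] V) (ψ : V →ₗ[ℂ] EW V) : Prop where
  L_one : L one = 0
  dbr : ∀ v, Dbr L (ψ v)
  creation0 : ∀ (v : V) (n : ℤ), 0 ≤ n → mf (ψ v) one n = 0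
  creation1 : ∀ v : V, mf (ψ v) one (-1) = v
  pair : ∀ u v, ∃ K : ℕ, ∀ w, QLK K (Fu (ψ u) (ψ v) w)
  one : ψ one = oneE
  hom : ∀ (u v : V) (n : ℤ), ψ (mf (ψ u) v n) = YE (ψ u) (ψ v) n

theorem YE_add_left {a a' b : EW V} {K K' : ℕ} (h : ∀ w, QLK K (Fu a b w))
    (h' : ∀ w, QLK K' (Fu a' b w)) (n : ℤ) : YE (a + a') b n = YE a b n + YE a' b n := by
  have e : ∀ w, Fu (a + a') b w = Fu a b w + Fu a' b w := fun w => rfl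
  have hs : ∀ w, QLK (max K K') (Fu (a + a') b w) := fun w => by
    rw [e]; exact ((h w).mono (le_max_left _ _)).add ((h' w).mono (le_max_right _ _))
  refine EW_ext fun w m => ?_
  rw [add_mf, YE_eq h, YE_eq h', YE_eq hs, e, Sb_add ⟨K, h w⟩ ⟨K', h' w⟩]
  rfl

theorem YE_smul_left {a b : EW V} {K : ℕ} (h : ∀ w, QLK K (Fu a b w)) (c : ℂ) (n : ℤ) :
    YE (c • a) b n = c • YE a b n := by
  have e : ∀ w, Fu (c • a) b w = c • Fu a b w := fun w => rfl
  have hs : ∀ w, QLK K (Fu (c • a) b w) := fun w => by rw [e]; exact (h w).smul c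
  refine EW_ext fun w m => ?_
  rw [smul_mf, YE_eq h, YE_eq hs, e, Sb_smul c ⟨K, h w⟩]
  rfl

theorem YE_zero_left (b : EW V) (n : ℤ) : YE 0 b n = 0 := by
  have e : ∀ w, Fu (0 : EW V) b w = 0 := fun w => rfl
  have hs : ∀ w, QLK 0 (Fu (0 : EW V) b w) := fun w => by
    rw [e]; exact ⟨0, fun _ _ => by simp⟩
  refine EW_ext fun w m => ?_
  rw [YE_eq hs, e, Sb_zero]
  rfl

theorem weak_assoc {ψ : V →ₗ[ℂ] EW V} {u v : V} {K : ℕ} (h : ∀ w, QLK K (Fu (ψ u) (ψ v) w))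
    (hg : ∀ n, ψ (mf (ψ u) v n) = YE (ψ u) (ψ v) n) (w : V) : ∃ l : ℕ,
    act V e2 ((X 0 + X 1) ^ l) (Eop (Fu (ψ u) (ψ v) w)) =
      act V e2 ((X 0 + X 1) ^ l) (fun k => mf (ψ (mf (ψ u) v (-k.1 - 1))) w (-k.2 - 1)) := by
  obtain ⟨l, hl⟩ := Eop_Sb_assoc (Fu_trU (ψ u) (ψ v) w) ⟨K, h w⟩
  refine ⟨l, hl.trans ?_⟩
  congr 1
  funext k
  rw [hg, YE_eq h]
  congr 1
  ext <;> simp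

theorem add_pow_act_eq {l l' : ℕ} {F G : ℤ × ℤ → V} (hl : l ≤ l')
    (h : act V e2 ((X 0 + X 1) ^ l) F = act V e2 ((X 0 + X 1) ^ l) G) :
    act V e2 ((X 0 + X 1) ^ l') F = act V e2 ((X 0 + X 1) ^ l') G := by
  obtain ⟨d, rfl⟩ := Nat.exists_eq_add_of_le hl
  rw [add_comm l d, pow_add, act_mul, act_mul, h]

theorem add_pow_cancel_eq {F G : ℤ × ℤ → V} {J₀ : ℤ} (hF : ∀ J q, J < J₀ → F (J, q) = 0)
    (hG : ∀ J q, J < J₀ → G (J, q) = 0) (l : ℕ)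
    (h : act V e2 ((X 0 + X 1) ^ l) F = act V e2 ((X 0 + X 1) ^ l) G) : F = G := by
  rw [← sub_eq_zero]
  refine add_pow_cancel (J₀ := J₀) (fun J q hJ => ?_) l ?_
  · rw [Pi.sub_apply, hF J q hJ, hG J q hJ, sub_zero]
  · rw [map_sub, h, sub_self]

variable {one : V} {L : V →ₗ[ℂ] V} {U : Set V} {Y0 : U → EW V} {ψ : V →ₗ[ℂ] EW V}
  {S : Set (EW V)}

theorem Gens.gen (h : Gens one L U Y0 ψ S) (u : U) : ψ u = Y0 u := by
  have := h.hom u one (-1)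
  rwa [h.creation1, h.one, YE_oneE_right] at this

theorem Gens.creation (h : Gens one L U Y0 ψ S) (v : V) :
    (∀ n : ℤ, 0 ≤ n → mf (ψ v) one n = 0) ∧ mf (ψ v) one (-1) = v := by
  refine h.ind (fun v => (∀ n : ℤ, 0 ≤ n → mf (ψ v) one n = 0) ∧ mf (ψ v) one (-1) = v)
    ?_ ?_ ?_ ?_ ?_ v
  · simp [zero_mf]
  · rw [h.one]
    exact ⟨fun n hn => by rw [mf_oneE, if_neg (by omega)], by simp [mf_oneE]⟩
  · rintro a b ⟨ha, ha'⟩ ⟨hb, hb'⟩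
    rw [map_add]
    exact ⟨fun n hn => by rw [add_mf, ha n hn, hb n hn, add_zero], by rw [add_mf, ha', hb']⟩
  · rintro c a ⟨ha, ha'⟩
    rw [map_smul]
    exact ⟨fun n hn => by rw [smul_mf, ha n hn, smul_zero], by rw [smul_mf, ha']⟩
  · rintro u v n ⟨hv, hv'⟩
    rw [h.hom, ← h.gen]
    obtain ⟨K, hK⟩ := h.compat.pair _ (h.mem u) _ (h.mem v)
    have := YE_creation h.L_one (h.dbr _ (h.mem u)) (h.dbr _ (h.mem v)) hK hv n
    rw [hv'] at this
    exact this

theorem Gens.hom_all (h : Gens one L U Y0 ψ S) (u v : V) (n : ℤ) :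
    ψ (mf (ψ u) v n) = YE (ψ u) (ψ v) n := by
  have pair := fun u v => h.compat.pair _ (h.mem u) _ (h.mem v)
  refine h.ind (fun u => ∀ v n, ψ (mf (ψ u) v n) = YE (ψ u) (ψ v) n) ?_ ?_ ?_ ?_ ?_ u v n
  · intro v n
    rw [map_zero, YE_zero_left, zero_mf, map_zero]
  · intro v n
    rw [h.one, YE_oneE_left, mf_oneE]
    split_ifs <;> simp
  · intro a b ha hb v n
    obtain ⟨K, hK⟩ := pair a v
    obtain ⟨K', hK'⟩ := pair b v
    rw [map_add, YE_add_left hK hK', add_mf, map_add, ha, hb]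
  · intro c a ha v n
    obtain ⟨K, hK⟩ := pair a v
    rw [map_smul, YE_smul_left hK, smul_mf, map_smul, ha]
  · intro u v m hv c n
    have hu : ∀ v n, ψ (mf (ψ u) v n) = YE (ψ u) (ψ v) n := by
      intro v n; rw [h.gen, h.hom]
    refine EW_ext fun w l => ?_
    obtain ⟨k, hk⟩ := YE_assoc h.compat (h.mem u) (h.mem v) (h.mem c)
    obtain ⟨K, hK⟩ := pair u v
    obtain ⟨k', hk'⟩ := weak_assoc hK (hu v) c
    have h1 := add_pow_act_eq (le_max_left k k') (hk w (-l - 1))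
    have h2 := add_pow_act_eq (le_max_right k k') hk'
    set l' := max k k'
    obtain ⟨N, hN⟩ := mf_trunc (ψ u) v
    let Λ : V →ₗ[ℂ] V :=
      { toFun := fun x => mf (ψ x) w l
        map_add' := fun x y => by rw [map_add, add_mf]
        map_smul' := fun c x => by rw [map_smul, smul_mf]; rfl }
    have hΛ : ∀ x, Λ x = mf (ψ x) w l := fun _ => rfl
    have h0 : ∀ J : ℤ, J < -N → mf (ψ u) v (-J - 1) = 0 := fun J hJ => hN _ (by omega)
    have key := add_pow_cancel_eq (l := l') (J₀ := -N)
      (F := fun q : ℤ × ℤ => mf (YE (YE (ψ u) (ψ v) (-q.1 - 1)) (ψ c) (-q.2 - 1)) w l)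
      (G := fun q : ℤ × ℤ => Λ (mf (ψ (mf (ψ u) v (-q.1 - 1))) c (-q.2 - 1))) ?_ ?_ ?_
    · have := congrFun key (-m - 1, -n - 1)
      simp only [hΛ, ← hu, show -(-m - 1) - 1 = m by ring, show -(-n - 1) - 1 = n by ring] at this
      rw [← h.gen]
      exact this.symm
    · intro J q hJ
      simp only [← hu]
      rw [h0 J hJ, map_zero, YE_zero_left, zero_mf]
    · intro J q hJ
      simp only
      rw [h0 J hJ, map_zero, zero_mf, map_zero]
    · rw [show - (-l - 1) - 1 = l by ring] at h1
      rw [h1]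
      have e : (fun q : ℤ × ℤ => mf (YE (ψ u) (YE (ψ v) (ψ c) (-q.2 - 1)) (-q.1 - 1)) w l) =
          fun q => Λ (Fu (ψ u) (ψ v) c q) := by
        funext q
        rw [← hv, ← hu, hΛ]
        rfl
      have e' : (Eop fun q : ℤ × ℤ => Λ (Fu (ψ u) (ψ v) c q)) =
          fun q => Λ (Eop (Fu (ψ u) (ψ v) c) q) :=
        funext fun q => Eop_map Λ (Fu_trU (ψ u) (ψ v) c) q
      rw [e, e', act_map, h2, act_map]

theorem Gens.sf (h : Gens one L U Y0 ψ S) : SF one L ψ where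
  L_one := h.L_one
  dbr v := h.dbr _ (h.mem v)
  creation0 v := (h.creation v).1
  creation1 v := (h.creation v).2
  pair u v := h.compat.pair _ (h.mem u) _ (h.mem v)
  one := h.one
  hom := h.hom_all

end StateField

section Construction

variable {V : Type*} [AddCommGroup V] [Module ℂ V]

open MvPolynomial (X C aeval)

variable {one : V} {L : V →ₗ[ℂ] V} {U : Set V} {Y0 : U → EW V} {ψ : V →ₗ[ℂ] EW V}

theorem mulSubPoly_prodCE (ψ : V →ₗ[ℂ] EW V) (u v w : V) (l : ℕ) (a b : ℤ) :
    mulSubPoly (X 0 ^ l) (prodCE (fun x => mf (ψ x)) (fun x => mf (ψ x)) u v w) a b =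
      act V e2 ((X 0 + X 1) ^ l) (Eop (Fu (ψ u) (ψ v) w)) (a, b) := by
  rw [mulSubPoly_X_pow]
  exact congrArg (fun F => act V e2 ((X 0 + X 1) ^ l) F (a, b))
    (funext fun k => prodCE_eq _ _ u v w k.1 k.2)

theorem SF.weak_assoc (h : SF one L ψ) (u v w : V) : ∃ l : ℕ,
    act V e2 ((X 0 + X 1) ^ l) (Eop (Fu (ψ u) (ψ v) w)) =
      act V e2 ((X 0 + X 1) ^ l) (fun k => mf (ψ (mf (ψ u) v (-k.1 - 1))) w (-k.2 - 1)) := by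
  obtain ⟨K, hK⟩ := h.pair u v
  exact NVA.weak_assoc hK (h.hom u v) w

/-- The nonlocal vertex algebra given by a state-field correspondence. -/
def SF.nlva (h : SF one L ψ) : NLVA V where
  Y := ψ
  one := one
  vac v n := by rw [h.one, mf_oneE]
  creation0 := h.creation0
  creation1 := h.creation1
  wassoc u v w := by
    obtain ⟨l, hl⟩ := h.weak_assoc u v w
    refine ⟨l, fun a b => ?_⟩
    rw [mulSubPoly_prodCE, hl, mulSubPoly_X_pow]
    rfl

theorem NLVA.weak_assoc (A : NLVA V) (u v w : V) : ∃ l : ℕ,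
    act V e2 ((X 0 + X 1) ^ l) (Eop (Fu (A.Y u) (A.Y v) w)) =
      act V e2 ((X 0 + X 1) ^ l) (fun k => mf (A.Y (mf (A.Y u) v (-k.1 - 1))) w (-k.2 - 1)) := by
  obtain ⟨l, hl⟩ := A.wassoc u v w
  refine ⟨l, ?_⟩
  funext ⟨a, b⟩
  rw [← mulSubPoly_prodCE, hl, mulSubPoly_X_pow]
  rfl

/-- A nonlocal vertex algebra is determined by the vertex operators of generators. -/
theorem NLVA.Y_unique (A B : NLVA V) (hone : A.one = B.one) (hU : ∀ u : U, A.Y u = Y0 u)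
    (hU' : ∀ u : U, B.Y u = Y0 u) (ind : ModeInd B.one Y0) : A.Y = B.Y := by
  refine LinearMap.ext fun v => ind (fun v => A.Y v = B.Y v) (by simp) ?_ ?_ ?_ ?_ v
  · refine EW_ext fun w n => ?_
    rw [B.vac, ← hone, A.vac]
  · intro a b ha hb
    rw [map_add, map_add, ha, hb]
  · intro c a ha
    rw [map_smul, map_smul, ha]
  · intro u v n hv
    refine EW_ext fun w m => ?_
    obtain ⟨l, hl⟩ := A.weak_assoc u v w
    obtain ⟨l', hl'⟩ := B.weak_assoc u v w
    rw [hU, hv] at hl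
    rw [hU'] at hl'
    have h1 := add_pow_act_eq (le_max_left l l') hl
    rw [add_pow_act_eq (le_max_right l l') hl'] at h1
    obtain ⟨N, hN⟩ := mf_trunc (Y0 u) v
    have key := add_pow_cancel_eq (J₀ := -N) ?_ ?_ _ h1
    · have := congrFun key (-n - 1, -m - 1)
      simpa using this.symm
    all_goals
      intro J q hJ
      simp only
      rw [hN _ (by omega), map_zero, zero_mf]

theorem modeInd_of_span {one : V} {Φ : U → EW V} (S : Set V)
    (hS : Submodule.span ℂ S = ⊤)
    (hind : ∀ P : V → Prop, P one → (∀ u v n, P v → P (mf (Φ u) v n)) → ∀ v ∈ S, P v) :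
    ModeInd one Φ := by
  intro P h0 h1 ha hs hm v
  have hv : v ∈ Submodule.span ℂ S := hS ▸ Submodule.mem_top
  induction hv using Submodule.span_induction with
  | mem x hx => exact hind P h1 hm x hx
  | zero => exact h0
  | add x y _ _ hx hy => exact ha x y hx hy
  | smul c x _ hx => exact hs c x hx

theorem ModeInd.gens (ind : ModeInd one Y0) (hL1 : L one = 0) (hLbr : ∀ u, Dbr L (Y0 u))
    (hcr0 : ∀ (u : U) (n : ℤ), 0 ≤ n → mf (Y0 u) one n = 0)
    (hcr1 : ∀ u : U, mf (Y0 u) one (-1) = u) {U' : Submodule ℂ (EW V)}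
    (hU' : IsGenVA (Set.range Y0) U') (hψmem : ∀ v, ψ v ∈ U') (hψ1 : ψ one = oneE)
    (hψhom : ∀ (u : U) (v : V) (n : ℤ), ψ (mf (Y0 u) v n) = YE (Y0 u) (ψ v) n) :
    Gens one L U Y0 ψ {a | a ∈ U' ∧ Dbr L a} := by
  obtain ⟨hq, hcl, -, hsub, -⟩ := hU'
  have pair : ∀ a b, a ∈ U' ∧ Dbr L a → b ∈ U' ∧ Dbr L b → ∃ K : ℕ, ∀ w, QLK K (Fu a b w) := by
    rintro a b ⟨ha, ha'⟩ ⟨hb, hb'⟩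
    exact QCSeq.pair ha' hb' (hq _ _ (by intro i; fin_cases i <;> assumption))
  have hY0 : ∀ u, Y0 u ∈ U' := fun u => hsub ⟨u, rfl⟩
  refine ⟨hL1, fun a ha => ha.2, hcr0, hcr1, ind, ⟨?_, ?_, ?_⟩, fun v => ⟨hψmem v, ?_⟩, hψ1, hψhom⟩
  · intro a ha b hb n
    obtain ⟨K, hK⟩ := pair a b ha hb
    exact ⟨hcl a ha.1 b hb.1 n, Dbr_YE ha.2 hb.2 hK n⟩
  · exact fun a ha b hb => pair a b ha hb
  · rintro a ⟨ha, ha'⟩ b ⟨hb, hb'⟩ c ⟨hc, hc'⟩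
    exact QCSeq.triple ha' hb' hc' (hq _ _ (by intro i; fin_cases i <;> assumption))
  · refine ind (fun v => Dbr L (ψ v)) ?_ ?_ ?_ ?_ ?_ v
    · intro w n
      simp [zero_mf]
    · intro w n
      rw [hψ1]
      simp only [mf_oneE]
      by_cases h : n = 0
      · subst h; simp
      · rw [if_neg (show ¬ n - 1 = -1 by omega)]
        split_ifs <;> simp
    · intro a b ha hb w n
      rw [map_add, add_mf, add_mf, add_mf, map_add, smul_add, ← ha, ← hb]
      abel
    · intro c a ha w n
      rw [map_smul, smul_mf, smul_mf, smul_mf, map_smul, smul_comm, ← ha, smul_sub]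
    · intro u v n hv
      rw [hψhom]
      obtain ⟨K, hK⟩ := pair _ _ ⟨hY0 u, hLbr u⟩ ⟨hψmem v, hv⟩
      exact Dbr_YE (hLbr u) hv hK n

end Construction

/-! ### Vector-valued Laurent series and operator-valued coefficients -/

section LaurentVec

variable {V : Type*} [AddCommGroup V] [Module ℂ V]

/-- Laurent series with coefficients in the endomorphism ring of `V`. -/
abbrev EE (V : Type*) [AddCommGroup V] [Module ℂ V] : Type _ := HahnSeries ℤ (Module.End ℂ V)

/-- The space `V((x))` as a module over `End(V)((x))`. -/
abbrev HV (V : Type*) [AddCommGroup V] [Module ℂ V] : Type _ := HahnModule ℤ (Module.End ℂ V) V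

/-- The coefficients of an element of `V((x))`. -/
def cf (h : HV V) (m : ℤ) : V := ((HahnModule.of (Module.End ℂ V)).symm h).coeff m

theorem cf_ext {g h : HV V} (H : ∀ m, cf g m = cf h m) : g = h :=
  HahnModule.ext _ _ (funext H)

theorem cf_add (g h : HV V) (m : ℤ) : cf (g + h) m = cf g m + cf h m := rfl

theorem cf_sub (g h : HV V) (m : ℤ) : cf (g - h) m = cf g m - cf h m := rfl

theorem cf_zero (m : ℤ) : cf (0 : HV V) m = 0 := rfl

/-- The coefficient of an element of `V((x))` as an additive map. -/
def cfHom (V : Type*) [AddCommGroup V] [Module ℂ V] (m : ℤ) : HV V →+ V where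
  toFun h := cf h m
  map_zero' := rfl
  map_add' _ _ := rfl

theorem cf_sum {ι : Type*} (s : Finset ι) (g : ι → HV V) (m : ℤ) :
    cf (∑ i ∈ s, g i) m = ∑ i ∈ s, cf (g i) m := map_sum (cfHom V m) g s

theorem cf_trunc (h : HV V) : ∃ N : ℤ, ∀ m, m < N → cf h m = 0 :=
  ⟨((HahnModule.of (Module.End ℂ V)).symm h).order, fun _ hm =>
    HahnSeries.coeff_eq_zero_of_lt_order hm⟩

/-- The element of `V((x))` with given lower truncated coefficients. -/
def mkH (g : ℤ → V) (hg : ∃ N : ℤ, ∀ m, m < N → g m = 0) : HV V :=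
  HahnModule.of _ (HahnSeries.ofSuppBddBelow g (by
    obtain ⟨N, hN⟩ := hg
    exact ⟨N, fun m hm => not_lt.mp fun h => hm (hN m h)⟩))

theorem sum_eq_finsum_sub {M : Type*} [AddCommMonoid M] (S : Finset (ℤ × ℤ)) (m : ℤ)
    (F : ℤ → ℤ → M) (hS : ∀ p ∈ S, p.1 + p.2 = m) (hF : ∀ n, F n (m - n) ≠ 0 → (n, m - n) ∈ S) :
    ∑ p ∈ S, F p.1 p.2 = ∑ᶠ n : ℤ, F n (m - n) := by
  rw [finsum_eq_sum_of_support_subset (s := S.image Prod.fst)]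
  · rw [Finset.sum_image]
    · refine Finset.sum_congr rfl fun p hp => ?_
      rw [show m - p.1 = p.2 by have := hS p hp; omega]
    · intro p hp q hq h
      have h1 := hS p hp
      have h2 := hS q hq
      exact Prod.ext h (by omega)
  · intro n hn
    exact Finset.mem_coe.2 (Finset.mem_image.2 ⟨_, hF n hn, rfl⟩)

theorem cf_smul (x : EE V) (h : HV V) (m : ℤ) :
    cf (x • h) m = ∑ᶠ n : ℤ, x.coeff n (cf h (m - n)) := by
  rw [cf, HahnModule.coeff_smul]
  refine sum_eq_finsum_sub _ m (fun i j => x.coeff i (cf h j)) ?_ ?_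
  · intro p hp
    rw [Finset.mem_vaddAntidiagonal] at hp
    exact hp.2.2
  · intro n hn
    rw [Finset.mem_vaddAntidiagonal]
    refine ⟨fun h0 => hn ?_, fun h0 => hn ?_, by simp⟩
    · simp [h0]
    · change x.coeff n (((HahnModule.of (Module.End ℂ V)).symm h).coeff (m - n)) = 0
      rw [h0, map_zero]

theorem coeff_mul_finsum {R : Type*} [Semiring R] (x y : HahnSeries ℤ R) (m : ℤ) :
    (x * y).coeff m = ∑ᶠ n : ℤ, x.coeff n * y.coeff (m - n) := by
  rw [HahnSeries.coeff_mul]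
  refine sum_eq_finsum_sub _ m (fun i j => x.coeff i * y.coeff j) ?_ ?_
  · intro p hp
    rw [Finset.mem_antidiagonal] at hp
    exact hp.2.2
  · intro n hn
    rw [Finset.mem_antidiagonal]
    exact ⟨left_ne_zero_of_mul hn, right_ne_zero_of_mul hn, by simp⟩

/-- Scalar Laurent series as operator-valued ones. -/
def iot (V : Type*) [AddCommGroup V] [Module ℂ V] : LC →+* EE V where
  toFun f := HahnSeries.map f (algebraMap ℂ (Module.End ℂ V))
  map_zero' := by ext; simp
  map_one' := by
    ext m : 2
    rw [HahnSeries.map_coeff, HahnSeries.coeff_one, HahnSeries.coeff_one]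
    split_ifs
    · exact map_one _
    · exact map_zero _
  map_add' f g := by
    ext m : 2
    exact map_add _ _ _
  map_mul' f g := by
    ext m : 2
    rw [HahnSeries.map_coeff, coeff_mul_finsum, coeff_mul_finsum]
    rw [map_finsum (algebraMap ℂ (Module.End ℂ V))]
    · exact finsum_congr fun n => map_mul _ _ _
    · refine (Set.finite_Icc f.order (m - g.order)).subset fun n hn => ?_
      constructor
      · by_contra h
        exact hn (by simp only [HahnSeries.coeff_eq_zero_of_lt_order (not_le.1 h), zero_mul])
      · by_contra h
        exact hn (by
          simp only [HahnSeries.coeff_eq_zero_of_lt_order (x := g) (i := m - n) (by omega),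
            mul_zero])

theorem iot_coeff (f : LC) (n : ℤ) (v : V) : (iot V f).coeff n v = f.coeff n • v := rfl

theorem iot_comm (f : LC) (x : EE V) : iot V f * x = x * iot V f := by
  ext m : 2
  rw [coeff_mul_finsum, coeff_mul_finsum,
    ← finsum_comp_equiv (Equiv.subLeft m)]
  refine finsum_congr fun n => ?_
  rw [Equiv.subLeft_apply, sub_sub_cancel]
  exact Algebra.commutes (R := ℂ) (A := Module.End ℂ V) _ _

instance : Module LC (HV V) := Module.compHom _ (iot V)

theorem LC_smul_def (f : LC) (h : HV V) : f • h = iot V f • h := rfl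

theorem EE_smul_LC (x : EE V) (f : LC) (h : HV V) : x • f • h = f • x • h :=
  (mul_smul x (iot V f) h).symm.trans
    ((congrArg (· • h) (iot_comm f x).symm).trans (mul_smul (iot V f) x h))

theorem cf_LC_smul (f : LC) (h : HV V) (m : ℤ) :
    cf (f • h) m = ∑ᶠ n : ℤ, f.coeff n • cf h (m - n) := cf_smul _ h m

/-- The substitution `x ↦ -x` on Laurent series. -/
def neg1 {M : Type*} [AddCommGroup M] [Module ℂ M] (g : HahnSeries ℤ M) : HahnSeries ℤ M :=
  HahnSeries.ofSuppBddBelow (fun m => (-1 : ℂ) ^ m • g.coeff m)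
    ⟨g.order, fun m hm => not_lt.mp fun h => hm (by
      simp only [HahnSeries.coeff_eq_zero_of_lt_order h, smul_zero])⟩

/-- The substitution `x ↦ -x` on `V((x))`. -/
def negH (h : HV V) : HV V :=
  HahnModule.of _ (neg1 ((HahnModule.of (Module.End ℂ V)).symm h))

theorem cf_negH (h : HV V) (m : ℤ) : cf (negH h) m = (-1 : ℂ) ^ m • cf h m := rfl

theorem neg1_coeff {M : Type*} [AddCommGroup M] [Module ℂ M] (g : HahnSeries ℤ M) (m : ℤ) :
    (neg1 g).coeff m = (-1 : ℂ) ^ m • g.coeff m := rfl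

theorem neg_one_zpow_sq (m : ℤ) : (-1 : ℂ) ^ m * (-1 : ℂ) ^ m = 1 := by
  rw [← mul_zpow]; simp

theorem negH_negH (h : HV V) : negH (negH h) = h := by
  refine cf_ext fun m => ?_
  rw [cf_negH, cf_negH, smul_smul, neg_one_zpow_sq, one_smul]

theorem negH_add (g h : HV V) : negH (g + h) = negH g + negH h :=
  cf_ext fun _ => smul_add _ _ _

theorem negH_smul (x : EE V) (h : HV V) : negH (x • h) = neg1 x • negH h := by
  refine cf_ext fun m => ?_
  rw [cf_negH, cf_smul, cf_smul, smul_finsum]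
  refine finsum_congr fun n => ?_
  rw [neg1_coeff, cf_negH, LinearMap.smul_apply, map_smul, smul_smul, ← zpow_add₀ (by norm_num)]
  simp

theorem negH_LC_smul (f : LC) (h : HV V) : negH (f • h) = neg1 f • negH h := by
  rw [LC_smul_def, LC_smul_def, negH_smul]
  congr 1
  ext m v
  simp only [neg1_coeff, LinearMap.smul_apply, iot_coeff]
  rw [smul_smul, smul_eq_mul]

theorem cf_single_smul (n : ℤ) (a : Module.End ℂ V) (h : HV V) (m : ℤ) :
    cf ((HahnSeries.single n a : EE V) • h) m = a (cf h (m - n)) := by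
  have := HahnModule.coeff_single_smul_vadd (Γ' := ℤ) (r := a) (x := h) (a := m - n) (b := n)
  rwa [vadd_eq_add, add_sub_cancel] at this

end LaurentVec

/-! ### The exponential of the translation operator -/

section Exponential

variable {V : Type*} [AddCommGroup V] [Module ℂ V]

theorem mul_coeff_finite (x y : EE V) (m : ℤ) :
    (Function.support fun n : ℤ => x.coeff n * y.coeff (m - n)).Finite := by
  refine (Set.finite_Icc x.order (m - y.order)).subset fun n hn => ?_
  constructor
  · by_contra h
    exact hn (by simp only [HahnSeries.coeff_eq_zero_of_lt_order (not_le.1 h), zero_mul])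
  · by_contra h
    exact hn (by
      simp only [HahnSeries.coeff_eq_zero_of_lt_order (x := y) (i := m - n) (by omega), mul_zero])

/-- An operator-valued power series with given coefficients. -/
def mkE (g : ℤ → Module.End ℂ V) (hg : ∀ n < 0, g n = 0) : EE V :=
  HahnSeries.ofSuppBddBelow g ⟨0, fun n hn => not_lt.mp fun h => hn (hg n h)⟩

/-- The Euler derivation `x d/dx`. -/
def theta (x : EE V) : EE V :=
  HahnSeries.ofSuppBddBelow (fun n => (n : ℂ) • x.coeff n)
    ⟨x.order, fun n hn => not_lt.mp fun h => hn (by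
      simp only [HahnSeries.coeff_eq_zero_of_lt_order h, smul_zero])⟩

theorem theta_coeff (x : EE V) (n : ℤ) : (theta x).coeff n = (n : ℂ) • x.coeff n := rfl

theorem theta_sub (x y : EE V) : theta (x - y) = theta x - theta y := by
  ext n : 2
  exact smul_sub _ _ _

theorem theta_mul (x y : EE V) : theta (x * y) = theta x * y + x * theta y := by
  ext m : 2
  rw [HahnSeries.coeff_add, theta_coeff, coeff_mul_finsum, coeff_mul_finsum, coeff_mul_finsum,
    ← finsum_add_distrib (mul_coeff_finite _ _ _) (mul_coeff_finite _ _ _), smul_finsum]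
  refine finsum_congr fun n => ?_
  rw [theta_coeff, theta_coeff, smul_mul_assoc, mul_smul_comm, ← add_smul]
  congr 1
  push_cast
  ring

theorem theta_single_zero (a : Module.End ℂ V) : theta (HahnSeries.single 0 a : EE V) = 0 := by
  ext n : 2
  rw [theta_coeff, HahnSeries.coeff_single]
  split_ifs with h
  · subst h; simp
  · simp

theorem theta_neg1 (x : EE V) : theta (neg1 x) = neg1 (theta x) := by
  ext n : 2
  rw [theta_coeff, neg1_coeff, neg1_coeff, theta_coeff, smul_comm]

theorem eq_zero_of_theta_eq (L : Module.End ℂ V) {z : EE V}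
    (hz : theta z = HahnSeries.single 1 L * z) (h0 : ∀ n ≤ 0, z.coeff n = 0) : z = 0 := by
  have key : ∀ n : ℕ, z.coeff n = 0 := by
    intro n
    induction n with
    | zero => exact h0 _ le_rfl
    | succ n ih =>
      have := congrArg (fun y : EE V => y.coeff ((n + 1 : ℕ) : ℤ)) hz
      simp only [theta_coeff, HahnSeries.coeff_single_mul] at this
      rw [show ((n + 1 : ℕ) : ℤ) - 1 = n by push_cast; ring, ih, mul_zero] at this
      refine (smul_eq_zero.1 this).resolve_left ?_
      exact_mod_cast Nat.succ_ne_zero n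
  ext n : 2
  rcases le_or_gt n 0 with h | h
  · exact h0 n h
  · lift n to ℕ using h.le
    exact key n

theorem mul_coeff_of_neg {x y : EE V} (hx : ∀ n < 0, x.coeff n = 0) (hy : ∀ n < 0, y.coeff n = 0)
    {m : ℤ} (hm : m < 0) : (x * y).coeff m = 0 := by
  rw [coeff_mul_finsum]
  refine (finsum_congr fun n => ?_).trans finsum_zero
  rcases lt_or_ge n 0 with h | h
  · rw [hx n h, zero_mul]
  · rw [hy _ (by omega), mul_zero]

theorem mul_coeff_zero {x y : EE V} (hx : ∀ n < 0, x.coeff n = 0) (hy : ∀ n < 0, y.coeff n = 0) :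
    (x * y).coeff 0 = x.coeff 0 * y.coeff 0 := by
  rw [coeff_mul_finsum, finsum_eq_single _ 0]
  · rw [sub_zero]
  · intro n hn
    rcases lt_or_gt_of_ne hn with h | h
    · rw [hx n h, zero_mul]
    · rw [hy _ (by omega), mul_zero]

theorem single_zero_coeff_of_neg (a : Module.End ℂ V) {n : ℤ} (hn : n < 0) :
    (HahnSeries.single 0 a : EE V).coeff n = 0 :=
  HahnSeries.coeff_single_of_ne hn.ne

/-- The divided powers of an operator. -/
def dp (L : Module.End ℂ V) (n : ℤ) : Module.End ℂ V :=
  if n < 0 then 0 else ((n.toNat.factorial : ℂ)⁻¹) • L ^ n.toNat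

theorem dp_neg (L : Module.End ℂ V) {n : ℤ} (h : n < 0) : dp L n = 0 := if_pos h

theorem dp_zero (L : Module.End ℂ V) : dp L 0 = 1 := by
  simp [dp]

theorem dp_rec (L : Module.End ℂ V) (n : ℤ) : (n : ℂ) • dp L n = L * dp L (n - 1) := by
  rcases lt_trichotomy n 0 with h | h | h
  · rw [dp_neg L h, dp_neg L (by omega), smul_zero, mul_zero]
  · subst h
    rw [dp_neg L (n := 0 - 1) (by norm_num)]
    simp
  · obtain ⟨k, rfl⟩ : ∃ k : ℕ, n = k + 1 := ⟨(n - 1).toNat, by omega⟩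
    have h1 : ((k : ℤ) + 1).toNat = k + 1 := by omega
    rw [dp, dp, if_neg (by omega), if_neg (by omega), add_sub_cancel_right, h1, Int.toNat_natCast,
      smul_smul, mul_smul_comm, ← pow_succ', Nat.factorial_succ]
    congr 1
    have h2 : (k.factorial : ℂ) ≠ 0 := by exact_mod_cast k.factorial_ne_zero
    have h3 : ((k : ℂ) + 1) ≠ 0 := by exact_mod_cast Nat.succ_ne_zero k
    push_cast
    field_simp

/-- The series `exp(x L)`. -/
def EXP (L : Module.End ℂ V) : EE V := mkE (dp L) fun _ h => dp_neg L h

theorem EXP_coeff (L : Module.End ℂ V) (n : ℤ) : (EXP L).coeff n = dp L n := rfl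

theorem theta_EXP (L : Module.End ℂ V) : theta (EXP L) = HahnSeries.single 1 L * EXP L := by
  ext n : 2
  rw [theta_coeff, HahnSeries.coeff_single_mul, EXP_coeff, EXP_coeff, dp_rec]

theorem dp_comm (L : Module.End ℂ V) (n : ℤ) : dp L n * L = L * dp L n := by
  rw [dp]
  split_ifs
  · simp
  · rw [smul_mul_assoc, mul_smul_comm, ← pow_succ, ← pow_succ']

theorem EXP_comm (L : Module.End ℂ V) :
    EXP L * HahnSeries.single 1 L = HahnSeries.single 1 L * EXP L := by
  ext n : 2
  rw [HahnSeries.coeff_mul_single, HahnSeries.coeff_single_mul, EXP_coeff, dp_comm]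

theorem neg1_single_mul (L : Module.End ℂ V) (x : EE V) :
    neg1 (HahnSeries.single 1 L * x) = -(HahnSeries.single 1 L * neg1 x) := by
  ext n : 2
  rw [neg1_coeff, HahnSeries.coeff_neg, HahnSeries.coeff_single_mul, HahnSeries.coeff_single_mul,
    neg1_coeff, mul_smul_comm, ← neg_smul, zpow_sub₀ (by norm_num), zpow_one, div_neg, div_one,
    neg_neg]

theorem mul_mul_add_mul_neg {R : Type*} [Ring R] (e p n : R) :
    e * p * n + e * -(p * n) = 0 := by
  noncomm_ring

theorem EXP_mul_neg1 (L : Module.End ℂ V) : EXP L * neg1 (EXP L) = 1 := by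
  have hE : ∀ n < 0, (EXP L).coeff n = 0 := fun n h => dp_neg L h
  have hN : ∀ n < 0, (neg1 (EXP L)).coeff n = 0 := fun n h => by
    rw [neg1_coeff, hE n h, smul_zero]
  have h0 : (EXP L * neg1 (EXP L)).coeff 0 = 1 := by
    rw [mul_coeff_zero hE hN, neg1_coeff, EXP_coeff, dp_zero]
    simp
  have hth : theta (EXP L * neg1 (EXP L)) = 0 := by
    rw [theta_mul, theta_neg1, theta_EXP, neg1_single_mul, ← EXP_comm]
    exact mul_mul_add_mul_neg _ _ _
  ext n : 2
  rcases lt_trichotomy n 0 with h | h | h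
  · rw [mul_coeff_of_neg hE hN h, HahnSeries.coeff_one, if_neg h.ne]
  · subst h
    rw [h0, HahnSeries.coeff_one, if_pos rfl]
  · have := congrArg (fun y : EE V => y.coeff n) hth
    simp only [theta_coeff] at this
    rw [(smul_eq_zero.1 this).resolve_left (by exact_mod_cast h.ne'), HahnSeries.coeff_one,
      if_neg h.ne']

/-- The coefficient of `x^s` in `a(x)`, as a constant operator-valued series. -/
def UC (a : EW V) (s : ℤ) : EE V := HahnSeries.single 0 (mfL a (-s - 1))

/-- The coefficient of `y^t` in `a(y + x)`, expanded in nonnegative powers of `x`. -/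
def EA (a : EW V) (t : ℤ) : EE V :=
  mkE (fun n => ch (t + n) n • mfL a (-(t + n) - 1)) fun n h => by rw [ch_neg h, zero_smul]

theorem EA_coeff (a : EW V) (t n : ℤ) :
    (EA a t).coeff n = ch (t + n) n • mfL a (-(t + n) - 1) := rfl

theorem Dbr.mul {L : V →ₗ[ℂ] V} {a : EW V} (h : Dbr L a) (s : ℤ) :
    (L * mfL a (-s - 1) - mfL a (-s - 1) * L : Module.End ℂ V) =
      ((s : ℂ) + 1) • mfL a (-(s + 1) - 1) := by
  ext v
  refine (h v (-s - 1)).trans ?_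
  rw [show -(s + 1) - 1 = -s - 1 - 1 by ring]
  change (-((-s - 1 : ℤ) : ℂ)) • mf a v _ = ((s : ℂ) + 1) • mf a v _
  congr 1
  push_cast
  ring

theorem theta_EA {L : V →ₗ[ℂ] V} {a : EW V} (h : Dbr L a) (t : ℤ) :
    theta (EA a t) = HahnSeries.single 1 L * EA a t - EA a t * HahnSeries.single 1 L := by
  ext n : 2
  rw [theta_coeff, HahnSeries.coeff_sub, HahnSeries.coeff_single_mul, HahnSeries.coeff_mul_single,
    EA_coeff, EA_coeff, mul_smul_comm, smul_mul_assoc, ← smul_sub, h.mul, smul_smul, smul_smul,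
    show t + (n - 1) + 1 = t + n by ring]
  congr 1
  have h1 := ch_absorb (t + n) n
  have h2 := ch_succ (t + n - 1) n
  rw [sub_add_cancel] at h2
  rw [show t + (n - 1) = t + n - 1 by ring]
  push_cast at h1 ⊢
  linear_combination h1 + ((t : ℂ) + n) * h2

theorem intertwine_aux {R : Type*} [Ring R] (p e c a : R) :
    p * e * c + e * 0 - ((p * a - a * p) * e + a * (p * e)) = p * (e * c - a * e) := by
  noncomm_ring

theorem EXP_mul_UC {L : V →ₗ[ℂ] V} {a : EW V} (h : Dbr L a) (t : ℤ) :
    EXP L * UC a t = EA a t * EXP L := by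
  have hE : ∀ n < 0, (EXP (V := V) L).coeff n = 0 := fun n h => dp_neg L h
  have hA : ∀ n < 0, (EA a t).coeff n = 0 := fun n h => by rw [EA_coeff, ch_neg h, zero_smul]
  have hU : ∀ n < 0, (UC a t).coeff n = 0 := fun n h => single_zero_coeff_of_neg _ h
  refine sub_eq_zero.1 (eq_zero_of_theta_eq L ?_ fun n hn => ?_)
  · rw [theta_sub, theta_mul, theta_mul, theta_EXP, theta_EA h, UC, theta_single_zero]
    exact intertwine_aux _ _ _ _
  · rw [HahnSeries.coeff_sub]
    rcases hn.lt_or_eq with hn | hn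
    · rw [mul_coeff_of_neg hE hU hn, mul_coeff_of_neg hA hE hn, sub_zero]
    · rw [hn, mul_coeff_zero hE hU, mul_coeff_zero hA hE, EA_coeff, ch_zero, EXP_coeff, dp_zero, UC,
        HahnSeries.coeff_single_same]
      simp

/-- The operator `h(x) ↦ exp(x L) h(-x)` on `V((x))`. -/
def sig (L : Module.End ℂ V) (h : HV V) : HV V := EXP L • negH h

theorem sig_add (L : Module.End ℂ V) (g h : HV V) : sig L (g + h) = sig L g + sig L h := by
  rw [sig, negH_add, smul_add, sig, sig]

theorem EE_mul_smul (x y : EE V) (h : HV V) : x • y • h = (x * y) • h :=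
  (mul_smul x y h).symm

theorem sig_sig (L : Module.End ℂ V) (h : HV V) : sig L (sig L h) = h := by
  rw [sig, sig, negH_smul, negH_negH, EE_mul_smul, EXP_mul_neg1]
  exact one_smul (EE V) h

theorem sig_smul (L : Module.End ℂ V) (f : LC) (h : HV V) :
    sig L (f • h) = (neg1 f : LC) • sig L h := by
  rw [sig, negH_LC_smul, EE_smul_LC, sig]

theorem EA_smul_sig {L : V →ₗ[ℂ] V} {a : EW V} (ha : Dbr L a) (t : ℤ) (h : HV V) :
    EA a t • sig L h = sig L (UC a t • h) := by
  have : neg1 (UC a t) = UC a t := by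
    ext n : 2
    rw [neg1_coeff, UC, HahnSeries.coeff_single]
    split_ifs with h
    · subst h; simp
    · simp
  rw [sig, EE_mul_smul, ← EXP_mul_UC ha, ← EE_mul_smul, sig, negH_smul, this]

theorem UC_smul_sig {L : V →ₗ[ℂ] V} {a : EW V} (ha : Dbr L a) (t : ℤ) (h : HV V) :
    UC a t • sig L h = sig L (EA a t • h) := by
  have := EA_smul_sig ha t (sig L h)
  rw [sig_sig] at this
  rw [this, sig_sig]

theorem cf_UC_smul (a : EW V) (t : ℤ) (h : HV V) (m : ℤ) :
    cf (UC a t • h) m = mf a (cf h m) (-t - 1) := by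
  rw [UC, cf_single_smul, sub_zero]
  rfl

end Exponential

/-! ### Sequences of vector-valued Laurent series -/

section Sequences

open MvPolynomial (X C aeval)

variable {V : Type*} [AddCommGroup V] [Module ℂ V]

/-- The variable of `ℂ((x))`. -/
def xL : LC := HahnSeries.single 1 1

theorem cf_xL_smul (h : HV V) (m : ℤ) : cf (xL • h) m = cf h (m - 1) := by
  rw [cf_LC_smul, finsum_eq_single _ 1]
  · rw [xL, HahnSeries.coeff_single_same, one_smul]
  · intro n hn
    rw [xL, HahnSeries.coeff_single_of_ne hn, zero_smul]

theorem inv_xL_smul (h : HV V) : (HahnSeries.single (-1) 1 : LC) • xL • h = h := by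
  rw [← mul_smul, xL, HahnSeries.single_mul_single, neg_add_cancel, mul_one]
  exact one_smul LC h

/-- The operator `R ↦ x R + ε y R` on sequences, viewed as series in `y`. -/
def opS (V : Type*) [AddCommGroup V] [Module ℂ V] (ε : LC) :
    (ℤ → HV V) →ₗ[LC] (ℤ → HV V) where
  toFun R t := xL • R t + ε • R (t - 1)
  map_add' R S := by
    funext t
    simp only [Pi.add_apply, smul_add]
    abel
  map_smul' f R := by
    funext t
    simp only [Pi.smul_apply, smul_add, RingHom.id_apply, smul_comm f]

theorem opS_apply (ε : LC) (R : ℤ → HV V) (t : ℤ) :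
    opS V ε R t = xL • R t + ε • R (t - 1) := rfl

theorem opS_mem {ε : LC} {M : Submodule LC (HV V)} {R : ℤ → HV V} (hR : ∀ t, R t ∈ M) (l : ℕ) :
    ∀ t, ((opS V ε) ^ l) R t ∈ M := by
  induction l with
  | zero => exact hR
  | succ l ih =>
    intro t
    rw [pow_succ', Module.End.mul_apply, opS_apply]
    exact M.add_mem (M.smul_mem _ (ih _)) (M.smul_mem _ (ih _))

theorem opS_trunc {ε : LC} {T : ℤ} {R : ℤ → HV V} (hR : ∀ t < T, R t = 0) (l : ℕ) :
    ∀ t < T, ((opS V ε) ^ l) R t = 0 := by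
  induction l with
  | zero => exact hR
  | succ l ih =>
    intro t ht
    rw [pow_succ', Module.End.mul_apply, opS_apply, ih t ht, ih _ (by omega), smul_zero, smul_zero,
      add_zero]

theorem mem_of_opS_pow {ε : LC} {M : Submodule LC (HV V)} {T : ℤ} (l : ℕ) {R : ℤ → HV V}
    (hT : ∀ t < T, R t = 0) (h : ∀ t, ((opS V ε) ^ l) R t ∈ M) (t : ℤ) : R t ∈ M := by
  induction l generalizing R t with
  | zero => exact h t
  | succ l ih =>
    rw [pow_succ] at h
    have h1 : ∀ t, opS V ε R t ∈ M := ih (R := opS V ε R) (opS_trunc (l := 1) hT) h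
    have key : ∀ n : ℕ, R (T - 1 + n) ∈ M := by
      intro n
      induction n with
      | zero => rw [hT _ (by push_cast; omega)]; exact M.zero_mem
      | succ n ihn =>
        have h2 := M.sub_mem (h1 (T - 1 + (n + 1 : ℕ))) (M.smul_mem ε ihn)
        rw [opS_apply, show T - 1 + ((n + 1 : ℕ) : ℤ) - 1 = T - 1 + n by push_cast; ring,
          add_sub_cancel_right] at h2
        rw [← inv_xL_smul (R _)]
        exact M.smul_mem _ h2
    rcases lt_or_ge t T with h2 | h2
    · rw [hT t h2]; exact M.zero_mem
    · have := key (t - (T - 1)).toNat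
      rwa [show T - 1 + ((t - (T - 1)).toNat : ℤ) = t by omega] at this

theorem neg1_xL : neg1 xL = -xL := by
  ext n
  rw [neg1_coeff, HahnSeries.coeff_neg, xL, HahnSeries.coeff_single]
  split_ifs with h
  · subst h; norm_num
  · simp

theorem neg1_one : neg1 (1 : LC) = 1 := by
  ext n
  rw [neg1_coeff, HahnSeries.coeff_one]
  split_ifs with h
  · subst h; norm_num
  · simp

theorem neg1_neg (f : LC) : neg1 (-f) = -neg1 f := by
  ext n
  rw [neg1_coeff, HahnSeries.coeff_neg, HahnSeries.coeff_neg, neg1_coeff, smul_neg]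

theorem sig_opS (L : Module.End ℂ V) {ε : LC} (hε : neg1 ε = ε) (R : ℤ → HV V) :
    (fun t => sig L (opS V ε R t)) = -opS V (-ε) (fun t => sig L (R t)) := by
  funext t
  rw [opS_apply, sig_add, sig_smul, sig_smul, hε, neg1_xL, Pi.neg_apply, opS_apply, neg_add,
    neg_smul, neg_smul, neg_neg]

theorem neg_one_pow_smul_neg (R : Type*) {M : Type*} [Ring R] [AddCommGroup M] [Module R M] (l : ℕ)
    (x : M) : (-1 : R) ^ l • -x = (-1 : R) ^ (l + 1) • x := by
  rw [pow_succ, mul_neg_one, neg_smul, smul_neg]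

theorem sig_opS_pow (L : Module.End ℂ V) {ε : LC} (hε : neg1 ε = ε) (l : ℕ) (R : ℤ → HV V) :
    (fun t => sig L (((opS V ε) ^ l) R t)) =
      (-1 : LC) ^ l • ((opS V (-ε)) ^ l) (fun t => sig L (R t)) := by
  induction l generalizing R with
  | zero => simp
  | succ l ih =>
    rw [pow_succ, Module.End.mul_apply, ih, sig_opS L hε, pow_succ (opS V (-ε)),
      Module.End.mul_apply, map_neg]
    exact neg_one_pow_smul_neg LC l _

/-- The two-variable family of a sequence, indexed by the position first. -/
def fm (R : ℤ → HV V) : ℤ × ℤ → V := fun k => cf (R k.1) k.2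

/-- The two-variable family of a sequence, indexed by the position second. -/
def fs (R : ℤ → HV V) : ℤ × ℤ → V := fun k => cf (R k.2) k.1

theorem fm_inj {R S : ℤ → HV V} (h : fm R = fm S) : R = S :=
  funext fun t => cf_ext fun m => congrFun h (t, m)

theorem fs_inj {R S : ℤ → HV V} (h : fs R = fs S) : R = S :=
  funext fun t => cf_ext fun m => congrFun h (m, t)

theorem act_add_fm (l : ℕ) (R : ℤ → HV V) :
    act V e2 ((X 0 + X 1) ^ l) (fm R) = fm (((opS V 1) ^ l) R) := by
  induction l generalizing R with
  | zero => simp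
  | succ l ih =>
    rw [pow_succ, act_mul, pow_succ, Module.End.mul_apply, ← ih]
    congr 1
    funext k
    rw [act_add, Pi.add_apply, act_X, act_X, fm, fm, fm, opS_apply, cf_add, cf_xL_smul, one_smul,
      add_comm]
    simp [e2]

theorem act_dl_fs (l : ℕ) (R : ℤ → HV V) :
    act V e2 (dl ^ l) (fs R) = fs (((opS V (-1)) ^ l) R) := by
  induction l generalizing R with
  | zero => simp
  | succ l ih =>
    rw [pow_succ, act_mul, pow_succ, Module.End.mul_apply, ← ih]
    congr 1
    funext k
    rw [dl, act_sub, Pi.sub_apply, act_X, act_X, fs, fs, fs, opS_apply, cf_add, cf_xL_smul,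
      neg_one_smul, sub_eq_add_neg]
    simp [e2]
    rfl

theorem act_dl_fm (l : ℕ) (R : ℤ → HV V) :
    act V e2 (dl ^ l) (fm R) = fm ((-1 : LC) ^ l • ((opS V (-1)) ^ l) R) := by
  induction l generalizing R with
  | zero => simp
  | succ l ih =>
    have : act V e2 dl (fm R) = fm (-(opS V (-1) R)) := by
      funext k
      rw [dl, act_sub, Pi.sub_apply, act_X, act_X, fm, fm, fm, Pi.neg_apply, opS_apply,
        neg_one_smul, ← sub_eq_add_neg, neg_sub, cf_sub, cf_xL_smul]
      simp [e2]
    rw [pow_succ, act_mul, pow_succ (opS V (-1)), Module.End.mul_apply, this, ih, map_neg]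
    exact congrArg fm (neg_one_pow_smul_neg LC l _)

/-- Assembling finitely many shifted members of a sequence with power series coefficients. -/
theorem exists_row_sum {c : ℤ → ℤ → ℂ} (hc : ∀ s t, (s < 0 ∨ t < 0) → c s t = 0)
    {M : Submodule LC (HV V)} {T : ℤ} {R : ℤ → HV V} (hT : ∀ t < T, R t = 0)
    (hR : ∀ t, R t ∈ M) :
    ∃ r : ℤ → HV V, (∀ t, r t ∈ M) ∧ ∀ t m, cf (r t) m =
      ∑ᶠ s : ℤ × ℤ, c s.1 s.2 • cf (R (t - s.1)) (m - s.2) := by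
  let row : ℤ → LC := fun s => HahnSeries.ofSuppBddBelow (c s)
    ⟨0, fun t ht => not_lt.mp fun h => ht (hc s t (Or.inr h))⟩
  refine ⟨fun t => ∑ s ∈ Finset.Icc 0 (t - T), row s • R (t - s),
    fun t => M.sum_mem fun s _ => M.smul_mem _ (hR _), fun t m => ?_⟩
  rw [cf_sum]
  choose N hN using fun s => cf_trunc (R (t - s))
  have hfin : (Function.support fun s : ℤ × ℤ =>
      c s.1 s.2 • cf (R (t - s.1)) (m - s.2)).Finite := by
    refine ((Set.finite_Icc 0 (t - T)).biUnion fun s _ =>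
      (Set.finite_Icc 0 (m - N s)).image (Prod.mk s)).subset ?_
    rintro ⟨s1, s2⟩ hs
    have h1 : 0 ≤ s1 ∧ 0 ≤ s2 := by
      by_contra h
      exact hs (by simp only [hc s1 s2 (by omega), zero_smul])
    have h2 : T ≤ t - s1 := by
      by_contra h
      exact hs (by simp only [hT (t - s1) (by omega), cf_zero, smul_zero])
    have h3 : N s1 ≤ m - s2 := by
      by_contra h
      exact hs (by simp only [hN s1 (m - s2) (by omega), smul_zero])
    exact Set.mem_biUnion (x := s1) ⟨h1.1, by omega⟩ ⟨s2, ⟨h1.2, by omega⟩, rfl⟩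
  rw [finsum_curry _ hfin, finsum_eq_sum_of_support_subset (s := Finset.Icc 0 (t - T))]
  · exact Finset.sum_congr rfl fun s _ => cf_LC_smul _ _ _
  · intro s hs
    rw [Finset.coe_Icc]
    by_contra h
    refine hs ((finsum_congr fun j => ?_).trans finsum_zero)
    rcases lt_or_ge s 0 with h1 | h1
    · simp only [hc s j (Or.inl h1), zero_smul]
    · simp only [hT (t - s) (by simp only [Set.mem_Icc] at h; omega), cf_zero, smul_zero]

end Sequences

/-! ### Multiplication by expanded Laurent series -/

section SmulFam

open MvPolynomial (X C aeval)

variable {V : Type*} [AddCommGroup V] [Module ℂ V]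

/-- `smulFam` on families indexed by pairs. -/
def smf (c : ℤ → ℤ → ℂ) (G : ℤ × ℤ → V) : ℤ × ℤ → V :=
  fun k => smulFam c (fun m t => G (m, t)) k.1 k.2

theorem smf_apply (c : ℤ → ℤ → ℂ) (G : ℤ × ℤ → V) (k : ℤ × ℤ) :
    smf c G k = ∑ᶠ s : ℤ × ℤ, c s.1 s.2 • G (k - s) := rfl

/-- Families which are lower truncated in the first variable, and in the second one for each fixed
first exponent. -/
def TrP (G : ℤ × ℤ → V) : Prop :=
  (∃ N : ℤ, ∀ k : ℤ × ℤ, k.1 < N → G k = 0) ∧ ∀ m, ∃ M : ℤ, ∀ t < M, G (m, t) = 0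

theorem TrP.add {F G : ℤ × ℤ → V} (hF : TrP F) (hG : TrP G) : TrP (F + G) := by
  obtain ⟨⟨N, hN⟩, hF⟩ := hF
  obtain ⟨⟨N', hN'⟩, hG⟩ := hG
  refine ⟨⟨min N N', fun k hk => ?_⟩, fun m => ?_⟩
  · rw [Pi.add_apply, hN k (by omega), hN' k (by omega), add_zero]
  · obtain ⟨M, hM⟩ := hF m
    obtain ⟨M', hM'⟩ := hG m
    refine ⟨min M M', fun t ht => ?_⟩
    rw [Pi.add_apply, hM t (by omega), hM' t (by omega), add_zero]

theorem TrP.smul (c : ℂ) {F : ℤ × ℤ → V} (hF : TrP F) : TrP (c • F) := by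
  obtain ⟨⟨N, hN⟩, hF⟩ := hF
  refine ⟨⟨N, fun k hk => ?_⟩, fun m => ?_⟩
  · rw [Pi.smul_apply, hN k hk, smul_zero]
  · obtain ⟨M, hM⟩ := hF m
    exact ⟨M, fun t ht => by rw [Pi.smul_apply, hM t ht, smul_zero]⟩

theorem TrP.shift (e : ℤ × ℤ) {F : ℤ × ℤ → V} (hF : TrP F) : TrP fun k => F (k - e) := by
  obtain ⟨⟨N, hN⟩, hF⟩ := hF
  refine ⟨⟨N + e.1, fun k hk => hN _ (by rw [Prod.fst_sub]; omega)⟩, fun m => ?_⟩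
  obtain ⟨M, hM⟩ := hF (m - e.1)
  exact ⟨M + e.2, fun t ht => hM _ (by omega)⟩

theorem Laur2.trP {G : ℤ × ℤ → V} (h : Laur2 G) : TrP G := by
  obtain ⟨N, hN⟩ := h
  exact ⟨⟨N, fun k hk => hN k (Or.inl hk)⟩, fun m => ⟨N, fun t ht => hN _ (Or.inr ht)⟩⟩

/-- Coefficient families supported where the first exponent and the total degree are bounded
below. -/
def SupC (c : ℤ → ℤ → ℂ) : Prop :=
  (∀ s t, s < 0 → c s t = 0) ∧ ∃ B : ℤ, ∀ s t, s + t < B → c s t = 0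

theorem smf_finite {c : ℤ → ℤ → ℂ} (hc : SupC c) {G : ℤ × ℤ → V} (hG : TrP G) (k : ℤ × ℤ) :
    (Function.support fun s : ℤ × ℤ => c s.1 s.2 • G (k - s)).Finite := by
  obtain ⟨hc0, B, hB⟩ := hc
  obtain ⟨⟨N, hN⟩, hG⟩ := hG
  choose M hM using hG
  refine ((Set.finite_Icc 0 (k.1 - N)).biUnion fun s _ =>
    (Set.finite_Icc (B - s) (k.2 - M (k.1 - s))).image (Prod.mk s)).subset ?_
  rintro ⟨s1, s2⟩ hs
  have h1 : 0 ≤ s1 := by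
    by_contra h
    exact hs (by simp only [hc0 s1 s2 (by omega), zero_smul])
  have h2 : B ≤ s1 + s2 := by
    by_contra h
    exact hs (by simp only [hB s1 s2 (by omega), zero_smul])
  have h3 : N ≤ k.1 - s1 := by
    by_contra h
    exact hs (by simp only [hN (k - (s1, s2)) (by rw [Prod.fst_sub]; omega), smul_zero])
  have h4 : M (k.1 - s1) ≤ k.2 - s2 := by
    by_contra h
    refine hs ?_
    have := hM (k.1 - s1) (k.2 - s2) (by omega)
    change c s1 s2 • G (k.1 - s1, k.2 - s2) = 0
    rw [this, smul_zero]
  exact Set.mem_biUnion (x := s1) ⟨h1, by omega⟩ ⟨s2, ⟨by omega, by omega⟩, rfl⟩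

theorem smf_add {c : ℤ → ℤ → ℂ} (hc : SupC c) {F G : ℤ × ℤ → V} (hF : TrP F) (hG : TrP G) :
    smf c (F + G) = smf c F + smf c G := by
  funext k
  rw [Pi.add_apply, smf_apply, smf_apply, smf_apply,
    ← finsum_add_distrib (smf_finite hc hF k) (smf_finite hc hG k)]
  exact finsum_congr fun s => smul_add _ _ _

theorem smf_smul (c : ℤ → ℤ → ℂ) (a : ℂ) (F : ℤ × ℤ → V) : smf c (a • F) = a • smf c F := by
  funext k
  rw [Pi.smul_apply, smf_apply, smf_apply, smul_finsum]
  exact finsum_congr fun s => smul_comm _ _ _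

theorem act_X_eq (j : Fin 2) (F : ℤ × ℤ → V) : act V e2 (X j) F = fun k => F (k - e2 j) :=
  funext fun k => act_X e2 j F k

theorem smf_X (c : ℤ → ℤ → ℂ) (j : Fin 2) (F : ℤ × ℤ → V) :
    smf c (act V e2 (X j) F) = act V e2 (X j) (smf c F) := by
  rw [act_X_eq, act_X_eq]
  funext k
  rw [smf_apply, smf_apply]
  refine finsum_congr fun s => ?_
  rw [sub_right_comm]

theorem smf_act_aux {c : ℤ → ℤ → ℂ} (hc : SupC c) (P : MvPolynomial (Fin 2) ℂ) (F : ℤ × ℤ → V)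
    (hF : TrP F) : TrP (act V e2 P F) ∧ smf c (act V e2 P F) = act V e2 (aeval X P) (smf c F) :=
  act_intertwine TrP (smf c) X (fun _ _ => TrP.add) (fun a _ => TrP.smul a)
    (fun j F hF => by rw [act_X_eq]; exact hF.shift _) (fun _ _ => smf_add hc)
    (fun a F _ => smf_smul c a F) (fun j F _ => smf_X c j F) P F hF

theorem smf_act {c : ℤ → ℤ → ℂ} (hc : SupC c) (P : MvPolynomial (Fin 2) ℂ) {F : ℤ × ℤ → V}
    (hF : TrP F) : smf c (act V e2 P F) = act V e2 P (smf c F) := by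
  have := (smf_act_aux hc P F hF).2
  rwa [MvPolynomial.aeval_X_left_apply] at this

theorem expandSub_eq (f : LC) (m t : ℤ) :
    expandSub f m t = ((-1 : ℂ) ^ m * ch (t + m) m) * f.coeff (t + m) := by
  rw [expandSub]
  split_ifs with h
  · lift m to ℕ using h
    rw [ch, if_neg (by omega), Int.toNat_natCast, zpow_natCast]
  · rw [ch_neg (by omega), mul_zero, zero_mul]

theorem supC_expandSub (f : LC) : SupC (expandSub f) := by
  refine ⟨fun s t h => if_neg (by omega), f.order, fun s t h => ?_⟩
  rw [expandSub_eq, HahnSeries.coeff_eq_zero_of_lt_order (by omega), mul_zero]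

theorem expandSub_xL_mul (f : LC) (m t : ℤ) :
    expandSub (xL * f) m t = expandSub f m (t - 1) - expandSub f (m - 1) t := by
  have h := ch_succ (t + m - 1) m
  rw [expandSub_eq, expandSub_eq, expandSub_eq, xL, HahnSeries.coeff_single_mul, one_mul,
    zpow_sub₀ (by norm_num : (-1 : ℂ) ≠ 0)]
  rw [show t + m - 1 + 1 = t + m by ring] at h
  rw [show t - 1 + m = t + m - 1 by ring, show t + (m - 1) = t + m - 1 by ring, h]
  norm_num
  ring

theorem smf_shift (c : ℤ → ℤ → ℂ) (e : ℤ × ℤ) (G : ℤ × ℤ → V) (k : ℤ × ℤ) :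
    smf (fun m t => c (m - e.1) (t - e.2)) G k = smf c G (k - e) := by
  rw [smf_apply, smf_apply, ← finsum_comp_equiv (Equiv.addRight e)]
  refine finsum_congr fun s => ?_
  simp only [Equiv.coe_addRight, Prod.fst_add, Prod.snd_add, add_sub_cancel_right]
  congr 2
  abel

theorem SupC.shift {c : ℤ → ℤ → ℂ} (hc : SupC c) {a b : ℤ} (ha : 0 ≤ a) :
    SupC fun m t => c (m - a) (t - b) := by
  obtain ⟨h0, B, hB⟩ := hc
  exact ⟨fun s t h => h0 _ _ (by omega), B + a + b, fun s t h => hB _ _ (by omega)⟩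

theorem smf_xL_mul (f : LC) {G : ℤ × ℤ → V} (hG : TrP G) :
    smf (expandSub (xL * f)) G = -act V e2 dl (smf (expandSub f) G) := by
  funext k
  have h1 := smf_shift (expandSub f) (0, 1) G k
  have h2 := smf_shift (expandSub f) (1, 0) G k
  rw [Pi.neg_apply, dl, act_sub, Pi.sub_apply, act_X, act_X, neg_sub]
  change _ = smf (expandSub f) G (k - (0, 1)) - smf (expandSub f) G (k - (1, 0))
  rw [← h1, ← h2, smf_apply, smf_apply, smf_apply,
    ← finsum_sub_distrib (smf_finite ((supC_expandSub f).shift (by norm_num)) hG k)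
      (smf_finite ((supC_expandSub f).shift (by norm_num)) hG k)]
  refine finsum_congr fun s => ?_
  rw [← sub_smul, expandSub_xL_mul, sub_zero, sub_zero]

theorem smf_neg_expandSub (f : LC) (G : ℤ × ℤ → V) :
    smf (expandSub (-f)) G = -smf (expandSub f) G := by
  funext k
  rw [Pi.neg_apply, smf_apply, smf_apply, ← finsum_neg_distrib]
  refine finsum_congr fun s => ?_
  rw [expandSub_eq, expandSub_eq, HahnSeries.coeff_neg, mul_neg, neg_smul]

theorem neg_xL_mul (f : LC) : -xL * f = -(xL * f) := by
  have h : -xL = HahnSeries.single 1 (-1) := (map_neg (HahnSeries.single.addMonoidHom 1) 1).symm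
  ext n
  rw [h, HahnSeries.coeff_neg, xL, HahnSeries.coeff_single_mul, HahnSeries.coeff_single_mul,
    one_mul, neg_one_mul]

theorem smf_xL_pow_mul (N : ℕ) (f : LC) {G : ℤ × ℤ → V} (hG : TrP G) :
    act V e2 (dl ^ N) (smf (expandSub f) G) = smf (expandSub ((-xL) ^ N * f)) G := by
  induction N with
  | zero => simp
  | succ N ih =>
    rw [pow_succ', act_mul, ih, pow_succ' (-xL), mul_assoc, neg_xL_mul, smf_neg_expandSub,
      smf_xL_mul _ hG, neg_neg]

/-- Being a power series. -/
def IsPS (f : LC) : Prop := ∀ n < 0, f.coeff n = 0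

theorem coeff_xL_pow_mul (N : ℕ) (f : LC) (n : ℤ) :
    ((-xL) ^ N * f).coeff n = (-1) ^ N * f.coeff (n - N) := by
  induction N generalizing n with
  | zero => simp
  | succ N ih =>
    rw [pow_succ', mul_assoc, neg_xL_mul, HahnSeries.coeff_neg, xL, HahnSeries.coeff_single_mul,
      one_mul, ← xL, ih, pow_succ, mul_neg_one, neg_mul]
    congr 3
    push_cast
    ring

theorem exists_isPS (f : LC) : ∃ N : ℕ, ∀ n ≥ N, IsPS ((-xL) ^ n * f) := by
  refine ⟨(-f.order).toNat, fun n hn m hm => ?_⟩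
  rw [coeff_xL_pow_mul, HahnSeries.coeff_eq_zero_of_lt_order (by omega), mul_zero]

theorem IsPS.expandSub {f : LC} (hf : IsPS f) (s t : ℤ) (h : s < 0 ∨ t < 0) :
    expandSub f s t = 0 := by
  rw [expandSub_eq]
  rcases lt_or_ge (t + s) 0 with h1 | h1
  · rw [hf _ h1, mul_zero]
  · rcases h with h | h
    · rw [ch_neg h, mul_zero, zero_mul]
    · rw [ch_of_lt h1 (by omega), mul_zero, zero_mul]

/-- A common denominator: multiplication by a high power of `x₁ - x₂`. -/
theorem dl_pow_smf (N l : ℕ) (f : LC) {G : ℤ × ℤ → V} (hG : TrP G) :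
    act V e2 (dl ^ (N + l)) (smf (expandSub f) G) =
      smf (expandSub ((-xL) ^ N * f)) (act V e2 (dl ^ l) G) := by
  rw [smf_act (supC_expandSub _) _ hG, pow_add, mul_comm, act_mul, smf_xL_pow_mul N f hG]

end SmulFam

/-! ### State-field correspondence as a bilinear map to `V((x))` -/

section StateSeries

open MvPolynomial (X C aeval)

variable {V : Type*} [AddCommGroup V] [Module ℂ V]
variable {one : V} {L : V →ₗ[ℂ] V} {ψ : V →ₗ[ℂ] EW V}

/-- The series `ψ(u, x) v`. -/
def yv (ψ : V →ₗ[ℂ] EW V) (u v : V) : HV V :=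
  mkH (fun m => mf (ψ u) v (-m - 1)) (by
    obtain ⟨N, hN⟩ := mf_trunc (ψ u) v
    exact ⟨-N, fun m hm => hN _ (by omega)⟩)

theorem cf_yv (u v : V) (m : ℤ) : cf (yv ψ u v) m = mf (ψ u) v (-m - 1) := rfl

theorem cf_C_smul (c : ℂ) (h : HV V) (m : ℤ) : cf ((HahnSeries.C c : LC) • h) m = c • cf h m := by
  rw [cf_LC_smul, finsum_eq_single _ 0]
  · rw [sub_zero, HahnSeries.C_apply, HahnSeries.coeff_single_same]
  · intro n hn
    rw [HahnSeries.C_apply, HahnSeries.coeff_single_of_ne hn, zero_smul]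

theorem yv_add_left (u u' v : V) : yv ψ (u + u') v = yv ψ u v + yv ψ u' v :=
  cf_ext fun m => by rw [cf_add, cf_yv, cf_yv, cf_yv, map_add, add_mf]

theorem yv_smul_left (c : ℂ) (u v : V) : yv ψ (c • u) v = (HahnSeries.C c : LC) • yv ψ u v :=
  cf_ext fun m => by rw [cf_C_smul, cf_yv, cf_yv, map_smul, smul_mf]

theorem yv_zero_left (v : V) : yv ψ 0 v = 0 :=
  cf_ext fun m => by rw [cf_zero, cf_yv, map_zero, zero_mf]

theorem yv_add_right (u v v' : V) : yv ψ u (v + v') = yv ψ u v + yv ψ u v' :=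
  cf_ext fun m => by rw [cf_add, cf_yv, cf_yv, cf_yv, mf_add]

theorem yv_smul_right (c : ℂ) (u v : V) : yv ψ u (c • v) = (HahnSeries.C c : LC) • yv ψ u v :=
  cf_ext fun m => by rw [cf_C_smul, cf_yv, cf_yv, mf_smul]

theorem yv_zero_right (u : V) : yv ψ u 0 = 0 :=
  cf_ext fun m => by rw [cf_zero, cf_yv, mf_zero]

theorem fm_UC_yv (a : EW V) (u w : V) : fm (fun t => UC a t • yv ψ u w) = Fu a (ψ u) w :=
  funext fun _ => cf_UC_smul _ _ _ _

theorem fs_UC_yv (a : EW V) (u w : V) :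
    fs (fun t => UC a t • yv ψ u w) = fun k => Fu a (ψ u) w (k.2, k.1) :=
  funext fun _ => cf_UC_smul _ _ _ _

theorem fm_EA_yv (a : EW V) (v w : V) : fm (fun t => EA a t • yv ψ v w) = Eop (Fu a (ψ v) w) := by
  funext k
  rw [fm, cf_smul, Eop]
  refine Eq.trans (finsum_congr fun n => ?_) (finsum_comp_equiv (Equiv.addLeft k.1))
  simp only [Equiv.coe_addLeft, add_sub_cancel_left]
  rfl

theorem SF.weak_assoc_opS (h : SF one L ψ) (u v w : V) : ∃ l₀ : ℕ, ∀ l ≥ l₀,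
    (opS V 1 ^ l) (fun t => EA (ψ u) t • yv ψ v w) =
      (opS V 1 ^ l) (fun t => yv ψ (mf (ψ u) v (-t - 1)) w) := by
  obtain ⟨l, hl⟩ := h.weak_assoc u v w
  refine ⟨l, fun l' hl' => fm_inj ?_⟩
  rw [← act_add_fm, ← act_add_fm, fm_EA_yv]
  exact add_pow_act_eq hl' hl

theorem neg_one_pow_smul_inj {R M : Type*} [Ring R] [AddCommGroup M] [Module R M] (l : ℕ)
    {x y : M} (h : (-1 : R) ^ l • x = (-1 : R) ^ l • y) : x = y := by
  rcases neg_one_pow_eq_or R l with h1 | h1 <;> rw [h1] at h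
  · rwa [one_smul, one_smul] at h
  · rwa [neg_one_smul, neg_one_smul, neg_inj] at h

theorem SF.skew_assoc_opS (h : SF one L ψ) (u v w : V) : ∃ l₀ : ℕ, ∀ l ≥ l₀,
    (opS V (-1) ^ l) (fun t => UC (ψ u) t • sig L (yv ψ v w)) =
      (opS V (-1) ^ l) (fun t => sig L (yv ψ (mf (ψ u) v (-t - 1)) w)) := by
  obtain ⟨l₀, hl⟩ := h.weak_assoc_opS u v w
  refine ⟨l₀, fun l hl' => ?_⟩
  have h1 := congrArg (fun R : ℤ → HV V => fun t => sig L (R t)) (hl l hl')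
  simp only [sig_opS_pow L neg1_one] at h1
  have h2 := neg_one_pow_smul_inj l h1
  simp only [UC_smul_sig (h.dbr u)]
  exact h2

theorem sig_zero (L : Module.End ℂ V) : sig L (0 : HV V) = 0 := by
  have h := sig_add L (0 : HV V) 0
  rw [add_zero] at h
  exact left_eq_add.mp h

theorem yv_mf_trunc (a : EW V) (v w : V) : ∃ T : ℤ, ∀ t < T, yv ψ (mf a v (-t - 1)) w = 0 := by
  obtain ⟨N, hN⟩ := mf_trunc a v
  exact ⟨-N, fun t ht => by rw [hN _ (by omega), yv_zero_left]⟩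

theorem yv_mf_trunc_right (u : V) (a : EW V) (v : V) :
    ∃ T : ℤ, ∀ t < T, yv ψ u (mf a v (-t - 1)) = 0 := by
  obtain ⟨N, hN⟩ := mf_trunc a v
  exact ⟨-N, fun t ht => by rw [hN _ (by omega), yv_zero_right]⟩

/-- The `ℂ((x))`-span of the series `ψ(u, x) v`. -/
def spY (ψ : V →ₗ[ℂ] EW V) : Submodule LC (HV V) :=
  Submodule.span LC (Set.range fun p : V × V => yv ψ p.1 p.2)

/-- The `ℂ((x))`-span of the series `e^{xL} ψ(u, -x) v`. -/
def spS (L : V →ₗ[ℂ] V) (ψ : V →ₗ[ℂ] EW V) : Submodule LC (HV V) :=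
  Submodule.span LC (Set.range fun p : V × V => sig L (yv ψ p.1 p.2))

theorem yv_mem_spY (u v : V) : yv ψ u v ∈ spY ψ := Submodule.subset_span ⟨(u, v), rfl⟩

theorem sig_yv_mem_spS (u v : V) : sig L (yv ψ u v) ∈ spS L ψ := Submodule.subset_span ⟨(u, v), rfl⟩

theorem sig_mem_spS {h : HV V} (hh : h ∈ spY ψ) : sig L h ∈ spS L ψ := by
  induction hh using Submodule.span_induction with
  | mem x hx => obtain ⟨p, rfl⟩ := hx; exact sig_yv_mem_spS _ _
  | zero => rw [sig_zero]; exact Submodule.zero_mem _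
  | add x y _ _ hx hy => rw [sig_add]; exact Submodule.add_mem _ hx hy
  | smul f x _ hx => rw [sig_smul]; exact Submodule.smul_mem _ _ hx

end StateSeries

/-! ### Locality and membership in spans -/

section LocMem

open MvPolynomial (X C aeval)

variable {V : Type*} [AddCommGroup V] [Module ℂ V]
variable {one : V} {L : V →ₗ[ℂ] V} {ψ : V →ₗ[ℂ] EW V}

theorem fs_sum {r : ℕ} (R : Fin r → ℤ → HV V) : fs (∑ i, R i) = ∑ i, fs (R i) := by
  funext k
  rw [fs, Finset.sum_apply, cf_sum, Finset.sum_apply]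
  rfl

theorem fm_sum {r : ℕ} (R : Fin r → ℤ → HV V) : fm (∑ i, R i) = ∑ i, fm (R i) := by
  funext k
  rw [fm, Finset.sum_apply, cf_sum, Finset.sum_apply]
  rfl

theorem exists_smf_fm {f : LC} (hf : IsPS f) {M : Submodule LC (HV V)} {T : ℤ} {R : ℤ → HV V}
    (hT : ∀ t < T, R t = 0) (hR : ∀ t, R t ∈ M) :
    ∃ r : ℤ → HV V, (∀ t, r t ∈ M) ∧ smf (expandSub f) (fm R) = fm r := by
  obtain ⟨r, hr, h⟩ := exists_row_sum hf.expandSub hT hR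
  exact ⟨r, hr, funext fun k => (h k.1 k.2).symm⟩

theorem exists_smf_fs {f : LC} (hf : IsPS f) {M : Submodule LC (HV V)} {T : ℤ} {R : ℤ → HV V}
    (hT : ∀ t < T, R t = 0) (hR : ∀ t, R t ∈ M) :
    ∃ r : ℤ → HV V, (∀ t, r t ∈ M) ∧ smf (expandSub f) (fs R) = fs r := by
  obtain ⟨r, hr, h⟩ := exists_row_sum (c := fun s t => expandSub f t s)
    (fun s t h => hf.expandSub t s h.symm) hT hR
  exact ⟨r, hr, funext fun k => Eq.trans
    (finsum_comp_equiv (Equiv.prodComm ℤ ℤ)).symm (h k.2 k.1).symm⟩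

/-- Multiplying a locality relation by a high power of `x₁ - x₂` makes the coefficients power
series. -/
theorem loc_clear {r k : ℕ} {f : Fin r → LC} {F : ℤ × ℤ → V} {G : Fin r → ℤ × ℤ → V}
    (hG : ∀ i, TrP (G i))
    (h : act V e2 (dl ^ k) F = ∑ i, act V e2 (dl ^ k) (smf (expandSub (f i)) (G i))) :
    ∃ (N : ℕ), ∀ n ≥ N, ∃ p : Fin r → LC, (∀ i, IsPS (p i)) ∧ ∀ l : ℕ,
      act V e2 (dl ^ (k + n + l)) F =
        ∑ i, act V e2 (dl ^ k) (smf (expandSub (p i)) (act V e2 (dl ^ l) (G i))) := by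
  choose N hN using fun i => exists_isPS (f i)
  refine ⟨Finset.univ.sup N, fun n hn => ⟨fun i => (-xL) ^ n * f i, fun i =>
    hN i n ((Finset.le_sup (Finset.mem_univ i)).trans hn), fun l => ?_⟩⟩
  rw [add_assoc, pow_add, mul_comm, act_mul, h, map_sum]
  refine Finset.sum_congr rfl fun i _ => ?_
  rw [← dl_pow_smf n l _ (hG i), ← act_mul, ← act_mul, mul_comm]

theorem mem_of_loc_fs {M : Submodule LC (HV V)} {r k : ℕ} {f : Fin r → LC} {P : ℤ → HV V}
    {B : Fin r → ℤ → HV V} (hTr : ∀ i, TrP (fs (B i))) {T : ℤ} (hP : ∀ t < T, P t = 0)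
    (hB : ∀ i, ∃ l₀ : ℕ, ∀ l ≥ l₀, (∀ t, (opS V (-1) ^ l) (B i) t ∈ M) ∧
      ∃ T : ℤ, ∀ t < T, (opS V (-1) ^ l) (B i) t = 0)
    (h : act V e2 (dl ^ k) (fs P) = ∑ i, act V e2 (dl ^ k) (smf (expandSub (f i)) (fs (B i))))
    (t : ℤ) : P t ∈ M := by
  obtain ⟨N, hN⟩ := loc_clear hTr h
  obtain ⟨p, hp, hl⟩ := hN N le_rfl
  choose l₀ hl₀ using hB
  have hB' := fun i => hl₀ i (Finset.univ.sup l₀) (Finset.le_sup (Finset.mem_univ i))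
  have hl := hl (Finset.univ.sup l₀)
  generalize Finset.univ.sup l₀ = l at hB' hl
  have key : ∀ i, ∃ r : ℤ → HV V, (∀ t, r t ∈ M) ∧
      smf (expandSub (p i)) (fs ((opS V (-1) ^ l) (B i))) = fs r := fun i => by
    obtain ⟨hm, T, hT⟩ := hB' i
    exact exists_smf_fs (hp i) hT hm
  choose R hR hRe using key
  simp only [act_dl_fs, hRe] at hl
  rw [← fs_sum, ← map_sum] at hl
  refine mem_of_opS_pow (ε := -1) (k + N + l) hP (fun t => ?_) t
  rw [fs_inj hl]
  refine opS_mem (fun t => ?_) k t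
  rw [Finset.sum_apply]
  exact M.sum_mem fun i _ => hR i t

theorem mem_of_loc_fm {M : Submodule LC (HV V)} {r k : ℕ} {f : Fin r → LC} {P : ℤ → HV V}
    {B : Fin r → ℤ → HV V} (hTr : ∀ i, ∃ T : ℤ, ∀ t < T, B i t = 0) (hB : ∀ i t, B i t ∈ M)
    (h : act V e2 (dl ^ k) (fm P) = ∑ i, act V e2 (dl ^ k) (smf (expandSub (f i)) (fm (B i)))) :
    ∃ N : ℕ, ∀ n ≥ N, ∀ t, (opS V (-1) ^ n) P t ∈ M := by
  have hG : ∀ i, TrP (fm (B i)) := fun i => by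
    obtain ⟨T, hT⟩ := hTr i
    exact ⟨⟨T, fun k hk => by rw [fm, hT _ hk, cf_zero]⟩, fun m => cf_trunc (B i m)⟩
  obtain ⟨N, hN⟩ := loc_clear hG h
  refine ⟨k + N, fun n hn t => ?_⟩
  obtain ⟨p, hp, hl⟩ := hN (n - k) (by omega)
  have hl := hl 0
  have key : ∀ i, ∃ r : ℤ → HV V, (∀ t, r t ∈ M) ∧
      smf (expandSub (p i)) (fm (B i)) = fm r := fun i => by
    obtain ⟨T, hT⟩ := hTr i
    exact exists_smf_fm (hp i) hT (hB i)
  choose R hR hRe using key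
  simp only [pow_zero, act_one, hRe] at hl
  simp only [act_dl_fm] at hl
  rw [← fm_sum, ← Finset.smul_sum, ← map_sum, add_zero, show k + (n - k) = n by omega] at hl
  have h1 := congrFun (fm_inj hl) t
  have h2 : ((-1 : LC) ^ k • (opS V (-1) ^ k) (∑ i, R i)) t ∈ M :=
    M.smul_mem _ (opS_mem (fun t => by
      rw [Finset.sum_apply]
      exact M.sum_mem fun i _ => hR i t) k t)
  rw [← h1, Pi.smul_apply] at h2
  have h3 := M.smul_mem ((-1 : LC) ^ n) h2
  rcases neg_one_pow_eq_or LC n with h4 | h4 <;> rw [h4] at h3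
  · rwa [one_smul, one_smul] at h3
  · rwa [neg_one_smul, neg_one_smul, neg_neg] at h3

/-- `𝒮`-locality of a pair of fields, with the fields on the right labelled by `S`. -/
def LocP (ψ : V →ₗ[ℂ] EW V) (S : Set V) (u v : V) : Prop :=
  ∃ (k r : ℕ) (f : Fin r → LC) (vi ui : Fin r → V), (∀ i, vi i ∈ S) ∧ (∀ i, ui i ∈ S) ∧
    ∀ w, act V e2 (dl ^ k) (Fu (ψ u) (ψ v) w) = ∑ i, act V e2 (dl ^ k)
      (smf (expandSub (f i)) fun p => Fu (ψ (vi i)) (ψ (ui i)) w (p.2, p.1))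

theorem trP_Fu_swap (a b : EW V) (w : V) : TrP fun p : ℤ × ℤ => Fu a b w (p.2, p.1) := by
  refine ⟨?_, fun m => ?_⟩
  · obtain ⟨N, hN⟩ := mf_trunc b w
    refine ⟨-N, fun k hk => ?_⟩
    change mf a (mf b w (-k.1 - 1)) (-k.2 - 1) = 0
    rw [hN _ (by omega), mf_zero]
  · obtain ⟨N, hN⟩ := mf_trunc a (mf b w (-m - 1))
    exact ⟨-N, fun t ht => hN (-t - 1) (by omega)⟩

theorem SF.UC_spS (h : SF one L ψ) (a : V) {x : HV V} (hx : x ∈ spS L ψ) :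
    ∃ l₀ : ℕ, ∀ l ≥ l₀, (∀ t, (opS V (-1) ^ l) (fun t => UC (ψ a) t • x) t ∈ spS L ψ) ∧
      ∃ T : ℤ, ∀ t < T, (opS V (-1) ^ l) (fun t => UC (ψ a) t • x) t = 0 := by
  induction hx using Submodule.span_induction with
  | mem x hx =>
    obtain ⟨p, rfl⟩ := hx
    obtain ⟨l₀, hl⟩ := h.skew_assoc_opS a p.1 p.2
    refine ⟨l₀, fun l hl' => ?_⟩
    rw [hl l hl']
    obtain ⟨T, hT⟩ := yv_mf_trunc (ψ := ψ) (ψ a) p.1 p.2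
    exact ⟨opS_mem (fun t => sig_yv_mem_spS _ _) l, T,
      opS_trunc (fun t ht => by rw [hT t ht, sig_zero]) l⟩
  | zero =>
    refine ⟨0, fun l _ => ?_⟩
    have : (fun t => UC (ψ a) t • (0 : HV V)) = 0 := funext fun t => smul_zero _
    rw [this, map_zero]
    exact ⟨fun t => Submodule.zero_mem _, 0, fun t _ => rfl⟩
  | add x y _ _ hx hy =>
    obtain ⟨l₁, h1⟩ := hx
    obtain ⟨l₂, h2⟩ := hy
    refine ⟨max l₁ l₂, fun l hl => ?_⟩
    obtain ⟨h1, T1, hT1⟩ := h1 l (by omega)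
    obtain ⟨h2, T2, hT2⟩ := h2 l (by omega)
    have : (fun t => UC (ψ a) t • (x + y)) =
        (fun t => UC (ψ a) t • x) + fun t => UC (ψ a) t • y := funext fun t => smul_add _ _ _
    rw [this, map_add]
    exact ⟨fun t => Submodule.add_mem _ (h1 t) (h2 t), min T1 T2, fun t ht => by
      rw [Pi.add_apply, hT1 t (by omega), hT2 t (by omega), add_zero]⟩
  | smul f x _ hx =>
    obtain ⟨l₀, hl⟩ := hx
    refine ⟨l₀, fun l hl' => ?_⟩
    obtain ⟨h1, T, hT⟩ := hl l hl'
    have : (fun t => UC (ψ a) t • f • x) = f • fun t => UC (ψ a) t • x :=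
      funext fun t => EE_smul_LC _ _ _
    rw [this, map_smul]
    exact ⟨fun t => Submodule.smul_mem _ _ (h1 t), T, fun t ht => by
      rw [Pi.smul_apply, hT t ht, smul_zero]⟩

end LocMem

/-! ### Skew symmetry from locality of the generators -/

section Skew

open MvPolynomial (X C aeval)

variable {V : Type*} [AddCommGroup V] [Module ℂ V]
variable {one : V} {L : V →ₗ[ℂ] V} {ψ : V →ₗ[ℂ] EW V}

/-- Applying a locality relation to `ψ(a)_t v`. -/
theorem SF.yv_mf_mem (h : SF one L ψ) {S : Set V} {u a : V} (hloc : LocP ψ S u a) (v : V)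
    (hS : ∀ b ∈ S, yv ψ b v ∈ spS L ψ) (n : ℤ) : yv ψ u (mf (ψ a) v n) ∈ spS L ψ := by
  obtain ⟨k, r, f, vi, ui, -, hui, hl⟩ := hloc
  obtain ⟨T, hT⟩ := yv_mf_trunc_right (ψ := ψ) u (ψ a) v
  have := mem_of_loc_fs (P := fun t => yv ψ u (mf (ψ a) v (-t - 1))) (k := k) (f := f)
    (B := fun i t => UC (ψ (vi i)) t • yv ψ (ui i) v) (M := spS L ψ)
    (fun i => by rw [fs_UC_yv]; exact trP_Fu_swap _ _ _) hT
    (fun i => h.UC_spS _ (hS _ (hui i))) (by simp only [fs_UC_yv]; exact hl v) (-n - 1)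
  simpa using this

theorem SF.creation_dp (h : SF one L ψ) (u : V) (m : ℤ) :
    mf (ψ u) one (-m - 1) = dp L m u := by
  rcases lt_or_ge m 0 with hm | hm
  · rw [h.creation0 u _ (by omega), dp_neg L hm, LinearMap.zero_apply]
  · lift m to ℕ using hm
    induction m with
    | zero =>
      rw [Nat.cast_zero, dp_zero]
      exact h.creation1 u
    | succ m ih =>
      have h1 := h.dbr u one (-(m : ℤ) - 1)
      have h2 := LinearMap.congr_fun (dp_rec L (m + 1)) u
      rw [LinearMap.smul_apply, Module.End.mul_apply, add_sub_cancel_right, ← ih] at h2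
      rw [h.L_one, mf_zero, sub_zero, ← h2] at h1
      push_cast at h1 ⊢
      rw [show -(-(m : ℂ) - 1) = m + 1 by ring] at h1
      rw [show -((m : ℤ) + 1) - 1 = -m - 1 - 1 by ring]
      exact (smul_right_injective V (Nat.cast_add_one_ne_zero m) h1).symm

theorem SF.yv_one_left (h : SF one L ψ) (v : V) (m : ℤ) :
    cf (yv ψ one v) m = if m = 0 then v else 0 := by
  rw [cf_yv, h.one, mf_oneE]
  exact if_congr (by omega) rfl rfl

theorem SF.yv_one_right (h : SF one L ψ) (u : V) : yv ψ u one = sig L (yv ψ one u) := by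
  refine cf_ext fun m => ?_
  rw [cf_yv, h.creation_dp, sig, cf_smul, finsum_eq_single _ m]
  · rw [cf_negH, h.yv_one_left, sub_self, if_pos rfl, zpow_zero, one_smul, EXP_coeff]
  · intro n hn
    rw [cf_negH, h.yv_one_left, if_neg (by omega), smul_zero, map_zero]

theorem SF.yv_mem_spS_of_gen (h : SF one L ψ) {S : Set V}
    (ind : ModeInd one (fun u : S => ψ u))
    (hloc : ∀ u ∈ S, ∀ v ∈ S, LocP ψ S u v) (v : V) : ∀ u ∈ S, yv ψ u v ∈ spS L ψ := by
  refine ind (fun v => ∀ u ∈ S, yv ψ u v ∈ spS L ψ) ?_ ?_ ?_ ?_ ?_ v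
  · intro u _
    rw [yv_zero_right]
    exact Submodule.zero_mem _
  · intro u _
    rw [h.yv_one_right]
    exact sig_yv_mem_spS _ _
  · intro a b ha hb u hu
    rw [yv_add_right]
    exact Submodule.add_mem _ (ha u hu) (hb u hu)
  · intro c a ha u hu
    rw [yv_smul_right]
    exact Submodule.smul_mem _ _ (ha u hu)
  · intro a v n hv u hu
    exact h.yv_mf_mem (hloc u hu a a.2) v hv n

end Skew

/-! ### Substitution, power series coefficients and exchange of variables -/

section Exchange

open MvPolynomial (X C aeval)

variable {V : Type*} [AddCommGroup V] [Module ℂ V]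

theorem ch_neg_sub_one (q : ℤ) (j : ℕ) : ch (-q - 1) j = (-1) ^ j * ch (q + j) j := by
  rw [ch_natCast, ch_natCast, show -q - 1 = -(q + 1) by ring, Ring.choose_neg,
    show q + 1 + (j : ℤ) - 1 = q + j by ring, Units.smul_def, smul_eq_mul, Int.cast_mul,
    Int.cast_negOnePow_natCast]

theorem ch_vandermonde (q m : ℤ) (J : ℕ) :
    ∑ j ∈ Finset.range (J + 1), (-1 : ℂ) ^ (J - j) * (ch (q + j) j * ch m (J - (j : ℕ))) =
      ch (J + q - m) J := by
  have h1 := ch_neg_sub_one (q - m) J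
  have h2 : ch (-(q - m) - 1) J =
      ∑ j ∈ Finset.range (J + 1), ch (-q - 1) j * ch m (J - (j : ℕ)) := by
    rw [show -(q - m) - 1 = -q - 1 + m by ring, ch_natCast,
      Ring.add_choose_eq _ (Commute.all _ _), Int.cast_sum,
      Finset.Nat.sum_antidiagonal_eq_sum_range_succ_mk]
    refine Finset.sum_congr rfl fun j hj => ?_
    have hj := Finset.mem_range.mp hj
    rw [ch_natCast, ← Nat.cast_sub (by omega), ch_natCast, Int.cast_mul]
  have h3 : ((-1 : ℂ) ^ J) * (-1) ^ J = 1 := by rw [← mul_pow]; norm_num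
  have h5 : ch (q - m + J) J = (-1) ^ J * ch (-(q - m) - 1) J := by
    rw [h1, ← mul_assoc, h3, one_mul]
  rw [show (J : ℤ) + q - m = q - m + J by ring, h5, h2, Finset.mul_sum]
  refine Finset.sum_congr rfl fun j hj => ?_
  have hj := Finset.mem_range.mp hj
  rw [ch_neg_sub_one]
  obtain ⟨d, rfl⟩ : ∃ d, J = j + d := ⟨J - j, by omega⟩
  have h4 : ((-1 : ℂ) ^ j) * (-1) ^ j = 1 := by rw [← mul_pow]; norm_num
  rw [Nat.add_sub_cancel_left, pow_add]
  linear_combination (-((-1 : ℂ) ^ d * (ch (q + j) j * ch m (((j + d : ℕ) : ℤ) - j)))) * h4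

theorem Sop_eq_sum {G : ℤ × ℤ → V} {N : ℤ} (hN : ∀ k : ℤ × ℤ, (k.1 < N ∨ k.2 < N) → G k = 0)
    (J q : ℤ) : Sop G (J, q) =
      ∑ m ∈ Finset.Icc N (J + q - N), ch m J • G (m, J + q - m) := by
  rw [Sop, finsum_eq_sum_of_support_subset (s := Finset.Icc N (J + q - N))]
  · exact Finset.sum_congr rfl fun m _ => by rw [show q - m + J = J + q - m by ring]
  · intro m hm
    rw [Finset.coe_Icc]
    by_contra h
    refine hm ?_
    simp only [Set.mem_Icc] at h
    simp only
    rw [hN _ (by simp only; omega), smul_zero]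

theorem Sop_swap {G : ℤ × ℤ → V} (hG : Laur2 G) (J : ℕ) (q : ℤ) :
    ∑ j ∈ Finset.range (J + 1), ((-1 : ℂ) ^ (J - j) * ch (q + j) j) • Sop G (J - j, q + j) =
      Sop (fun k => G (k.2, k.1)) (J, q) := by
  obtain ⟨N, hN⟩ := hG
  rw [Sop_eq_sum (N := N) fun k hk => hN _ hk.symm]
  have h1 : ∀ j ∈ Finset.range (J + 1), ((-1 : ℂ) ^ (J - j) * ch (q + j) j) •
      Sop G (J - j, q + j) = ∑ m ∈ Finset.Icc N (J + q - N),
        ((-1 : ℂ) ^ (J - j) * (ch (q + j) j * ch m (J - (j : ℕ)))) • G (m, J + q - m) := by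
    intro j _
    rw [Sop_eq_sum hN, show (J : ℤ) - j + (q + j) = J + q by ring, Finset.smul_sum]
    exact Finset.sum_congr rfl fun m _ => by rw [smul_smul, mul_assoc]
  rw [Finset.sum_congr rfl h1, Finset.sum_comm]
  refine Finset.sum_nbij' (fun m => J + q - m) (fun m => J + q - m) ?_ ?_ ?_ ?_ ?_
  · intro m hm; rw [Finset.mem_Icc] at *; omega
  · intro m hm; rw [Finset.mem_Icc] at *; omega
  · intro m _; ring
  · intro m _; ring
  · intro m _
    rw [← Finset.sum_smul, ch_vandermonde, sub_sub_cancel]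

theorem Sop_injective_of_nonneg {F : ℤ × ℤ → V} (hF : Laur2 F) (h0 : ∀ k : ℤ × ℤ, k.1 < 0 → F k = 0)
    (h : Sop F = 0) : F = 0 := by
  obtain ⟨N, hN⟩ := hF
  have key : ∀ (D : ℤ) (n : ℕ) (m : ℤ), D - N - n < m → F (m, D - m) = 0 := by
    intro D n
    induction n with
    | zero => exact fun m hm => hN _ (Or.inr (by push_cast at hm; simp only; omega))
    | succ n ih =>
      intro m hm
      rcases lt_or_ge m 0 with h1 | h1
      · exact h0 _ h1
      have h2 := congrFun h (m, D - m)
      rw [Sop, finsum_eq_single _ m] at h2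
      · have h3 := ch_symm h1 0
        rw [sub_zero, ch_zero] at h3
        simp only [h3, one_smul, Pi.zero_apply] at h2
        rw [← h2]
        congr 2
        ring
      · intro m' hm'
        simp only
        rcases lt_or_gt_of_ne hm' with h3 | h3
        · rcases lt_or_ge m' 0 with h4 | h4
          · rw [h0 _ h4, smul_zero]
          · rw [ch_of_lt h4 h3, zero_smul]
        · have := ih m' (by push_cast at hm; omega)
          rw [show D - m - m' + m = D - m' by ring, this, smul_zero]
  funext k
  have := key (k.1 + k.2) (k.2 - N + 1).toNat k.1 (by omega)
  rwa [add_sub_cancel_left] at this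

theorem Sop_injective {G : ℤ × ℤ → V} (hG : Laur2 G) (h : Sop G = 0) : G = 0 := by
  obtain ⟨N, hN⟩ := id hG
  refine X_pow_cancel e2 0 (-N).toNat (Eq.trans ?_ (map_zero _).symm)
  refine Sop_injective_of_nonneg (hG.act _) (fun k hk => ?_) ?_
  · rw [act_X_pow]
    refine hN _ (Or.inl ?_)
    simp [e2]
    omega
  · rw [Sop_act _ hG, h, map_zero]

theorem Sop_inj {F G : ℤ × ℤ → V} (hF : Laur2 F) (hG : Laur2 G) (h : Sop F = Sop G) : F = G := by
  have h1 := Sop_smul (-1) hG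
  have h2 := Sop_add hF (hG.smul (-1))
  rw [h1, h, neg_one_smul, neg_one_smul, add_neg_cancel, ← sub_eq_add_neg] at h2
  refine sub_eq_zero.mp (Sop_injective ?_ h2)
  have := hF.add (hG.smul (-1))
  rwa [neg_one_smul, ← sub_eq_add_neg] at this

theorem Sop_zero : Sop (0 : ℤ × ℤ → V) = 0 := by
  funext k
  rw [Sop]
  simp

theorem Laur2.sum {r : ℕ} {F : Fin r → ℤ × ℤ → V} (hF : ∀ i, Laur2 (F i)) :
    Laur2 (∑ i, F i) ∧ Sop (∑ i, F i) = ∑ i, Sop (F i) := by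
  induction r with
  | zero =>
    simp only [Finset.univ_eq_empty, Finset.sum_empty, Sop_zero, and_true]
    exact ⟨0, fun _ _ => rfl⟩
  | succ r ih =>
    rw [Fin.sum_univ_succ, Fin.sum_univ_succ]
    obtain ⟨h1, h2⟩ := ih fun i => hF i.succ
    exact ⟨(hF 0).add h1, by rw [Sop_add (hF 0) h1, h2]⟩

theorem laur2_smf {c : ℤ → ℤ → ℂ} (hc : ∀ s t, (s < 0 ∨ t < 0) → c s t = 0) {G : ℤ × ℤ → V}
    (hG : Laur2 G) : Laur2 (smf c G) := by
  obtain ⟨N, hN⟩ := hG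
  refine ⟨N, fun k hk => ?_⟩
  rw [smf_apply]
  refine finsum_eq_zero_of_forall_eq_zero fun s => ?_
  by_cases h : s.1 < 0 ∨ s.2 < 0
  · rw [hc _ _ h, zero_smul]
  · rw [hN _ (by rw [Prod.fst_sub, Prod.snd_sub]; omega), smul_zero]

theorem smf_expandSub_add (f g : LC) {G : ℤ × ℤ → V} (hG : TrP G) :
    smf (expandSub (f + g)) G = smf (expandSub f) G + smf (expandSub g) G := by
  funext k
  rw [Pi.add_apply, smf_apply, smf_apply, smf_apply,
    ← finsum_add_distrib (smf_finite (supC_expandSub f) hG k) (smf_finite (supC_expandSub g) hG k)]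
  refine finsum_congr fun s => ?_
  rw [← add_smul, expandSub_eq, expandSub_eq, expandSub_eq, HahnSeries.coeff_add, mul_add]

theorem smf_expandSub_C (c : ℂ) (G : ℤ × ℤ → V) :
    smf (expandSub (HahnSeries.C c)) G = c • G := by
  funext k
  rw [Pi.smul_apply, smf_apply, finsum_eq_single _ (0, 0)]
  · rw [expandSub_eq, HahnSeries.C_apply]
    simp only [add_zero, ch_zero, zpow_zero, HahnSeries.coeff_single_same, one_mul]
    rw [show k - (0, 0) = k from sub_zero k]
  · rintro ⟨m, t⟩ hs
    rw [expandSub_eq, HahnSeries.C_apply]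
    simp only
    by_cases h : t + m = 0
    · have hm : m ≠ 0 := fun hm => hs (by rw [hm, show t = 0 by omega])
      rcases lt_or_gt_of_ne hm with h1 | h1
      · rw [ch_neg h1, mul_zero, zero_mul, zero_smul]
      · rw [h, ch_of_lt le_rfl h1, mul_zero, zero_mul, zero_smul]
    · rw [HahnSeries.coeff_single_of_ne h, mul_zero, zero_smul]

theorem IsPS.exists_eq_C_add {f : LC} (hf : IsPS f) : ∃ g : LC, IsPS g ∧
    (∀ n : ℕ, g.coeff n = f.coeff (n + 1)) ∧ f = HahnSeries.C (f.coeff 0) + xL * g := by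
  have h1 : ∀ n : ℤ, (HahnSeries.ofSuppBddBelow (fun n : ℤ => if n < 0 then 0 else f.coeff (n + 1))
      ⟨0, fun n hn => not_lt.mp fun h => hn (if_pos h)⟩ : LC).coeff n =
        if n < 0 then 0 else f.coeff (n + 1) := fun _ => rfl
  refine ⟨_, fun n hn => by rw [h1, if_pos hn], fun n => by rw [h1, if_neg (by omega)], ?_⟩
  ext n
  rw [HahnSeries.coeff_add, xL, HahnSeries.coeff_single_mul, one_mul, h1, HahnSeries.C_apply]
  rcases lt_trichotomy n 0 with h | rfl | h
  · rw [if_pos (by omega), HahnSeries.coeff_single_of_ne h.ne, hf n h, add_zero]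
  · rw [if_pos (by omega), HahnSeries.coeff_single_same, add_zero]
  · rw [if_neg (by omega), HahnSeries.coeff_single_of_ne h.ne', zero_add, sub_add_cancel]

theorem Sop_smf_step {f : LC} {g : LC} (hg : IsPS g)
    (hfg : f = HahnSeries.C (f.coeff 0) + xL * g) {G : ℤ × ℤ → V} (hG : Laur2 G) (J q : ℤ) :
    Sop (smf (expandSub f) G) (J, q) =
      f.coeff 0 • Sop G (J, q) - Sop (smf (expandSub g) G) (J - 1, q) := by
  have h1 : smf (expandSub f) G = f.coeff 0 • G + (-1 : ℂ) • act V e2 dl (smf (expandSub g) G) := by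
    rw [hfg, smf_expandSub_add _ _ hG.trP, smf_expandSub_C, smf_xL_mul _ hG.trP, neg_one_smul,
      ← hfg]
  have h2 := laur2_smf hg.expandSub hG
  have h3 := Sop_dl_pow h2 1 (J - 1, q)
  rw [pow_one, Nat.cast_one, sub_add_cancel] at h3
  rw [h1, Sop_add (hG.smul _) ((h2.act _).smul _), Sop_smul _ hG, Sop_smul _ (h2.act _), ← h3,
    Pi.add_apply, Pi.smul_apply, Pi.smul_apply, neg_one_smul, sub_eq_add_neg]

theorem Sop_smf {f : LC} (hf : IsPS f) {G : ℤ × ℤ → V} (hG : Laur2 G) (J : ℕ) (q : ℤ) :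
    Sop (smf (expandSub f) G) (J, q) =
      ∑ n ∈ Finset.range (J + 1), ((-1 : ℂ) ^ n * f.coeff n) • Sop G (J - n, q) := by
  induction J generalizing f with
  | zero =>
    obtain ⟨g, hg, -, h⟩ := hf.exists_eq_C_add
    rw [Sop_smf_step hg h hG, Sop_of_neg _ (J := ((0 : ℕ) : ℤ) - 1) (by norm_num),
      Finset.sum_range_one]
    simp
  | succ J ih =>
    obtain ⟨g, hg, hgf, h⟩ := hf.exists_eq_C_add
    rw [Sop_smf_step hg h hG, Nat.cast_succ, add_sub_cancel_right, ih hg,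
      Finset.sum_range_succ' _ (J + 1), sub_eq_neg_add, ← Finset.sum_neg_distrib]
    congr 1
    · refine Finset.sum_congr rfl fun n _ => ?_
      rw [hgf, ← neg_smul, pow_succ, Nat.cast_succ, add_sub_add_right_eq_sub]
      congr 1
      ring
    · simp

end Exchange

/-! ### Locality from skew symmetry -/

section SkewLoc

open MvPolynomial (X C aeval)

variable {V : Type*} [AddCommGroup V] [Module ℂ V]
variable {one : V} {L : V →ₗ[ℂ] V} {ψ : V →ₗ[ℂ] EW V}

/-- The linear map sending `v` to the mode `ψ(v)_n w`. -/
def modeMap (ψ : V →ₗ[ℂ] EW V) (w : V) (n : ℤ) : V →ₗ[ℂ] V where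
  toFun v := mf (ψ v) w n
  map_add' u v := by rw [map_add, add_mf]
  map_smul' c v := by rw [map_smul, smul_mf, RingHom.id_apply]

theorem modeMap_apply (w : V) (n : ℤ) (v : V) : modeMap ψ w n v = mf (ψ v) w n := rfl

theorem SF.modeMap_dp (h : SF one L ψ) (a w : V) (j q : ℤ) :
    modeMap ψ w (-q - 1) (dp L j a) = ch (q + j) j • modeMap ψ w (-(q + j) - 1) a := by
  rw [modeMap_apply, ← h.creation_dp, h.hom, h.one, YE_eq (Fu_oneE_right _),
    Sb_eq (Fu_oneE_right _ w), pow_zero, act_one, Sop, finsum_eq_single _ (q + j)]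
  · simp [Fu, Fab, mf_oneE, modeMap_apply]
  · intro m hm
    have h0 : q - m + j ≠ 0 := fun h0 => hm (by omega)
    simp only [Fu, Fab, mf_oneE]
    rw [if_neg (by push_cast; omega), mf_zero, smul_zero]

theorem SF.modeMap_cf_yv (h : SF one L ψ) {u v w : V} {K : ℕ}
    (hK : ∀ w, QLK K (Fu (ψ u) (ψ v) w)) (j q : ℤ) :
    modeMap ψ w (-q - 1) (cf (yv ψ u v) j) =
      Sop (act V e2 (dl ^ K) (Fu (ψ u) (ψ v) w)) (j + K, q) := by
  rw [modeMap_apply, cf_yv, h.hom, YE_eq hK, Sb_eq (hK w)]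
  simp

theorem act_dl_pow_swap (K : ℕ) (F : ℤ × ℤ → V) :
    act V e2 (dl ^ K) (fun p => F (p.2, p.1)) =
      (-1 : ℂ) ^ K • fun p => act V e2 (dl ^ K) F (p.2, p.1) := by
  induction K generalizing F with
  | zero => simp
  | succ K ih =>
    have h1 : act V e2 dl (fun p => F (p.2, p.1)) =
        (-1 : ℂ) • fun p : ℤ × ℤ => act V e2 dl F (p.2, p.1) := by
      funext p
      simp only [dl, act_sub, Pi.sub_apply, Pi.smul_apply, act_X]
      simp [e2]
    rw [pow_succ, act_mul, h1, map_smul, ih, act_mul, pow_succ, smul_smul, mul_comm]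

theorem Laur2.swap {F : ℤ × ℤ → V} (hF : Laur2 F) : Laur2 fun p => F (p.2, p.1) := by
  obtain ⟨N, hN⟩ := hF
  exact ⟨N, fun k hk => hN _ hk.symm⟩

theorem SF.modeMap_sig (h : SF one L ψ) {u v w : V} {K : ℕ}
    (hK : ∀ w, QLK K (Fu (ψ u) (ψ v) w)) (j q : ℤ) :
    modeMap ψ w (-q - 1) (cf (sig L (yv ψ u v)) j) =
      Sop (act V e2 (dl ^ K) fun p => Fu (ψ u) (ψ v) w (p.2, p.1)) (j + K, q) := by
  have h0 : ∀ n : ℤ, modeMap ψ w (-q - 1) (dp L n (cf (negH (yv ψ u v)) (j - n))) =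
      ((-1 : ℂ) ^ (j - n) * ch (q + n) n) •
        Sop (act V e2 (dl ^ K) (Fu (ψ u) (ψ v) w)) (j + K - n, q + n) := fun n => by
    rw [h.modeMap_dp, cf_negH, map_smul, h.modeMap_cf_yv hK, smul_smul, mul_comm,
      show j - n + (K : ℤ) = j + K - n by ring]
  obtain ⟨N, hN⟩ := cf_trunc (yv ψ u v)
  have hfin : (Function.support fun n : ℤ => dp L n (cf (negH (yv ψ u v)) (j - n))).Finite := by
    refine (Set.finite_Icc 0 (j - N)).subset fun n hn => ?_
    by_contra hn'
    refine hn ?_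
    rw [Set.mem_Icc] at hn'
    simp only
    rcases lt_or_ge n 0 with h1 | h1
    · rw [dp_neg L h1, LinearMap.zero_apply]
    · rw [cf_negH, hN _ (by omega), smul_zero, map_zero]
  have h1 : modeMap ψ w (-q - 1) (cf (sig L (yv ψ u v)) j) = ∑ᶠ n : ℤ,
      ((-1 : ℂ) ^ (j - n) * ch (q + n) n) •
        Sop (act V e2 (dl ^ K) (Fu (ψ u) (ψ v) w)) (j + K - n, q + n) := by
    rw [sig, cf_smul]
    simp only [EXP_coeff]
    exact ((modeMap ψ w (-q - 1)).toAddMonoidHom.map_finsum hfin).trans (finsum_congr h0)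
  rw [h1, act_dl_pow_swap, Sop_smul _ (hK w).swap, Pi.smul_apply]
  rcases lt_or_ge (j + K) 0 with hJ | hJ
  · rw [Sop_of_neg _ hJ, smul_zero]
    refine finsum_eq_zero_of_forall_eq_zero fun n => ?_
    rcases lt_or_ge n 0 with h2 | h2
    · rw [ch_neg h2, mul_zero, zero_smul]
    · rw [Sop_of_neg _ (by omega), smul_zero]
  · obtain ⟨J, hJ⟩ := Int.eq_ofNat_of_zero_le hJ
    obtain rfl : j = J - K := by omega
    rw [hJ, ← Sop_swap (hK w), Finset.smul_sum,
      finsum_eq_sum_of_support_subset (s := (Finset.range (J + 1)).map Nat.castEmbedding)]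
    · rw [Finset.sum_map]
      refine Finset.sum_congr rfl fun n hn => ?_
      rw [Nat.castEmbedding_apply, smul_smul, ← mul_assoc]
      congr 2
      have hn := Finset.mem_range.mp hn
      obtain ⟨d, rfl⟩ : ∃ d, J = n + d := ⟨J - n, by omega⟩
      rw [Nat.add_sub_cancel_left, show ((n + d : ℕ) : ℤ) - K - n = d - K by push_cast; ring,
        zpow_sub₀ (by norm_num), zpow_natCast, zpow_natCast, div_eq_mul_inv, mul_comm, ← inv_pow]
      norm_num
    · intro n hn
      rw [Finset.coe_map, Set.mem_image]
      have h2 : 0 ≤ n := by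
        by_contra h2
        exact hn (by simp only; rw [ch_neg (by omega), mul_zero, zero_smul])
      have h3 : n ≤ J := by
        by_contra h3
        exact hn (by simp only; rw [Sop_of_neg _ (by omega), smul_zero])
      exact ⟨n.toNat, by simp; omega, by simp [h2]⟩

theorem SF.modeMap_smul_sig (h : SF one L ψ) {u v w : V} {K : ℕ}
    (hK : ∀ w, QLK K (Fu (ψ u) (ψ v) w)) {f : LC} (hf : IsPS ((-xL) ^ K * (neg1 f : LC)))
    (J : ℕ) (q : ℤ) :
    modeMap ψ w (-q - 1) (cf (f • sig L (yv ψ u v)) (J - (K + K : ℕ))) =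
      Sop (smf (expandSub ((-xL) ^ K * (neg1 f : LC)))
        (act V e2 (dl ^ K) fun p => Fu (ψ u) (ψ v) w (p.2, p.1))) (J, q) := by
  have hG : Laur2 (act V e2 (dl ^ K) fun p => Fu (ψ u) (ψ v) w (p.2, p.1)) := by
    rw [act_dl_pow_swap]
    exact (hK w).swap.smul _
  have h2 : ((-1 : ℂ) ^ K) * (-1) ^ K = 1 := by rw [← mul_pow]; norm_num
  have hcoeff : ∀ n : ℤ, ((-xL) ^ K * (neg1 f : LC)).coeff n = (-1 : ℂ) ^ n * f.coeff (n - K) := by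
    intro n
    rw [coeff_xL_pow_mul, neg1_coeff, smul_eq_mul, zpow_sub₀ (by norm_num), zpow_natCast,
      div_eq_mul_inv, ← inv_pow]
    norm_num
    linear_combination (-1 : ℂ) ^ n * f.coeff (n - K) * h2
  have hf0 : ∀ n : ℤ, n < -K → f.coeff n = 0 := fun n hn => by
    have h3 := hcoeff (n + K)
    rw [hf _ (by omega), add_sub_cancel_right] at h3
    exact (mul_eq_zero.mp h3.symm).resolve_left (zpow_ne_zero _ (by norm_num))
  obtain ⟨N, hN⟩ := cf_trunc (sig L (yv ψ u v))
  have hfin : (Function.support fun n : ℤ =>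
      f.coeff n • cf (sig L (yv ψ u v)) (J - (K + K : ℕ) - n)).Finite := by
    refine (Set.finite_Icc (-(K : ℤ)) (J - (K + K : ℕ) - N)).subset fun n hn => ?_
    by_contra hn'
    refine hn ?_
    rw [Set.mem_Icc] at hn'
    simp only
    rcases lt_or_ge n (-K) with h1 | h1
    · rw [hf0 n h1, zero_smul]
    · rw [hN _ (by omega), smul_zero]
  have h0 : modeMap ψ w (-q - 1) (cf (f • sig L (yv ψ u v)) (J - (K + K : ℕ))) = ∑ᶠ n : ℤ,
      f.coeff n • Sop (act V e2 (dl ^ K) fun p => Fu (ψ u) (ψ v) w (p.2, p.1)) (J - K - n, q) := by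
    rw [cf_LC_smul]
    refine ((modeMap ψ w (-q - 1)).toAddMonoidHom.map_finsum hfin).trans (finsum_congr fun n => ?_)
    change modeMap ψ w (-q - 1) _ = _
    rw [map_smul, h.modeMap_sig hK, show (J : ℤ) - (K + K : ℕ) - n + K = J - K - n by
      push_cast; ring]
  rw [h0, Sop_smf hf hG,
    finsum_eq_sum_of_support_subset
      (s := (Finset.range (J + 1)).image fun n : ℕ => (n : ℤ) - K)]
  · rw [Finset.sum_image fun a _ b _ hab => by simpa using hab]
    refine Finset.sum_congr rfl fun n _ => ?_
    rw [hcoeff, zpow_natCast, ← mul_assoc, ← mul_pow, neg_one_mul, neg_neg, one_pow, one_mul,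
      show (J : ℤ) - K - (n - K) = J - n by ring]
  · intro n hn
    rw [Finset.coe_image, Set.mem_image]
    have h3 : -(K : ℤ) ≤ n := by
      by_contra h3
      exact hn (by simp only; rw [hf0 _ (by omega), zero_smul])
    have h4 : n ≤ J - K := by
      by_contra h4
      exact hn (by simp only; rw [Sop_of_neg _ (by omega), smul_zero])
    exact ⟨(n + K).toNat, by simp; omega, by simp; omega⟩

theorem SF.locP_of_mem (h : SF one L ψ) {u v : V} (hy : yv ψ u v ∈ spS L ψ) :
    LocP ψ Set.univ u v := by
  obtain ⟨r, f, g, hfg⟩ := Submodule.mem_span_set'.mp hy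
  choose p hp using fun i => (g i).2
  choose K₁ hK₁ using fun i => h.pair (p i).1 (p i).2
  choose K₂ hK₂ using fun i => exists_isPS (neg1 (f i) : LC)
  obtain ⟨K₀, hK₀⟩ := h.pair u v
  obtain ⟨K, h0, h1, h2⟩ : ∃ K : ℕ, K₀ ≤ K ∧ (∀ i, K₁ i ≤ K) ∧ ∀ i, K₂ i ≤ K :=
    ⟨K₀ + (Finset.univ.sup K₁ + Finset.univ.sup K₂), by omega,
      fun i => by have := Finset.le_sup (f := K₁) (Finset.mem_univ i); omega,
      fun i => by have := Finset.le_sup (f := K₂) (Finset.mem_univ i); omega⟩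
  have hF := fun i w => (hK₁ i w).mono (h1 i)
  have hps := fun i => hK₂ i K (h2 i)
  refine ⟨K + K, r, fun i => neg1 (f i), fun i => (p i).1, fun i => (p i).2,
    fun _ => trivial, fun _ => trivial, fun w => ?_⟩
  have hG : ∀ i, Laur2 (act V e2 (dl ^ K)
      fun q => Fu (ψ (p i).1) (ψ (p i).2) w (q.2, q.1)) := fun i => by
    rw [act_dl_pow_swap]
    exact (hF i w).swap.smul _
  have hS := Laur2.sum fun i => laur2_smf (hps i).expandSub (hG i)
  have hq : QLK (K + K) (Fu (ψ u) (ψ v) w) := (hK₀ w).mono (by omega)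
  simp only [dl_pow_smf K K _ (trP_Fu_swap _ _ w)]
  refine Sop_inj hq hS.1 (funext fun k => ?_)
  obtain ⟨J, q⟩ := k
  rw [hS.2, Finset.sum_apply]
  rcases lt_or_ge J 0 with hJ | hJ
  · simp only [Sop_of_neg _ hJ, Finset.sum_const_zero]
  · lift J to ℕ using hJ
    have h3 := h.modeMap_cf_yv (w := w) (fun w => (hK₀ w).mono (show K₀ ≤ K + K by omega))
      (J - (K + K : ℕ)) q
    rw [sub_add_cancel] at h3
    rw [← h3, ← hfg, cf_sum, map_sum]
    refine Finset.sum_congr rfl fun i _ => ?_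
    rw [← h.modeMap_smul_sig (hF i) (hps i), ← hp i]

end SkewLoc

/-! ### The skew symmetry span contains all fields -/

section SkewAll

open MvPolynomial (X C aeval)

variable {V : Type*} [AddCommGroup V] [Module ℂ V]
variable {one : V} {L : V →ₗ[ℂ] V} {ψ : V →ₗ[ℂ] EW V}

theorem SF.EA_spS (h : SF one L ψ) {a : V} (ha : ∀ v, LocP ψ Set.univ a v) {x : HV V}
    (hx : x ∈ spS L ψ) :
    ∃ l₀ : ℕ, ∀ l ≥ l₀, ∀ t, (opS V 1 ^ l) (fun t => EA (ψ a) t • x) t ∈ spS L ψ := by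
  induction hx using Submodule.span_induction with
  | mem x hx =>
    obtain ⟨⟨c, b⟩, rfl⟩ := hx
    obtain ⟨k, r, f, vi, ui, -, -, hl⟩ := ha c
    obtain ⟨N, hN⟩ := mem_of_loc_fm (P := fun t => UC (ψ a) t • yv ψ c b) (k := k) (f := f)
      (B := fun i t => yv ψ (vi i) (mf (ψ (ui i)) b (-t - 1))) (M := spY ψ)
      (fun i => yv_mf_trunc_right _ _ _) (fun i t => yv_mem_spY _ _)
      (by rw [fm_UC_yv]; exact hl b)
    refine ⟨N, fun l hl' t => ?_⟩
    simp only [EA_smul_sig (h.dbr a)]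
    have h1 := sig_opS_pow L (ε := -1) (by rw [neg1_neg, neg1_one]) l
      (fun t => UC (ψ a) t • yv ψ c b)
    rw [neg_neg] at h1
    have h2 := (spS L ψ).smul_mem ((-1 : LC) ^ l) (sig_mem_spS (L := L) (hN l hl' t))
    have h3 := congrFun h1 t
    rw [h3, Pi.smul_apply] at h2
    rcases neg_one_pow_eq_or LC l with h4 | h4 <;> rw [h4] at h2
    · rwa [one_smul, one_smul] at h2
    · rwa [neg_one_smul, neg_one_smul, neg_neg] at h2
  | zero =>
    refine ⟨0, fun l _ => ?_⟩
    have : (fun t => EA (ψ a) t • (0 : HV V)) = 0 := funext fun t => smul_zero _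
    rw [this, map_zero]
    exact fun t => Submodule.zero_mem _
  | add x y _ _ hx hy =>
    obtain ⟨l₁, h1⟩ := hx
    obtain ⟨l₂, h2⟩ := hy
    refine ⟨max l₁ l₂, fun l hl t => ?_⟩
    have : (fun t => EA (ψ a) t • (x + y)) =
        (fun t => EA (ψ a) t • x) + fun t => EA (ψ a) t • y := funext fun t => smul_add _ _ _
    rw [this, map_add]
    exact Submodule.add_mem _ (h1 l (by omega) t) (h2 l (by omega) t)
  | smul f x _ hx =>
    obtain ⟨l₀, hl⟩ := hx
    refine ⟨l₀, fun l hl' t => ?_⟩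
    have : (fun t => EA (ψ a) t • f • x) = f • fun t => EA (ψ a) t • x :=
      funext fun t => EE_smul_LC _ _ _
    rw [this, map_smul]
    exact Submodule.smul_mem _ _ (hl l hl' t)

theorem SF.yv_mem_spS (h : SF one L ψ) {S : Set V} (ind : ModeInd one (fun u : S => ψ u))
    (hloc : ∀ u ∈ S, ∀ v ∈ S, LocP ψ S u v) (u v : V) : yv ψ u v ∈ spS L ψ := by
  refine ind (fun u => yv ψ u v ∈ spS L ψ) ?_ ?_ ?_ ?_ ?_ u
  · rw [yv_zero_left]
    exact Submodule.zero_mem _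
  · rw [← sig_sig L (yv ψ one v), ← h.yv_one_right]
    exact sig_yv_mem_spS _ _
  · intro a b ha hb
    rw [yv_add_left]
    exact Submodule.add_mem _ ha hb
  · intro c a ha
    rw [yv_smul_left]
    exact Submodule.smul_mem _ _ ha
  · intro a b n hb
    obtain ⟨l₁, h1⟩ := h.weak_assoc_opS a b v
    obtain ⟨l₂, h2⟩ := h.EA_spS
      (fun w => h.locP_of_mem (h.yv_mem_spS_of_gen ind hloc w a a.2)) hb
    obtain ⟨T, hT⟩ := yv_mf_trunc (ψ := ψ) (ψ a) b v
    have h3 := mem_of_opS_pow (ε := 1) (l₁ + l₂) hT (M := spS L ψ)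
      (fun t => by rw [← h1 _ (by omega)]; exact h2 _ (by omega) t) (-n - 1)
    simpa using h3

theorem SF.isWeakQVA (h : SF one L ψ) {S : Set V} (ind : ModeInd one (fun u : S => ψ u))
    (hloc : ∀ u ∈ S, ∀ v ∈ S, LocP ψ S u v) : IsWeakQVA h.nlva := by
  intro u v
  obtain ⟨k, r, f, vi, ui, -, -, hl⟩ := h.locP_of_mem (h.yv_mem_spS ind hloc u v)
  refine ⟨k, r, f, vi, ui, fun w m t => ?_⟩
  have h1 := congrFun (hl w) (m, t)
  rw [Finset.sum_apply] at h1
  simp only [mulPoly_eq]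
  exact h1

theorem locP_of_sLocal {U : Set V} {Y0 : U → EW V} (hY : ∀ u : U, ψ u = Y0 u)
    (hS : SLocal (Set.range Y0)) : ∀ u ∈ U, ∀ v ∈ U, LocP ψ U u v := by
  intro u hu v hv
  obtain ⟨k, r, f, a, b, ha, hb, hl⟩ := hS _ ⟨⟨u, hu⟩, rfl⟩ _ ⟨⟨v, hv⟩, rfl⟩
  choose ui hui using ha
  choose vi hvi using hb
  refine ⟨k, r, f, fun i => ui i, fun i => vi i, fun i => (ui i).2, fun i => (vi i).2,
    fun w => funext fun p => ?_⟩
  have h1 := hl w p.1 p.2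
  simp only [mulPoly_eq, ← hui, ← hvi, ← hY] at h1
  rw [Finset.sum_apply]
  exact h1

end SkewAll

end NVA

namespace NVA

variable {V : Type*} [AddCommGroup V] [Module ℂ V]

/-- The monomial `u¹_{n₁} ⋯ uʳ_{n_r} 1 ∈ V`, for a family of vertex operators
`Φ : ι → ℰ(V)` acting on `V`. -/
def iterModes (one : V) {ι : Type*} (Φ : ι → EW V) :
    {r : ℕ} → (Fin r → ι) → (Fin r → ℤ) → V
  | 0, _, _ => one
  | _ + 1, us, ns => mf (Φ (us 0)) (iterModes one Φ (Fin.tail us) (Fin.tail ns)) (ns 0)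

theorem modeInd_of_iterModes {U : Set V} {one : V} {Φ : U → EW V}
    (hspan : Submodule.span ℂ {v : V | ∃ (r : ℕ) (us : Fin r → U) (ns : Fin r → ℤ),
      v = iterModes one Φ us ns} = ⊤) : ModeInd one Φ := by
  refine modeInd_of_span _ hspan fun P h1 hm => ?_
  rintro _ ⟨r, us, ns, rfl⟩
  induction r with
  | zero => exact h1
  | succ r ih => exact hm _ _ _ (ih _ _)

/-- cf. Theorem 6.3 / `tqva-construction`.  Let `V` be a vector
space, `1 ∈ V`, `L(-1)` a linear operator on `V`, `U ⊆ V` and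
`Y₀ : U → Hom(V, V((x)))`, `u ↦ u(x)`, satisfying: `L(-1)1 = 0`;
`[L(-1), u(x)] = (d/dx)u(x)`; `u(x)1 ∈ V[[x]]` with `lim_{x→0} u(x)1 = u`;
`Y₀(U)` is quasi compatible; `V` is spanned by the monomials `u¹_{n₁}⋯uʳ_{n_r}1`;
and there is a linear map `ψ : V → ⟨Y₀(U)⟩` with `ψ(1) = 1_V` and
`ψ(uₙv) = u(x)ₙ ψ(v)`.  Then `Y₀` extends uniquely to a nonlocal vertex algebra
structure `(V, Y, 1)`; if moreover `Y₀(U)` is `𝒮`-local, `V` is a weak quantum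
vertex algebra. -/
theorem statement18 {V : Type*} [AddCommGroup V] [Module ℂ V]
    (one : V) (Lm : V →ₗ[ℂ] V) (U : Set V) (Y0 : U → EW V)
    (hL1 : Lm one = 0)
    (hLbr : ∀ (u : U) (v : V) (n : ℤ),
      Lm (mf (Y0 u) v n) - mf (Y0 u) (Lm v) n = (-n : ℂ) • mf (Y0 u) v (n - 1))
    (hcr0 : ∀ (u : U) (n : ℤ), 0 ≤ n → mf (Y0 u) one n = 0)
    (hcr1 : ∀ u : U, mf (Y0 u) one (-1) = (u : V))
    (hqc : QCSet (Set.range Y0))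
    (hspan : Submodule.span ℂ {v : V | ∃ (r : ℕ) (us : Fin r → U) (ns : Fin r → ℤ),
        v = iterModes one Y0 us ns} = ⊤)
    (U' : Submodule ℂ (EW V)) (hU' : IsGenVA (Set.range Y0) U')
    (ψm : V →ₗ[ℂ] EW V) (hψmem : ∀ v : V, ψm v ∈ U') (hψ1 : ψm one = oneE)
    (hψhom : ∀ (u : U) (v : V) (n : ℤ), ψm (mf (Y0 u) v n) = YE (Y0 u) (ψm v) n) :
    ∃ A : NLVA V, A.one = one ∧ (∀ u : U, A.Y (u : V) = Y0 u) ∧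
      (∀ A' : NLVA V, A'.one = one → (∀ u : U, A'.Y (u : V) = Y0 u) → A'.Y = A.Y) ∧
      (SLocal (Set.range Y0) → IsWeakQVA A) := by
  have ind := modeInd_of_iterModes hspan
  have hg := ind.gens hL1 hLbr hcr0 hcr1 hU' hψmem hψ1 hψhom
  refine ⟨hg.sf.nlva, rfl, hg.gen, fun A' h1 hA' => ?_, fun hS => ?_⟩
  · refine NLVA.Y_unique (Y0 := Y0) _ _ h1 hA' hg.gen ind
  · refine hg.sf.isWeakQVA (S := U) ?_ (locP_of_sLocal hg.gen hS)
    rwa [show (fun u : U => ψm u) = Y0 from funext hg.gen]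

end NVA
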